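/- (C. Weber, 1967) Let K be a geometric simplicial complex in ℝ^N with finitely many faces and of dimension at most n (every face has at most n+1 vertices), and let m, n satisfy 2m ≥ 3n + 3. Then there is a continuous injective map (equivalently, a topological embedding) |K| → ℝ^m if and only if there exists a continuous equivariant map from the deleted product of |K| to the unit sphere S^{m-1}, i.e., a continuous g : {(x,y) ∈ |K| × |K| : x ≠ y} → S^{m-1} with g(y,x) = −g(x,y) for all x ≠ y. -/

import Mathlib

namespace HW

open Set Filter Topology MeasureTheory Metric
open scoped NNReal ENNReal

section

section Slab
variable {Ω : Type*} [NormedAddCommGroup Ω] [NormedSpace ℝ Ω] [FiniteDimensional ℝ Ω]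
  [MeasurableSpace Ω] [BorelSpace Ω] {ι : Type*} [Fintype ι]

omit [FiniteDimensional ℝ Ω] [MeasurableSpace Ω] [BorelSpace Ω] in
theorem norm_le_of_comp_sub_id {ρ : (ι → ℝ) →L[ℝ] Ω} {R : Ω →L[ℝ] (ι → ℝ)}
    (h : ‖R.comp ρ - ContinuousLinearMap.id ℝ (ι → ℝ)‖ ≤ 1 / 2) (u : ι → ℝ) :
    ‖u‖ ≤ 2 * ‖R (ρ u)‖ := by
  have h1 := (R.comp ρ - ContinuousLinearMap.id ℝ (ι → ℝ)).le_of_opNorm_le h u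
  have h2 : ‖u‖ ≤ ‖R (ρ u)‖ + ‖(R.comp ρ - ContinuousLinearMap.id ℝ (ι → ℝ)) u‖ := by
    have : u = R (ρ u) - (R.comp ρ - ContinuousLinearMap.id ℝ (ι → ℝ)) u := by simp
    calc ‖u‖ = ‖R (ρ u) - (R.comp ρ - ContinuousLinearMap.id ℝ (ι → ℝ)) u‖ := by rw [← this]
      _ ≤ _ := norm_sub_le _ _
  linarith

theorem measure_slab_le (μ : Measure Ω) [μ.IsAddHaarMeasure] (ρ : (ι → ℝ) →L[ℝ] Ω) (M : ℝ) :
    ∃ C : ℝ≥0∞, C ≠ ∞ ∧ ∀ R : Ω →L[ℝ] (ι → ℝ),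
      ‖R.comp ρ - ContinuousLinearMap.id ℝ (ι → ℝ)‖ ≤ 1 / 2 → ∀ (a : ι → ℝ) (r : ℝ), 0 ≤ r →
      μ {t | t ∈ closedBall 0 M ∧ ‖R t - a‖ ≤ r} ≤ C * ENNReal.ofReal r ^ (Fintype.card ι) := by
  set D := closedBall (0 : Ω) (M + ‖ρ‖) with hD
  have hball : volume (closedBall (0 : ι → ℝ) 1) ≠ 0 :=
    (measure_closedBall_pos volume _ one_pos).ne'
  have hball' : volume (closedBall (0 : ι → ℝ) 1) ≠ ∞ := measure_closedBall_lt_top.ne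
  refine ⟨(volume (closedBall (0 : ι → ℝ) 1))⁻¹ * (μ D * 8 ^ (Fintype.card ι)), ?_, ?_⟩
  · exact ENNReal.mul_ne_top (ENNReal.inv_ne_top.2 hball)
      (ENNReal.mul_ne_top measure_closedBall_lt_top.ne (by simp))
  intro R hR a r hr
  set S := {t | t ∈ closedBall (0 : Ω) M ∧ ‖R t - a‖ ≤ r} with hS
  have hSc : IsClosed S :=
    isClosed_closedBall.inter (isClosed_le (R.continuous.sub continuous_const).norm continuous_const)
  have hSm : MeasurableSet S := hSc.measurableSet
  set B := closedBall (0 : ι → ℝ) 1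
  have hmeas : MeasurableSet {q : (ι → ℝ) × Ω | q.1 ∈ B ∧ q.2 + ρ q.1 ∈ S} := by
    refine (IsClosed.inter ?_ ?_).measurableSet
    · exact isClosed_closedBall.preimage continuous_fst
    · exact hSc.preimage (by fun_prop)
  have key : volume B * μ S ≤ μ D * (ENNReal.ofReal (8 * r)) ^ (Fintype.card ι) := by
    have e1 : (volume.prod μ) {q : (ι → ℝ) × Ω | q.1 ∈ B ∧ q.2 + ρ q.1 ∈ S} = volume B * μ S := by
      rw [Measure.prod_apply hmeas]
      have : ∀ u : ι → ℝ, μ (Prod.mk u ⁻¹' {q : (ι → ℝ) × Ω | q.1 ∈ B ∧ q.2 + ρ q.1 ∈ S})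
          = B.indicator (fun _ => μ S) u := by
        intro u
        by_cases hu : u ∈ B
        · simp only [hu, indicator_of_mem]
          have : (Prod.mk u ⁻¹' {q : (ι → ℝ) × Ω | q.1 ∈ B ∧ q.2 + ρ q.1 ∈ S})
            = (fun t => t + ρ u) ⁻¹' S := by ext t; simp [hu]
          rw [this, measure_preimage_add_right]
        · have : (Prod.mk u ⁻¹' {q : (ι → ℝ) × Ω | q.1 ∈ B ∧ q.2 + ρ q.1 ∈ S}) = ∅ := by
            ext t; simp [hu]
          simp [this, hu]
      simp_rw [this]
      rw [lintegral_indicator isClosed_closedBall.measurableSet, setLIntegral_const, mul_comm]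
    have e2 : (volume.prod μ) {q : (ι → ℝ) × Ω | q.1 ∈ B ∧ q.2 + ρ q.1 ∈ S}
        ≤ μ D * (ENNReal.ofReal (8 * r)) ^ (Fintype.card ι) := by
      rw [Measure.prod_apply_symm hmeas]
      have : ∀ t : Ω, volume ((fun u => (u, t)) ⁻¹' {q : (ι → ℝ) × Ω | q.1 ∈ B ∧ q.2 + ρ q.1 ∈ S})
          ≤ D.indicator (fun _ => (ENNReal.ofReal (8 * r)) ^ (Fintype.card ι)) t := by
        intro t
        rcases ((fun u => (u, t)) ⁻¹' {q : (ι → ℝ) × Ω | q.1 ∈ B ∧ q.2 + ρ q.1 ∈ S}).eq_empty_or_nonempty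
          with h | ⟨u0, hu0⟩
        · rw [h]; simp
        · obtain ⟨hu0B, hu0S⟩ := hu0
          simp only at hu0B hu0S
          have htD : t ∈ D := by
            rw [hD, mem_closedBall_zero_iff]
            have h1 : ‖t + ρ u0‖ ≤ M := by simpa using hu0S.1
            have h2 : ‖ρ u0‖ ≤ ‖ρ‖ := by
              have := ρ.le_opNorm u0
              have h3 : ‖u0‖ ≤ 1 := by simpa [B] using hu0B
              nlinarith [norm_nonneg ρ]
            calc ‖t‖ = ‖(t + ρ u0) - ρ u0‖ := by simp
              _ ≤ _ := norm_sub_le _ _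
              _ ≤ _ := by linarith
          rw [indicator_of_mem htD]
          have hsub : ((fun u => (u, t)) ⁻¹' {q : (ι → ℝ) × Ω | q.1 ∈ B ∧ q.2 + ρ q.1 ∈ S})
              ⊆ closedBall u0 (4 * r) := by
            rintro u ⟨_, huS⟩
            simp only at huS
            rw [mem_closedBall, dist_eq_norm]
            refine (norm_le_of_comp_sub_id hR _).trans ?_
            have h1 := huS.2
            have h2 := hu0S.2
            have : R (ρ (u - u0)) = (R (t + ρ u) - a) - (R (t + ρ u0) - a) := by
              simp only [map_sub, map_add]; abel
            rw [this]
            have := norm_sub_le (R (t + ρ u) - a) (R (t + ρ u0) - a)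
            linarith
          refine (measure_mono hsub).trans ?_
          rw [Real.volume_pi_closedBall _ (by positivity)]
          rw [← ENNReal.ofReal_pow (by positivity)]
          apply ENNReal.ofReal_le_ofReal
          apply le_of_eq; ring
      refine (lintegral_mono this).trans ?_
      rw [lintegral_indicator isClosed_closedBall.measurableSet, setLIntegral_const, mul_comm]
    rw [← e1]; exact e2
  have : μ S ≤ (volume B)⁻¹ * (μ D * (ENNReal.ofReal (8 * r)) ^ (Fintype.card ι)) := by
    calc μ S = (volume B)⁻¹ * (volume B * μ S) := by
          rw [← mul_assoc, ENNReal.inv_mul_cancel hball hball', one_mul]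
      _ ≤ _ := by gcongr
  refine this.trans (le_of_eq ?_)
  rw [ENNReal.ofReal_mul (by norm_num), mul_pow]
  simp [mul_assoc]

end Slab

/-- A map is countably Lipschitz on `T` if `T` is covered by countably many sets on each of which
the map is Lipschitz. -/
def CL {X Y : Type*} [PseudoEMetricSpace X] [PseudoEMetricSpace Y] (F : X → Y) (T : Set X) : Prop :=
  ∃ c : ℕ → Set X, T ⊆ ⋃ n, c n ∧ ∀ n, ∃ K : ℝ≥0, LipschitzOnWith K F (c n)

namespace CL
variable {X Y Z : Type*} [PseudoEMetricSpace X] [PseudoEMetricSpace Y] [PseudoEMetricSpace Z]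

theorem mono {F : X → Y} {S T : Set X} (h : CL F T) (hST : S ⊆ T) : CL F S := by
  obtain ⟨c, hc, hK⟩ := h
  exact ⟨c, hST.trans hc, hK⟩

theorem of_countable {κ : Type*} [Countable κ] {F : X → Y} {T : Set X} (c : κ → Set X)
    (hT : T ⊆ ⋃ n, c n) (hc : ∀ n, CL F (c n)) : CL F T := by
  choose d hd hK using hc
  rcases isEmpty_or_nonempty κ with hκ | hκ
  · exact ⟨fun _ => ∅, by simpa using hT, fun n => ⟨0, by simp⟩⟩
  obtain ⟨φ, hφ⟩ := exists_surjective_nat (κ × ℕ)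
  refine ⟨fun n => d (φ n).1 (φ n).2, fun x hx => ?_, fun n => hK _ _⟩
  obtain ⟨i, hi⟩ := mem_iUnion.1 (hT hx)
  obtain ⟨j, hj⟩ := mem_iUnion.1 (hd i hi)
  obtain ⟨n, hn⟩ := hφ (i, j)
  exact mem_iUnion.2 ⟨n, by rw [hn]; exact hj⟩

theorem _root_.LipschitzOnWith.CL {F : X → Y} {T : Set X} {K : ℝ≥0} (h : LipschitzOnWith K F T) :
    HW.CL F T := ⟨fun _ => T, subset_iUnion (fun _ : ℕ => T) 0, fun _ => ⟨K, h⟩⟩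

theorem _root_.LipschitzWith.CL {F : X → Y} {K : ℝ≥0} (h : LipschitzWith K F) (T : Set X) :
    HW.CL F T := (h.lipschitzOnWith (s := T)).CL

theorem union {F : X → Y} {S T : Set X} (hS : CL F S) (hT : CL F T) : CL F (S ∪ T) :=
  of_countable (fun b : Bool => if b then S else T)
    (fun x hx => by rcases hx with h | h <;> simp [h])
    (fun b => by cases b <;> simpa)

theorem congr {F G : X → Y} {T : Set X} (h : CL F T) (hFG : EqOn F G T) : CL G T := by
  obtain ⟨c, hc, hK⟩ := h
  refine ⟨fun n => c n ∩ T, fun x hx => ?_, fun n => ?_⟩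
  · obtain ⟨i, hi⟩ := mem_iUnion.1 (hc hx)
    exact mem_iUnion.2 ⟨i, hi, hx⟩
  · obtain ⟨K, hK⟩ := hK n
    refine ⟨K, fun x hx y hy => ?_⟩
    rw [← hFG hx.2, ← hFG hy.2]
    exact hK hx.1 hy.1

theorem comp {F : X → Y} {G : Y → Z} {T : Set X} {S : Set Y} (hG : CL G S) (hF : CL F T)
    (h : MapsTo F T S) : CL (fun x => G (F x)) T := by
  obtain ⟨c, hc, hK⟩ := hF
  obtain ⟨d, hd, hL⟩ := hG
  refine of_countable (κ := ℕ × ℕ) (fun q => c q.1 ∩ F ⁻¹' d q.2) (fun x hx => ?_) (fun q => ?_)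
  · obtain ⟨i, hi⟩ := mem_iUnion.1 (hc hx)
    obtain ⟨j, hj⟩ := mem_iUnion.1 (hd (h hx))
    exact mem_iUnion.2 ⟨(i, j), hi, hj⟩
  · obtain ⟨K, hK⟩ := hK q.1
    obtain ⟨L, hL⟩ := hL q.2
    exact (hL.comp (hK.mono inter_subset_left) (fun x hx => hx.2)).CL

theorem lip_comp {F : X → Y} {G : Y → Z} {T : Set X} {K : ℝ≥0} (hG : LipschitzWith K G)
    (hF : CL F T) : CL (fun x => G (F x)) T := (hG.CL univ).comp hF (mapsTo_univ _ _)

theorem prodMk {F : X → Y} {G : X → Z} {T : Set X} (hF : CL F T) (hG : CL G T) :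
    CL (fun x => (F x, G x)) T := by
  obtain ⟨c, hc, hK⟩ := hF
  obtain ⟨d, hd, hL⟩ := hG
  refine of_countable (κ := ℕ × ℕ) (fun q => c q.1 ∩ d q.2) (fun x hx => ?_) (fun q => ?_)
  · obtain ⟨i, hi⟩ := mem_iUnion.1 (hc hx)
    obtain ⟨j, hj⟩ := mem_iUnion.1 (hd hx)
    exact mem_iUnion.2 ⟨(i, j), hi, hj⟩
  · obtain ⟨K, hK⟩ := hK q.1
    obtain ⟨L, hL⟩ := hL q.2
    exact ((hK.mono inter_subset_left).prodMk (hL.mono inter_subset_right)).CL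

theorem pi {ι : Type*} [Fintype ι] {W : ι → Type*} [∀ i, PseudoEMetricSpace (W i)]
    {F : X → ∀ i, W i} {T : Set X} (hF : ∀ i, CL (fun x => F x i) T) : CL F T := by
  choose c hc hK using hF
  refine of_countable (κ := ι → ℕ) (fun q => ⋂ i, c i (q i)) (fun x hx => ?_) (fun q => ?_)
  · have := fun i => mem_iUnion.1 (hc i hx)
    choose q hq using this
    exact mem_iUnion.2 ⟨q, mem_iInter.2 hq⟩
  · choose K hK using fun i => hK i (q i)
    refine (LipschitzOnWith.CL (K := Finset.univ.sup K) fun x hx y hy => ?_)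
    rw [edist_pi_def]
    refine Finset.sup_le fun i _ => ?_
    refine (hK i (mem_iInter.1 hx i) (mem_iInter.1 hy i)).trans ?_
    gcongr
    exact Finset.le_sup (f := K) (Finset.mem_univ i)

theorem sub {E : Type*} [SeminormedAddCommGroup E] {F G : X → E} {T : Set X} (hF : CL F T)
    (hG : CL G T) : CL (fun x => F x - G x) T :=
  lip_comp (G := fun q : E × E => q.1 - q.2) (LipschitzWith.prod_fst.sub LipschitzWith.prod_snd)
    (hF.prodMk hG)

theorem add {E : Type*} [SeminormedAddCommGroup E] {F G : X → E} {T : Set X} (hF : CL F T)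
    (hG : CL G T) : CL (fun x => F x + G x) T :=
  lip_comp (G := fun q : E × E => q.1 + q.2) (LipschitzWith.prod_fst.add LipschitzWith.prod_snd)
    (hF.prodMk hG)

theorem of_locallyLipschitz [SecondCountableTopology X] {F : X → Y} (h : LocallyLipschitz F)
    (T : Set X) : CL F T := by
  choose K t ht hK using h
  obtain ⟨s, hs, hst⟩ := TopologicalSpace.countable_cover_nhds ht
  have := hs.to_subtype
  refine of_countable (κ := s) (fun q => t q) (fun x _ => ?_) (fun q => (hK q).CL)
  have hx : x ∈ ⋃ x ∈ s, t x := by rw [hst]; trivial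
  simpa using hx

end CL

section Sard
variable {X : Type*} [MetricSpace X] [MeasurableSpace X] [BorelSpace X]
  {Ω : Type*} [NormedAddCommGroup Ω] [NormedSpace ℝ Ω] [FiniteDimensional ℝ Ω]
  [MeasurableSpace Ω] [BorelSpace Ω] {ι : Type*} [Fintype ι]

theorem exists_cover_of_hausdorffMeasure_eq_zero {d : ℝ} {s : Set X} (h : μH[d] s = 0)
    {ε : ℝ≥0∞} (hε : 0 < ε) : ∃ c : ℕ → Set X, s ⊆ ⋃ n, c n ∧ (∀ n, ediam (c n) ≤ ε) ∧
      ∑' n, ⨆ _ : (c n).Nonempty, ediam (c n) ^ d < ε := by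
  rw [Measure.hausdorffMeasure_apply] at h
  have h1 := (iSup₂_eq_bot.1 h) ε hε
  rw [bot_eq_zero] at h1
  have h2 := hε
  rw [← h1] at h2
  simp only [iInf_lt_iff] at h2
  obtain ⟨c, hc, hc2, h3⟩ := h2
  exact ⟨c, hc, hc2, h3⟩

theorem ae_hausdorffMeasure_piece (μ : Measure Ω) [μ.IsAddHaarMeasure] {e : ℝ} (he : 0 ≤ e)
    {s : Set X} (hs : μH[e + Fintype.card ι] s = 0)
    {R : X → Ω →L[ℝ] (ι → ℝ)} {a : X → ι → ℝ} {K : ℝ≥0} (hR : LipschitzOnWith K R s)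
    (ha : LipschitzOnWith K a s) (ρ : (ι → ℝ) →L[ℝ] Ω)
    (hρ : ∀ τ ∈ s, ‖(R τ).comp ρ - ContinuousLinearMap.id ℝ (ι → ℝ)‖ ≤ 1 / 2) (M : ℕ) :
    ∀ᵐ t ∂μ, ‖t‖ ≤ M → μH[e] {τ ∈ s | R τ t = a τ} = 0 := by
  classical
  obtain ⟨C, hC, hslab⟩ := measure_slab_le μ ρ (M : ℝ)
  have hεpos : ∀ n : ℕ, (0 : ℝ≥0∞) < (n + 1 : ℝ≥0∞)⁻¹ := fun n =>
    ENNReal.inv_pos.2 (by finiteness)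
  have hεlim : Tendsto (fun n : ℕ => (n + 1 : ℝ≥0∞)⁻¹) atTop (𝓝 0) := by
    have := (ENNReal.tendsto_inv_nat_nhds_zero).comp (tendsto_add_atTop_nat 1)
    simpa [Function.comp_def] using this
  choose c hc hcd hcs using fun n => exists_cover_of_hausdorffMeasure_eq_zero hs (hεpos n)
  let r : ℕ → ℕ → ℝ := fun n i => K * (M + 1) * (ediam (c n i)).toReal
  let S : ℕ → ℕ → Set Ω := fun n i =>
    if h : (c n i ∩ s).Nonempty then
      {t | t ∈ closedBall 0 M ∧ ‖R h.some t - a h.some‖ ≤ r n i} else ∅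
  have hfin : ∀ n i, ediam (c n i) ≠ ∞ := fun n i =>
    ne_top_of_le_ne_top (by simp) (hcd n i)
  have hSm : ∀ n i, MeasurableSet (S n i) := by
    intro n i
    by_cases h : (c n i ∩ s).Nonempty
    · simp only [S, h, dite_true]
      exact (isClosed_closedBall.inter (isClosed_le
        (((R h.some).continuous.sub continuous_const).norm) continuous_const)).measurableSet
    · simp [S, h]
  have hSμ : ∀ n i, μ (S n i) * ediam (c n i) ^ e ≤
      (C * ENNReal.ofReal (K * (M + 1)) ^ (Fintype.card ι)) *
        ⨆ _ : (c n i).Nonempty, ediam (c n i) ^ (e + Fintype.card ι) := by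
    intro n i
    by_cases h : (c n i ∩ s).Nonempty
    · have h' : (c n i).Nonempty := h.mono inter_subset_left
      simp only [S, h, dite_true, h', ciSup_unique]
      have := hslab (R h.some) (hρ _ h.some_mem.2) (a h.some) (r n i) (by positivity)
      calc _ ≤ C * ENNReal.ofReal (r n i) ^ Fintype.card ι * ediam (c n i) ^ e := by gcongr
        _ = _ := by
          simp only [r]
          rw [ENNReal.ofReal_mul (by positivity), ENNReal.ofReal_toReal (hfin n i), mul_pow,
            ENNReal.rpow_add_of_nonneg _ _ he (by positivity), ENNReal.rpow_natCast]
          ring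
    · simp [S, h]
  let F : ℕ → Ω → ℝ≥0∞ := fun n t => ∑' i, (S n i).indicator (fun _ => ediam (c n i) ^ e) t
  have hFm : ∀ n, Measurable (F n) := fun n =>
    Measurable.tsum fun i => measurable_const.indicator (hSm n i)
  have hFint : ∀ n, ∫⁻ t, F n t ∂μ ≤
      (C * ENNReal.ofReal (K * (M + 1)) ^ (Fintype.card ι)) * (n + 1 : ℝ≥0∞)⁻¹ := by
    intro n
    simp only [F]
    rw [lintegral_tsum fun i => (measurable_const.indicator (hSm n i)).aemeasurable]
    calc _ = ∑' i, μ (S n i) * ediam (c n i) ^ e := by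
          congr 1; ext i
          rw [lintegral_indicator (hSm n i)]; simp [mul_comm]
      _ ≤ ∑' i, (C * ENNReal.ofReal (K * (M + 1)) ^ (Fintype.card ι)) *
        ⨆ _ : (c n i).Nonempty, ediam (c n i) ^ (e + Fintype.card ι) :=
          ENNReal.tsum_le_tsum (hSμ n)
      _ ≤ _ := by
          rw [ENNReal.tsum_mul_left]
          gcongr
          exact (hcs n).le
  have hlim : ∫⁻ t, liminf (fun n => F n t) atTop ∂μ = 0 := by
    refine le_antisymm ((lintegral_liminf_le hFm).trans ?_) bot_le
    have h0 : Tendsto (fun n : ℕ => (C * ENNReal.ofReal (K * (M + 1)) ^ (Fintype.card ι)) *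
        (n + 1 : ℝ≥0∞)⁻¹) atTop (𝓝 0) := by
      have := ENNReal.Tendsto.const_mul (a := C * ENNReal.ofReal (K * (M + 1)) ^ (Fintype.card ι))
        hεlim (Or.inr (ENNReal.mul_ne_top hC (by finiteness)))
      simpa using this
    rw [← h0.liminf_eq]
    exact liminf_le_liminf (Eventually.of_forall hFint)
  have hae := (lintegral_eq_zero_iff (Measurable.liminf hFm)).1 hlim
  filter_upwards [hae] with t ht htM
  refine le_antisymm (le_trans ?_ (le_of_eq ht)) bot_le
  have := Measure.hausdorffMeasure_le_liminf_tsum (ι := fun n => {i : ℕ // t ∈ S n i}) (β := ℕ)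
    (l := atTop) e {τ ∈ s | R τ t = a τ} (fun n => (n + 1 : ℝ≥0∞)⁻¹) hεlim (fun n i => c n i)
    (Eventually.of_forall fun n i => hcd n i) (Eventually.of_forall fun n τ hτ => ?_)
  · refine this.trans (le_of_eq ?_)
    congr 1; ext n
    exact tsum_subtype {i : ℕ | t ∈ S n i} (fun i => ediam (c n i) ^ e)
  · obtain ⟨hτs, hτ⟩ := hτ
    obtain ⟨i, hi⟩ := mem_iUnion.1 (hc n hτs)
    refine mem_iUnion.2 ⟨⟨i, ?_⟩, hi⟩
    have h : (c n i ∩ s).Nonempty := ⟨τ, hi, hτs⟩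
    simp only [S, h, dite_true]
    refine ⟨by simpa using htM, ?_⟩
    set τ' := h.some
    have hτ' : τ' ∈ c n i ∩ s := h.some_mem
    have hd : dist τ' τ ≤ (ediam (c n i)).toReal := by
      rw [dist_edist]
      exact ENNReal.toReal_mono (hfin n i) (edist_le_ediam_of_mem hτ'.1 hi)
    have h1 : ‖R τ' - R τ‖ ≤ K * dist τ' τ := by
      rw [← dist_eq_norm]; exact hR.dist_le_mul _ hτ'.2 _ hτs
    have h2 : ‖a τ' - a τ‖ ≤ K * dist τ' τ := by
      rw [← dist_eq_norm]; exact ha.dist_le_mul _ hτ'.2 _ hτs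
    have h3 : R τ' t - a τ' = (R τ' - R τ) t - (a τ' - a τ) := by
      simp [hτ]
    rw [h3]
    have h4 : ‖(R τ' - R τ) t‖ ≤ K * dist τ' τ * M :=
      ((R τ' - R τ).le_opNorm t).trans (by gcongr)
    calc _ ≤ ‖(R τ' - R τ) t‖ + ‖a τ' - a τ‖ := norm_sub_le _ _
      _ ≤ K * dist τ' τ * M + K * dist τ' τ := by linarith
      _ = K * (M + 1) * dist τ' τ := by ring
      _ ≤ r n i := by simp only [r]; gcongr

theorem ae_hausdorffMeasure_eq_zero (μ : Measure Ω) [μ.IsAddHaarMeasure] {e : ℝ} (he : 0 ≤ e)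
    {T : Set X} (hT : μH[e + Fintype.card ι] T = 0)
    {R : X → Ω →L[ℝ] (ι → ℝ)} {a : X → ι → ℝ} (hR : CL R T) (ha : CL a T)
    (hsurj : ∀ τ ∈ T, Function.Surjective (R τ)) :
    ∀ᵐ t ∂μ, μH[e] {τ ∈ T | R τ t = a τ} = 0 := by
  obtain ⟨c, hc, hK⟩ := hR
  obtain ⟨d, hd, hL⟩ := ha
  choose K hK using hK
  choose L hL using hL
  let A := (ι → ℝ) →L[ℝ] Ω
  have : ProperSpace A := FiniteDimensional.proper ℝ A
  let ρ := TopologicalSpace.denseSeq A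
  have key : ∀ q : ℕ × ℕ × ℕ × ℕ, ∀ᵐ t ∂μ, ‖t‖ ≤ q.2.2.2 → μH[e] {τ ∈ {τ ∈ T | τ ∈ c q.1 ∧ τ ∈ d q.2.1 ∧
      ‖(R τ).comp (ρ q.2.2.1) - ContinuousLinearMap.id ℝ (ι → ℝ)‖ ≤ 1 / 2} | R τ t = a τ} = 0 := by
    rintro ⟨n1, n2, j, M⟩
    refine ae_hausdorffMeasure_piece μ he (K := K n1 ⊔ L n2) (measure_mono_null ?_ hT) ?_ ?_ (ρ j)
      (fun τ hτ => hτ.2.2.2) M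
    · exact fun τ hτ => hτ.1
    · exact ((hK n1).mono fun τ hτ => hτ.2.1).weaken le_sup_left
    · exact ((hL n2).mono fun τ hτ => hτ.2.2.1).weaken le_sup_right
  filter_upwards [ae_all_iff.2 key] with t ht
  obtain ⟨M, hM⟩ := exists_nat_ge ‖t‖
  refine measure_mono_null (t := ⋃ q : ℕ × ℕ × ℕ, {τ ∈ {τ ∈ T | τ ∈ c q.1 ∧ τ ∈ d q.2.1 ∧
      ‖(R τ).comp (ρ q.2.2) - ContinuousLinearMap.id ℝ (ι → ℝ)‖ ≤ 1 / 2} | R τ t = a τ}) ?_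
      (measure_iUnion_null fun q => ht (q.1, q.2.1, q.2.2, M) hM)
  rintro τ ⟨hτ, hRt⟩
  obtain ⟨n1, h1⟩ := mem_iUnion.1 (hc hτ)
  obtain ⟨n2, h2⟩ := mem_iUnion.1 (hd hτ)
  obtain ⟨ρ0, hρ0⟩ := (R τ).exists_rightInverse_of_surjective (LinearMap.range_eq_top.2 (hsurj τ hτ))
  have hcont : Continuous fun ρ' : A => ‖(R τ).comp ρ' - ContinuousLinearMap.id ℝ (ι → ℝ)‖ := by
    have : Continuous fun ρ' : A => (R τ).comp ρ' := continuous_const.clm_comp continuous_id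
    exact (this.sub continuous_const).norm
  have hopen : IsOpen {ρ' : A | ‖(R τ).comp ρ' - ContinuousLinearMap.id ℝ (ι → ℝ)‖ < 1 / 2} :=
    isOpen_lt hcont continuous_const
  obtain ⟨_, hj, j, rfl⟩ := (TopologicalSpace.denseRange_denseSeq A).exists_mem_open hopen
    ⟨ρ0, by simp [hρ0]⟩ |> fun ⟨j, hj⟩ => (⟨ρ j, hj, j, rfl⟩ : ∃ x, x ∈ _ ∧ ∃ j, ρ j = x)
  exact mem_iUnion.2 ⟨(n1, n2, j), ⟨hτ, h1, h2, le_of_lt hj⟩, hRt⟩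

theorem ae_forall_ne (μ : Measure Ω) [μ.IsAddHaarMeasure]
    {T : Set X} (hT : μH[(Fintype.card ι : ℝ)] T = 0)
    {R : X → Ω →L[ℝ] (ι → ℝ)} {a : X → ι → ℝ} (hR : CL R T) (ha : CL a T)
    (hsurj : ∀ τ ∈ T, Function.Surjective (R τ)) :
    ∀ᵐ t ∂μ, ∀ τ ∈ T, R τ t ≠ a τ := by
  have := ae_hausdorffMeasure_eq_zero μ le_rfl (by rwa [zero_add]) hR ha hsurj
  filter_upwards [this] with t ht τ hτ hRa
  have h1 : μH[0] ({τ} : Set X) = 0 := measure_mono_null (by simpa using ⟨hτ, hRa⟩) ht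
  rw [Measure.hausdorffMeasure_zero_singleton] at h1
  exact one_ne_zero h1

end Sard

end

section

section HEP

theorem exists_homotopy_extension {Z Z' : Type*} [MetricSpace Z] [TopologicalSpace Z'] {m : ℕ}
    {σ : Z → Z} (hσ : Continuous σ) (hσσ : ∀ z, σ (σ z) = z) {σ' : Z' → Z'}
    {ι : Z' → Z} (hι : IsClosedEmbedding ι) (hισ : ∀ z, ι (σ' z) = σ (ι z))
    {C₀ : Set Z} (hC₀ : IsClosed C₀) (hC₀σ : ∀ z ∈ C₀, σ z ∈ C₀) (hdisj : ∀ z, ι z ∉ C₀)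
    {g : Z → Fin m → ℝ} (hg : Continuous g) (hgσ : ∀ z, g (σ z) = -g z) (hg0 : ∀ z, g z ≠ 0)
    {H : unitInterval × Z' → Fin m → ℝ} (hH : Continuous H) (hHσ : ∀ s z, H (s, σ' z) = -H (s, z))
    (hH0 : ∀ q, H q ≠ 0) (hHg : ∀ z, H (0, z) = g (ι z)) :
    ∃ G : unitInterval × Z → Fin m → ℝ, Continuous G ∧ (∀ s z, G (s, σ z) = -G (s, z)) ∧ (∀ q, G q ≠ 0) ∧
      (∀ z, G (0, z) = g z) ∧ (∀ s z, G (s, ι z) = H (s, z)) ∧ ∀ s, ∀ z ∈ C₀, G (s, z) = g z := by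
  have hι' : IsClosedEmbedding (Prod.map (id : unitInterval → unitInterval) ι) :=
    IsClosedEmbedding.id.prodMap hι
  obtain ⟨H₁, hH₁⟩ := ContinuousMap.exists_extension' (hι') (⟨H, hH⟩ : C(unitInterval × Z', Fin m → ℝ))
  have hH₁' : ∀ s z, H₁ (s, ι z) = H (s, z) := fun s z => congrFun hH₁ (s, z)
  let H₂ : unitInterval × Z → Fin m → ℝ := fun q => H₁ q + (g q.2 - H₁ (0, q.2))
  have hH₂c : Continuous H₂ := by fun_prop
  have hH₂0 : ∀ z, H₂ (0, z) = g z := fun z => by simp [H₂]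
  have hH₂ι : ∀ s z, H₂ (s, ι z) = H (s, z) := fun s z => by simp [H₂, hH₁', hHg]
  let H₃ : unitInterval × Z → Fin m → ℝ := fun q => (1 / 2 : ℝ) • (H₂ q - H₂ (q.1, σ q.2))
  have hH₃c : Continuous H₃ := by fun_prop
  have hH₃0 : ∀ z, H₃ (0, z) = g z := fun z => by
    simp only [H₃, hH₂0, hgσ]; ext i; simp; ring
  have hH₃ι : ∀ s z, H₃ (s, ι z) = H (s, z) := fun s z => by
    simp only [H₃, hH₂ι, ← hισ, hHσ]; ext i; simp; ring
  have hH₃σ : ∀ s z, H₃ (s, σ z) = -H₃ (s, z) := fun s z => by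
    simp only [H₃, hσσ]; ext i; simp; ring
  let C : Set Z := C₀ ∪ Prod.snd '' (H₃ ⁻¹' {0})
  have hC : IsClosed C := hC₀.union
    (isClosedMap_snd_of_compactSpace _ (isClosed_singleton.preimage hH₃c))
  have hCσ : ∀ z, z ∈ C → σ z ∈ C := by
    rintro z (hz | ⟨⟨s, z'⟩, hz, rfl⟩)
    · exact Or.inl (hC₀σ z hz)
    · refine Or.inr ⟨(s, σ z'), ?_, rfl⟩
      have : H₃ (s, z') = 0 := hz
      simp [hH₃σ, this]
  have hCι : Disjoint C (range ι) := by
    rw [Set.disjoint_left]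
    rintro _ (hz | ⟨⟨s, z'⟩, hz, rfl⟩) ⟨w, rfl⟩
    · exact hdisj w hz
    · have : H₃ (s, ι w) = 0 := hz
      exact hH0 (s, w) (by rw [← hH₃ι, this])
  obtain ⟨u, hu0, hu1, huI⟩ := exists_continuous_zero_one_of_isClosed hC hι.isClosed_range hCι
  let w : Z → unitInterval := fun z => ⟨(u z + u (σ z)) / 2, by
    have h1 := huI z; have h2 := huI (σ z)
    exact ⟨by linarith [h1.1, h2.1], by linarith [h1.2, h2.2]⟩⟩
  have hwc : Continuous w := by
    apply Continuous.subtype_mk; fun_prop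
  have hwσ : ∀ z, w (σ z) = w z := fun z => by
    apply Subtype.ext; simp [w, hσσ, add_comm]
  have hw0 : ∀ z ∈ C, w z = 0 := fun z hz => by
    apply Subtype.ext
    have h1 := hu0 hz; have h2 := hu0 (hCσ z hz)
    simp [w, h1, h2]
  have hw1 : ∀ z, w (ι z) = 1 := fun z => by
    apply Subtype.ext
    have h1 := hu1 (mem_range_self z); have h2 := hu1 (mem_range_self (σ' z))
    rw [hισ] at h2
    simp only [Pi.one_apply] at h1 h2
    simp [w, h1, h2]
  refine ⟨fun q => H₃ (q.1 * w q.2, q.2), ?_, ?_, ?_, ?_, ?_, ?_⟩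
  · have : Continuous fun q : unitInterval × Z => q.1 * w q.2 := by fun_prop
    fun_prop
  · intro s z; simp only [hwσ, hH₃σ]
  · rintro ⟨s, z⟩ h0
    simp only at h0
    by_cases hz : z ∈ C
    · rw [hw0 z hz, mul_zero, hH₃0] at h0
      exact hg0 z h0
    · exact hz (Or.inr ⟨_, h0, rfl⟩)
  · intro z; simp only [zero_mul, hH₃0]
  · intro s z; simp only [hw1, mul_one, hH₃ι]
  · intro s z hz
    simp only [hw0 z (Or.inl hz), mul_zero, hH₃0]

end HEP

/-- The deleted product of a space. -/
abbrev DP (X : Type*) := {p : X × X // p.1 ≠ p.2}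

/-- The involution of the deleted product. -/
def DP.swap {X : Type*} (p : DP X) : DP X := ⟨(p.1.2, p.1.1), fun h => p.2 h.symm⟩

section Odd
variable {X : Type*} {m : ℕ}

theorem DP.swap_swap (p : DP X) : p.swap.swap = p := rfl

variable [TopologicalSpace X]

theorem DP.continuous_swap : Continuous (DP.swap : DP X → DP X) := by
  unfold DP.swap
  fun_prop

/-- Equivariant maps from the deleted product to a punctured vector space. -/
structure IsOdd (g : DP X → Fin m → ℝ) : Prop where
  cont : Continuous g
  odd : ∀ p, g p.swap = -g p
  ne : ∀ p, g p ≠ 0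

/-- Equivariant homotopy of equivariant maps. -/
def ElemHom (g₀ g₁ : DP X → Fin m → ℝ) : Prop :=
  ∃ G : unitInterval × DP X → Fin m → ℝ, Continuous G ∧ (∀ s p, G (s, p.swap) = -G (s, p)) ∧ (∀ q, G q ≠ 0) ∧
    (∀ p, G (0, p) = g₀ p) ∧ ∀ p, G (1, p) = g₁ p

/-- The transitive closure of equivariant homotopy. -/
def AHom (g₀ g₁ : DP X → Fin m → ℝ) : Prop := Relation.ReflTransGen ElemHom g₀ g₁

theorem ElemHom.aHom {g₀ g₁ : DP X → Fin m → ℝ} (h : ElemHom g₀ g₁) : AHom g₀ g₁ :=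
  Relation.ReflTransGen.single h

theorem AHom.trans {g₀ g₁ g₂ : DP X → Fin m → ℝ} (h : AHom g₀ g₁) (h' : AHom g₁ g₂) : AHom g₀ g₂ :=
  Relation.ReflTransGen.trans h h'

theorem ElemHom.of_segment {g₀ g₁ : DP X → Fin m → ℝ} (h₀ : IsOdd g₀) (h₁ : IsOdd g₁)
    (h : ∀ p, ∀ s : ℝ, 0 ≤ s → s ≤ 1 → (1 - s) • g₀ p + s • g₁ p ≠ 0) : ElemHom g₀ g₁ := by
  have h0 := h₀.cont
  have h1 := h₁.cont
  refine ⟨fun q => (1 - (q.1 : ℝ)) • g₀ q.2 + (q.1 : ℝ) • g₁ q.2, by fun_prop, ?_, ?_, ?_, ?_⟩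
  · intro s p
    simp only [h₀.odd, h₁.odd]
    module
  · exact fun q => h q.2 q.1 q.1.2.1 q.1.2.2
  · intro p; simp
  · intro p; simp

end Odd

/-- A homotopy on a closed invariant part of the deleted product extends. -/
theorem IsOdd.extend {X Z' : Type*} [MetricSpace X] [TopologicalSpace Z'] {m : ℕ}
    {σ' : Z' → Z'} {ι : Z' → DP X} (hι : IsClosedEmbedding ι) (hισ : ∀ z, ι (σ' z) = (ι z).swap)
    {C₀ : Set (DP X)} (hC₀ : IsClosed C₀) (hC₀σ : ∀ z ∈ C₀, z.swap ∈ C₀) (hdisj : ∀ z, ι z ∉ C₀)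
    {g : DP X → Fin m → ℝ} (hg : IsOdd g)
    {H : unitInterval × Z' → Fin m → ℝ} (hH : Continuous H) (hHσ : ∀ s z, H (s, σ' z) = -H (s, z))
    (hH0 : ∀ q, H q ≠ 0) (hHg : ∀ z, H (0, z) = g (ι z)) :
    ∃ g', IsOdd g' ∧ ElemHom g g' ∧ (∀ z, g' (ι z) = H (1, z)) ∧ ∀ z ∈ C₀, g' z = g z := by
  obtain ⟨G, hG, hGσ, hG0, hGg, hGι, hGC⟩ := exists_homotopy_extension DP.continuous_swap
    DP.swap_swap hι hισ hC₀ hC₀σ hdisj hg.cont hg.odd hg.ne hH hHσ hH0 hHg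
  refine ⟨fun z => G (1, z), ⟨by fun_prop, fun p => hGσ 1 p, fun p => hG0 _⟩,
    ⟨G, hG, hGσ, hG0, hGg, fun p => rfl⟩, fun z => hGι 1 z, fun z hz => hGC 1 z hz⟩

/-- The map of deleted products induced by an injective map. -/
def DP.map {X Y : Type*} (j : X → Y) (hj : Function.Injective j) (p : DP X) : DP Y :=
  ⟨(j p.1.1, j p.1.2), fun h => p.2 (hj h)⟩

theorem DP.isClosedEmbedding_map {X Y : Type*} [TopologicalSpace X] [TopologicalSpace Y] {j : X → Y}
    (hj : IsClosedEmbedding j) : IsClosedEmbedding (DP.map j hj.injective) := by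
  have h1 : IsClosedEmbedding (Prod.map j j) := hj.prodMap hj
  have hcont : Continuous (DP.map j hj.injective) := by
    have := hj.continuous
    unfold DP.map
    fun_prop
  refine ⟨⟨?_, ?_⟩, ?_⟩
  · have h2 : IsInducing ((Subtype.val : DP Y → Y × Y) ∘ DP.map j hj.injective) :=
      (h1.isInducing.comp IsInducing.subtypeVal :
        IsInducing (Prod.map j j ∘ (Subtype.val : DP X → X × X)))
    exact IsInducing.of_comp hcont continuous_subtype_val h2
  · intro p q h
    have h2 := congrArg Subtype.val h
    simp only [DP.map, Prod.mk.injEq] at h2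
    exact Subtype.ext (Prod.ext (hj.injective h2.1) (hj.injective h2.2))
  · have : range (DP.map j hj.injective) = (Subtype.val : DP Y → Y × Y) ⁻¹' range (Prod.map j j) := by
      ext ⟨q, hq⟩
      constructor
      · rintro ⟨p, hp⟩
        exact ⟨p.1, congrArg Subtype.val hp⟩
      · rintro ⟨⟨x, y⟩, hp⟩
        simp only [Prod.map] at hp
        refine ⟨⟨(x, y), fun h => hq ?_⟩, Subtype.ext hp⟩
        simp only at h
        rw [← hp, h]
    rw [this]
    exact h1.isClosed_range.preimage continuous_subtype_val

theorem AHom.exists_extension {X Y : Type*} [TopologicalSpace X] [MetricSpace Y] {m : ℕ} {j : X → Y}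
    (hj : IsClosedEmbedding j) {h₀ h₁ : DP X → Fin m → ℝ} (h : AHom h₀ h₁)
    (he : ∃ g : DP Y → Fin m → ℝ, IsOdd g ∧ ∀ p, g (DP.map j hj.injective p) = h₀ p) :
    ∃ g : DP Y → Fin m → ℝ, IsOdd g ∧ ∀ p, g (DP.map j hj.injective p) = h₁ p := by
  induction h with
  | refl => exact he
  | tail _ hstep ih =>
    obtain ⟨g, hg, hgj⟩ := ih
    obtain ⟨G, hG, hGσ, hG0, hGs, hGe⟩ := hstep
    obtain ⟨g', hg', _, hg'j, _⟩ := hg.extend (σ' := DP.swap) (DP.isClosedEmbedding_map hj)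
      (fun z => rfl) isClosed_empty (by simp) (by simp) hG hGσ hG0 (fun z => by rw [hGs, hgj])
    exact ⟨g', hg', fun p => by rw [hg'j, hGe]⟩

end

section

theorem summable_smul_of_bounded {X E : Type*} [NormedAddCommGroup E]
    [NormedSpace ℝ E] [CompleteSpace E] {φ : ℕ → X → ℝ} (hφ : ∀ n x, |φ n x| ≤ 1)
    {u : ℕ → E} (hu : Summable fun n => ‖u n‖) (x : X) :
    Summable fun n => φ n x • u n := by
  refine Summable.of_norm_bounded hu fun n => ?_
  rw [norm_smul, Real.norm_eq_abs]
  exact mul_le_of_le_one_left (norm_nonneg _) (hφ n x)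

theorem lipschitzWith_tsum_smul {X E : Type*} [PseudoMetricSpace X] [NormedAddCommGroup E]
    [NormedSpace ℝ E] [CompleteSpace E] {φ : ℕ → X → ℝ} (hφ : ∀ n x, |φ n x| ≤ 1)
    (hφd : ∀ n x y, |φ n x - φ n y| ≤ dist x y) {u : ℕ → E} (hu : Summable fun n => ‖u n‖) :
    ∃ K, LipschitzWith K fun x => ∑' n, φ n x • u n := by
  have hS : 0 ≤ ∑' n, ‖u n‖ := tsum_nonneg fun n => norm_nonneg _
  refine ⟨⟨_, hS⟩, LipschitzWith.of_dist_le_mul fun x y => ?_⟩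
  rw [dist_eq_norm, ← (summable_smul_of_bounded hφ hu x).tsum_sub
    (summable_smul_of_bounded hφ hu y)]
  refine tsum_of_norm_bounded (hu.hasSum.mul_right (dist x y)) fun n => ?_
  rw [← sub_smul, norm_smul, Real.norm_eq_abs, mul_comm]
  exact mul_le_mul_of_nonneg_left (hφd n x y) (norm_nonneg _)

/-- Local constants in a convex family glue to a continuous, countably Lipschitz map. -/
theorem exists_CL_approx {X V : Type*} [PseudoMetricSpace X] [SecondCountableTopology X]
    [NormedAddCommGroup V] [NormedSpace ℝ V] [CompleteSpace V] {e₀ : X → V} (he₀ : Continuous e₀)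
    {δ : X → ℝ} (hδ : Continuous δ) (hδ0 : ∀ x, 0 < δ x) :
    ∃ F : X → V, Continuous F ∧ CL F univ ∧ (∀ x, ‖F x - e₀ x‖ ≤ δ x) ∧
      ∀ x, e₀ x = 0 → F x = 0 := by
  classical
  have hloc : ∀ x, ∃ r : ℝ, 0 < r ∧ r ≤ 1 ∧ ∃ v : V, ∀ y, dist y x < r →
      ‖v - e₀ y‖ ≤ δ y ∧ (e₀ y = 0 → v = 0) := by
    intro x
    have key : ∃ v : V, ∀ᶠ y in 𝓝 x, ‖v - e₀ y‖ ≤ δ y ∧ (e₀ y = 0 → v = 0) := by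
      by_cases hx : e₀ x = 0
      · refine ⟨0, ?_⟩
        have : ∀ᶠ y in 𝓝 x, ‖(0 : V) - e₀ y‖ < δ y :=
          (continuous_const.sub he₀).norm.continuousAt.eventually_lt hδ.continuousAt
            (by simpa [hx] using hδ0 x)
        filter_upwards [this] with y hy using ⟨hy.le, fun _ => rfl⟩
      · refine ⟨e₀ x, ?_⟩
        have h1 : ∀ᶠ y in 𝓝 x, ‖e₀ x - e₀ y‖ < δ y :=
          (continuous_const.sub he₀).norm.continuousAt.eventually_lt hδ.continuousAt
            (by simpa using hδ0 x)
        have h2 : ∀ᶠ y in 𝓝 x, e₀ y ≠ 0 := he₀.continuousAt.eventually_ne hx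
        filter_upwards [h1, h2] with y hy hy' using ⟨hy.le, fun h => absurd h hy'⟩
    obtain ⟨v, hv⟩ := key
    obtain ⟨r, hr, hr'⟩ := Metric.eventually_nhds_iff.1 hv
    exact ⟨min r 1, lt_min hr one_pos, min_le_right _ _, v,
      fun y hy => hr' (hy.trans_le (min_le_left _ _))⟩
  rcases isEmpty_or_nonempty X with hX | hX
  · exact ⟨0, continuous_zero, ⟨fun _ => ∅, fun x => (hX.false x).elim, fun _ => ⟨0, by simp⟩⟩,
      fun x => (hX.false x).elim, fun x => (hX.false x).elim⟩
  choose r hr hr1 v hv using hloc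
  obtain ⟨s, hs, hst⟩ := TopologicalSpace.countable_cover_nhds
    (f := fun x => ball x (r x)) (fun x => ball_mem_nhds x (hr x))
  have hsne : s.Nonempty := by
    by_contra h
    rw [not_nonempty_iff_eq_empty] at h
    rw [h] at hst
    simp only [mem_empty_iff_false, iUnion_of_empty, iUnion_empty] at hst
    exact empty_ne_univ hst
  obtain ⟨a, rfl⟩ := hs.exists_eq_range hsne
  let φ : ℕ → X → ℝ := fun n x => max 0 (r (a n) - dist x (a n))
  have hφ0 : ∀ n x, 0 ≤ φ n x := fun n x => le_max_left _ _
  have hφ1 : ∀ n x, φ n x ≤ 1 := fun n x => max_le zero_le_one (by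
    have := hr1 (a n); have := dist_nonneg (x := x) (y := a n); linarith)
  have hφd : ∀ n x y, |φ n x - φ n y| ≤ dist x y := fun n x y => by
    simp only [φ]
    rw [max_comm, max_comm (0:ℝ) (r (a n) - dist y (a n))]
    refine (abs_max_sub_max_le_abs _ _ _).trans ?_
    rw [sub_sub_sub_cancel_left, abs_sub_comm]
    exact abs_dist_sub_le x y (a n)
  have hφa : ∀ n x, |φ n x| ≤ 1 := fun n x => by rw [abs_of_nonneg (hφ0 n x)]; exact hφ1 n x
  let w : ℕ → ℝ := fun n => (1 / 2) ^ n / (1 + ‖v (a n)‖)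
  have hw0 : ∀ n, 0 < w n := fun n => by
    have := norm_nonneg (v (a n)); positivity
  have hgeo : Summable fun n : ℕ => ((1 : ℝ) / 2) ^ n := summable_geometric_two
  have hw1 : Summable fun n => ‖w n‖ := by
    refine Summable.of_nonneg_of_le (fun n => norm_nonneg _) (fun n => ?_) hgeo
    rw [Real.norm_of_nonneg (hw0 n).le]
    exact div_le_self (by positivity) (by have := norm_nonneg (v (a n)); linarith)
  have hwv : Summable fun n => ‖w n • v (a n)‖ := by
    refine Summable.of_nonneg_of_le (fun n => norm_nonneg _) (fun n => ?_) hgeo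
    rw [norm_smul, Real.norm_of_nonneg (hw0 n).le]
    have h1 := norm_nonneg (v (a n))
    simp only [w]
    rw [div_mul_eq_mul_div, div_le_iff₀ (by positivity)]
    have : (0 : ℝ) < (1 / 2) ^ n := by positivity
    nlinarith
  obtain ⟨KA, hKA⟩ := lipschitzWith_tsum_smul hφa hφd hwv
  obtain ⟨KB, hKB⟩ := lipschitzWith_tsum_smul hφa hφd hw1
  have sA := summable_smul_of_bounded hφa hwv
  have sB := summable_smul_of_bounded hφa hw1
  set A : X → V := fun x => ∑' n, φ n x • w n • v (a n) with hA
  set B : X → ℝ := fun x => ∑' n, φ n x • w n with hB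
  have hB0 : ∀ x, 0 < B x := by
    intro x
    have hx : x ∈ ⋃ x ∈ range a, ball x (r x) := by rw [hst]; trivial
    simp only [mem_range, iUnion_exists, iUnion_iUnion_eq', mem_iUnion, mem_ball] at hx
    obtain ⟨n, hn⟩ := hx
    refine (sB x).tsum_pos (fun k => mul_nonneg (hφ0 k x) (hw0 k).le) n ?_
    exact mul_pos (lt_max_of_lt_right (by linarith)) (hw0 n)
  have hF : LocallyLipschitz fun x => (B x)⁻¹ • A x := by
    intro x
    have h1 : ContDiffAt ℝ 1 (fun q : ℝ × V => q.1⁻¹ • q.2) (B x, A x) := by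
      refine ContDiffAt.smul ?_ contDiffAt_snd
      exact contDiffAt_fst.inv (hB0 x).ne'
    obtain ⟨K, t, ht, hK⟩ := h1.exists_lipschitzOnWith
    have h2 : LipschitzWith _ fun x => (B x, A x) := hKB.prodMk hKA
    refine ⟨_, _, h2.continuous.continuousAt.preimage_mem_nhds ht,
      hK.comp (h2.lipschitzOnWith) (fun y hy => hy)⟩
  refine ⟨_, hF.continuous, CL.of_locallyLipschitz hF univ, fun x => ?_, fun x hx => ?_⟩
  · have e1 : (B x)⁻¹ • A x - e₀ x = (B x)⁻¹ • ∑' n, φ n x • w n • (v (a n) - e₀ x) := by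
      have : ∑' n, φ n x • w n • (v (a n) - e₀ x) = A x - B x • e₀ x := by
        have h3 : Summable fun n => φ n x • w n • e₀ x := by
          simpa only [smul_assoc] using (sB x).smul_const (e₀ x)
        simp only [smul_sub]
        rw [(sA x).tsum_sub h3, hB]
        congr 1
        rw [← (sB x).tsum_smul_const]
        simp only [smul_assoc]
      rw [this, smul_sub, inv_smul_smul₀ (hB0 x).ne']
    rw [e1, norm_smul, Real.norm_of_nonneg (inv_nonneg.2 (hB0 x).le), inv_mul_le_iff₀ (hB0 x)]
    refine tsum_of_norm_bounded ((sB x).hasSum.mul_right (δ x)) fun n => ?_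
    rw [norm_smul, norm_smul, Real.norm_of_nonneg (hw0 n).le, Real.norm_of_nonneg (hφ0 n x),
      smul_eq_mul, mul_assoc]
    rcases (hφ0 n x).eq_or_lt with h | h
    · simp [← h]
    · have : dist x (a n) < r (a n) := by
        by_contra h4
        exact h.ne' (max_eq_left (by linarith))
      exact mul_le_mul_of_nonneg_left (mul_le_mul_of_nonneg_left (hv _ _ this).1 (hw0 n).le)
        (hφ0 n x)
  · have : A x = 0 := by
      simp only [hA]
      convert tsum_zero with n
      rcases (hφ0 n x).eq_or_lt with h | h
      · simp [← h]
      · have : dist x (a n) < r (a n) := by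
          by_contra h4
          exact h.ne' (max_eq_left (by linarith))
        rw [(hv _ _ this).2 hx]; simp
    simp [this]

end

section

theorem exists_radial_minorant {Y : Type*} [NormedAddCommGroup Y] [ProperSpace Y]
    {γ : Y → ℝ} (hγ : Continuous γ) (hγ0 : ∀ u, 0 < γ u) :
    ∃ φ : ℝ → ℝ, ContDiff ℝ (⊤ : ℕ∞) φ ∧ (∀ s, 0 < φ s) ∧ (∀ s, deriv φ s ≤ 0) ∧
      ∀ u, φ (‖u‖ ^ 2) ≤ γ u ∧ 2 * ‖u‖ * |deriv φ (‖u‖ ^ 2)| ≤ γ u := by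
  obtain ⟨b, hb⟩ : ∃ b : C(ℝ, ℝ), ContDiff ℝ (⊤ : ℕ∞) b ∧
      ∀ t, 0 < b t ∧ ∀ u, ‖u‖ ^ 2 ≤ t → b t ≤ Real.exp (-t) * γ u := by
    have hconv : ∀ t : ℝ, Convex ℝ {c : ℝ | 0 < c ∧ ∀ u, ‖u‖ ^ 2 ≤ t → c ≤ Real.exp (-t) * γ u} := by
      intro t
      refine (convex_Ioi (0 : ℝ)).inter (t := {c : ℝ | ∀ u, ‖u‖ ^ 2 ≤ t → c ≤ Real.exp (-t) * γ u}) ?_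
      simp only [Set.ofPred_forall]
      exact convex_iInter fun u => convex_iInter fun _ => convex_Iic _
    obtain ⟨g, hg⟩ := exists_contMDiffMap_forall_mem_convex_of_local_const (n := (⊤ : ℕ∞))
      (modelWithCornersSelf ℝ ℝ) hconv (fun t => by
        have hne : (closedBall (0 : Y) (|t| + 1)).Nonempty := ⟨0, by simp; positivity⟩
        obtain ⟨u₀, -, hu₀⟩ := (isCompact_closedBall (0 : Y) (|t| + 1)).exists_isMinOn hne
          hγ.continuousOn
        refine ⟨Real.exp (-(t + 1)) * γ u₀, ?_⟩
        have : ∀ᶠ y in 𝓝 t, y < t + 1 := eventually_lt_nhds (by linarith)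
        filter_upwards [this] with y hy
        refine ⟨mul_pos (Real.exp_pos _) (hγ0 _), fun u hu => ?_⟩
        have h1 : ‖u‖ ^ 2 ≤ t + 1 := hu.trans hy.le
        have h2 : ‖u‖ ≤ |t| + 1 := by
          have := le_abs_self t
          have := abs_nonneg t
          nlinarith [norm_nonneg u]
        have h3 : γ u₀ ≤ γ u := hu₀ (by simpa using h2)
        have h4 : Real.exp (-(t + 1)) ≤ Real.exp (-y) := Real.exp_le_exp.2 (by linarith)
        exact mul_le_mul h4 h3 (hγ0 _).le (Real.exp_pos _).le)
    exact ⟨⟨g, g.contMDiff.continuous⟩, g.contMDiff.contDiff, hg⟩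
  obtain ⟨hbs, hb⟩ := hb
  have hbc : Continuous b := b.continuous
  have hinter : ∀ s, 0 ≤ s → IntegrableOn b (Ioi s) := by
    intro s hs
    have h1 : IntegrableOn (fun t => Real.exp (-t) * γ 0) (Ioi s) :=
      (integrableOn_exp_neg_Ioi s).mul_const _
    refine h1.mono' hbc.aestronglyMeasurable.restrict ?_
    filter_upwards [ae_restrict_mem measurableSet_Ioi] with t ht
    rw [Real.norm_of_nonneg (hb t).1.le]
    exact (hb t).2 0 (by simpa using hs.trans (le_of_lt ht))
  let φ : ℝ → ℝ := fun s => (∫ t in Ioi 0, b t) - ∫ t in (0 : ℝ)..s, b t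
  have hd : ∀ s, HasDerivAt φ (-b s) s := fun s => by
    have := (intervalIntegral.integral_hasDerivAt_right (hbc.intervalIntegrable 0 s)
      (hbc.stronglyMeasurableAtFilter _ _) hbc.continuousAt).const_sub (∫ t in Ioi 0, b t)
    exact this
  have hd' : deriv φ = fun s => -b s := funext fun s => (hd s).deriv
  have hφI : ∀ s, 0 ≤ s → φ s = ∫ t in Ioi s, b t := fun s hs => by
    simp only [φ]
    rw [← intervalIntegral.integral_interval_add_Ioi (hinter 0 le_rfl) (hinter s hs)]
    ring
  have hφa : Antitone φ := antitone_of_deriv_nonpos (fun s => (hd s).differentiableAt)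
    (fun s => by rw [hd']; exact neg_nonpos.2 (hb s).1.le)
  have hpos : ∀ s, 0 ≤ s → 0 < φ s := fun s hs => by
    rw [hφI s hs, setIntegral_pos_iff_support_of_nonneg_ae]
    · have : Function.support b = univ := by
        ext t; simpa using (hb t).1.ne'
      simp [this]
    · exact Eventually.of_forall fun t => (hb t).1.le
    · exact hinter s hs
  refine ⟨φ, ?_, fun s => ?_, fun s => ?_, fun u => ⟨?_, ?_⟩⟩
  · rw [contDiff_infty_iff_deriv]
    exact ⟨fun s => (hd s).differentiableAt, by rw [hd']; exact hbs.neg⟩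
  · exact (hpos (max s 0) (le_max_right _ _)).trans_le (hφa (le_max_left _ _))
  · rw [hd']; exact neg_nonpos.2 (hb s).1.le
  · have hs : (0 : ℝ) ≤ ‖u‖ ^ 2 := by positivity
    rw [hφI _ hs]
    calc ∫ t in Ioi (‖u‖ ^ 2), b t ≤ ∫ t in Ioi (‖u‖ ^ 2), Real.exp (-t) * γ u := by
          refine setIntegral_mono_on (hinter _ hs) ((integrableOn_exp_neg_Ioi _).mul_const _)
            measurableSet_Ioi fun t ht => (hb t).2 u (le_of_lt ht)
      _ = Real.exp (-‖u‖ ^ 2) * γ u := by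
          rw [integral_mul_const, integral_exp_neg_Ioi]
      _ ≤ γ u := mul_le_of_le_one_left (hγ0 u).le (by simp)
  · rw [hd', abs_neg, abs_of_pos (hb _).1]
    have h1 := (hb (‖u‖ ^ 2)).2 u le_rfl
    have h2 : 2 * ‖u‖ * Real.exp (-‖u‖ ^ 2) ≤ 1 := by
      rw [Real.exp_neg, ← div_eq_mul_inv, div_le_one (Real.exp_pos _)]
      nlinarith [Real.add_one_le_exp (‖u‖ ^ 2), sq_nonneg (‖u‖ - 1)]
    calc 2 * ‖u‖ * b (‖u‖ ^ 2) ≤ 2 * ‖u‖ * (Real.exp (-‖u‖ ^ 2) * γ u) := by gcongr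
      _ = (2 * ‖u‖ * Real.exp (-‖u‖ ^ 2)) * γ u := by ring
      _ ≤ γ u := mul_le_of_le_one_left (hγ0 u).le h2

/-- A smooth positive function small together with its derivative. -/
theorem exists_contDiff_small {Y : Type*} [NormedAddCommGroup Y] [InnerProductSpace ℝ Y]
    [ProperSpace Y] {γ : Y → ℝ} (hγ : Continuous γ) (hγ0 : ∀ u, 0 < γ u) :
    ∃ ζ : Y → ℝ, ContDiff ℝ (⊤ : ℕ∞) ζ ∧ (∀ u, 0 < ζ u) ∧ (∀ u, ζ u ≤ γ u) ∧
      ∀ u, ‖fderiv ℝ ζ u‖ ≤ γ u := by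
  obtain ⟨φ, hφ, hφ0, -, h⟩ := exists_radial_minorant hγ hγ0
  refine ⟨fun u => φ (‖u‖ ^ 2), hφ.comp (contDiff_norm_sq ℝ), fun u => hφ0 _, fun u => (h u).1,
    fun u => ?_⟩
  have h1 : HasFDerivAt (fun u : Y => φ (‖u‖ ^ 2))
      (deriv φ (‖u‖ ^ 2) • (2 • innerSL ℝ u)) u := by
    have h2 : HasDerivAt φ (deriv φ (‖u‖ ^ 2)) (‖u‖ ^ 2) :=
      (hφ.differentiable (by simp) _).hasDerivAt
    exact h2.comp_hasFDerivAt u (hasStrictFDerivAt_norm_sq u).hasFDerivAt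
  rw [h1.fderiv, norm_smul]
  refine le_trans ?_ (h u).2
  rw [mul_comm, Real.norm_eq_abs]
  gcongr
  have := norm_nsmul_le (n := 2) (a := innerSL ℝ u)
  simpa [innerSL_apply_norm] using this

/-- Extension by zero along an open embedding. -/
theorem continuous_extend_zero {Y N V : Type*} [TopologicalSpace Y] [TopologicalSpace N]
    [NormedAddCommGroup V] {χ : Y → N} (hχ : IsOpenEmbedding χ) {b : N → ℝ} (hb : Continuous b)
    (hb0 : ∀ x, x ∉ range χ → b x = 0) {h : Y → V} (hh : Continuous h)
    (hhb : ∀ u, ‖h u‖ ≤ b (χ u)) : Continuous (Function.extend χ h 0) := by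
  rw [continuous_iff_continuousAt]
  intro x
  by_cases hx : x ∈ range χ
  · obtain ⟨u, rfl⟩ := hx
    rw [← hχ.continuousAt_iff]
    have : Function.extend χ h 0 ∘ χ = h := Function.extend_comp hχ.injective h 0
    rw [this]
    exact hh.continuousAt
  · have hb' : ∀ y, ‖Function.extend χ h 0 y‖ ≤ b y := by
      intro y
      by_cases hy : y ∈ range χ
      · obtain ⟨u, rfl⟩ := hy
        rw [hχ.injective.extend_apply]
        exact hhb u
      · rw [Function.extend_apply' _ _ _ (fun ⟨a, ha⟩ => hy ⟨a, ha⟩)]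
        simp [hb0 y hy]
    have h0 : Function.extend χ h 0 x = 0 := by
      rw [Function.extend_apply' _ _ _ (fun ⟨a, ha⟩ => hx ⟨a, ha⟩)]; rfl
    rw [ContinuousAt, h0]
    refine squeeze_zero_norm hb' ?_
    have := hb.tendsto x
    rwa [hb0 x hx] at this

end

section

/-- A bounded expanding immersion of `ℝ^p` onto a torus of revolution in `ℝ^(p+1)`. -/
theorem exists_torus (p : ℕ) : ∃ c : Fin (p + 1) → (Fin p → ℝ) → ℝ,
    (∀ i, ContDiff ℝ (⊤ : ℕ∞) (c i)) ∧ (∃ M, ∀ i x, |c i x| ≤ M) ∧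
    ∀ x w, ∑ i, w i ^ 2 ≤ ∑ i, (fderiv ℝ (c i) x w) ^ 2 := by
  induction p with
  | zero => exact ⟨fun _ _ => 0, fun _ => contDiff_const, ⟨0, by simp⟩, by simp⟩
  | succ p ih =>
    obtain ⟨c, hc, ⟨M, hM⟩, hcw⟩ := ih
    let T : (Fin (p + 1) → ℝ) →L[ℝ] (Fin p → ℝ) :=
      ContinuousLinearMap.pi fun i => ContinuousLinearMap.proj i.succ
    let P : (Fin (p + 1) → ℝ) →L[ℝ] ℝ := ContinuousLinearMap.proj 0
    have hM0 : 0 ≤ M := (abs_nonneg _).trans (hM 0 0)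
    let B := M + 1
    let a : (Fin (p + 1) → ℝ) → ℝ := fun x => c 0 (T x) + B
    let f1 : (Fin (p + 1) → ℝ) → ℝ := fun x => a x * Real.cos (P x)
    let f2 : (Fin (p + 1) → ℝ) → ℝ := fun x => a x * Real.sin (P x)
    have ha : ContDiff ℝ (⊤ : ℕ∞) a := ((hc 0).comp T.contDiff).add contDiff_const
    have hf1 : ContDiff ℝ (⊤ : ℕ∞) f1 := ha.mul (Real.contDiff_cos.comp P.contDiff)
    have hf2 : ContDiff ℝ (⊤ : ℕ∞) f2 := ha.mul (Real.contDiff_sin.comp P.contDiff)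
    have hcd : ∀ i y, DifferentiableAt ℝ (c i) y := fun i y => (hc i).differentiable (by simp) y
    have hda : ∀ x, HasFDerivAt a ((fderiv ℝ (c 0) (T x)).comp T) x := fun x => by
      have := ((hcd 0 (T x)).hasFDerivAt.comp x T.hasFDerivAt).add_const B
      exact this
    have hcos : ∀ x, HasFDerivAt (fun x => Real.cos (P x)) (-Real.sin (P x) • P) x := fun x =>
      (Real.hasDerivAt_cos (P x)).comp_hasFDerivAt x P.hasFDerivAt
    have hsin : ∀ x, HasFDerivAt (fun x => Real.sin (P x)) (Real.cos (P x) • P) x := fun x =>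
      (Real.hasDerivAt_sin (P x)).comp_hasFDerivAt x P.hasFDerivAt
    have ha1 : ∀ x, 1 ≤ a x := fun x => by
      have := (abs_le.1 (hM 0 (T x))).1
      simp only [a, B]; linarith
    have haM : ∀ x, |a x| ≤ 2 * M + 1 := fun x => by
      have := (abs_le.1 (hM 0 (T x))).2
      rw [abs_of_nonneg (by linarith [ha1 x])]
      simp only [a, B]; linarith
    refine ⟨Fin.cons f1 (Fin.cons f2 fun i x => c i.succ (T x)), ?_, ⟨2 * M + 1, ?_⟩, ?_⟩
    · intro i
      refine Fin.cases hf1 (fun i => ?_) i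
      refine Fin.cases hf2 (fun i => ?_) i
      exact (hc i.succ).comp T.contDiff
    · intro i x
      refine Fin.cases ?_ (fun i => ?_) i
      · simp only [Fin.cons_zero, f1, abs_mul]
        exact (mul_le_of_le_one_right (abs_nonneg _) (Real.abs_cos_le_one _)).trans (haM x)
      refine Fin.cases ?_ (fun i => ?_) i
      · simp only [Fin.cons_zero, Fin.cons_succ, f2, abs_mul]
        exact (mul_le_of_le_one_right (abs_nonneg _) (Real.abs_sin_le_one _)).trans (haM x)
      · simp only [Fin.cons_succ]
        exact (hM _ _).trans (by linarith)
    · intro x w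
      rw [Fin.sum_univ_succ, Fin.sum_univ_succ (n := p + 1), Fin.sum_univ_succ (n := p)]
      simp only [Fin.cons_zero, Fin.cons_succ]
      have e1 := ((hda x).mul (hcos x)).fderiv
      have e2 := ((hda x).mul (hsin x)).fderiv
      have e3 : ∀ i : Fin p, fderiv ℝ (fun x => c i.succ (T x)) x w
          = fderiv ℝ (c i.succ) (T x) (T w) := fun i => by
        have := ((hcd i.succ (T x)).hasFDerivAt.comp x T.hasFDerivAt).fderiv
        have h2 := congrArg (fun L => L w) this
        exact h2
      have e1' : fderiv ℝ f1 x w = a x * (-Real.sin (P x) * P w)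
          + Real.cos (P x) * fderiv ℝ (c 0) (T x) (T w) := congrArg (fun L => L w) e1
      have e2' : fderiv ℝ f2 x w = a x * (Real.cos (P x) * P w)
          + Real.sin (P x) * fderiv ℝ (c 0) (T x) (T w) := congrArg (fun L => L w) e2
      rw [e1', e2']
      simp only [e3]
      have h := hcw (T x) (T w)
      rw [Fin.sum_univ_succ] at h
      have h3 : ∀ i, T w i = w i.succ := fun i => rfl
      have h4 : P w = w 0 := rfl
      simp only [h3, h4] at h ⊢
      have hsc := Real.sin_sq_add_cos_sq (P x)
      generalize fderiv ℝ (c 0) (T x) (T w) = d at *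
      have hid : (a x * (-Real.sin (P x) * w 0) + Real.cos (P x) * d) ^ 2 +
          (a x * (Real.cos (P x) * w 0) + Real.sin (P x) * d) ^ 2 =
          (Real.sin (P x) ^ 2 + Real.cos (P x) ^ 2) * ((a x) ^ 2 * w 0 ^ 2 + d ^ 2) := by ring
      rw [hsc, one_mul] at hid
      have h5 : w 0 ^ 2 ≤ a x ^ 2 * w 0 ^ 2 :=
        le_mul_of_one_le_left (sq_nonneg _) (one_le_pow₀ (ha1 x))
      linarith

end

section

/-- A radial expanding diffeomorphism. -/
theorem exists_expanding {Y : Type*} [NormedAddCommGroup Y] [InnerProductSpace ℝ Y]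
    [ProperSpace Y] {κ : Y → ℝ} (hκ : Continuous κ) :
    ∃ Θ : Y → Y, ContDiff ℝ (⊤ : ℕ∞) Θ ∧ ∀ u v, v ≠ 0 → κ u * ‖v‖ < ‖fderiv ℝ Θ u v‖ := by
  obtain ⟨φ, hφ, hφ0, hφ', h⟩ := exists_radial_minorant (γ := fun u : Y => (|κ u| + 1)⁻¹)
    (Continuous.inv₀ (by fun_prop) fun u => by positivity) (fun u => by positivity)
  refine ⟨fun u => (φ (‖u‖ ^ 2))⁻¹ • u,
    ((hφ.comp (contDiff_norm_sq ℝ)).inv fun u => (hφ0 _).ne').smul contDiff_id, fun u v hv => ?_⟩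
  set s := ‖u‖ ^ 2
  have h2 : HasDerivAt (fun s => (φ s)⁻¹) (-deriv φ s / φ s ^ 2) s :=
    ((hφ.differentiable (by simp) _).hasDerivAt).inv (hφ0 _).ne'
  have h3 := (h2.comp_hasFDerivAt u (hasStrictFDerivAt_norm_sq u).hasFDerivAt).smul
    (hasFDerivAt_id u)
  have h4 : fderiv ℝ (fun u : Y => (φ (‖u‖ ^ 2))⁻¹ • u) u v =
      (φ s)⁻¹ • v + ((-deriv φ s / φ s ^ 2) * (2 * inner ℝ u v)) • u := by
    have h5 := congrArg (fun L => L v) h3.fderiv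
    refine h5.trans ?_
    simp [s]
  rw [h4]
  have h6 : inner ℝ ((φ s)⁻¹ • v + ((-deriv φ s / φ s ^ 2) * (2 * inner ℝ u v)) • u) v =
      (φ s)⁻¹ * ‖v‖ ^ 2 + 2 * (-deriv φ s / φ s ^ 2) * (inner ℝ u v) ^ 2 := by
    rw [inner_add_left, inner_smul_left, inner_smul_left, real_inner_self_eq_norm_sq]
    simp only [conj_trivial]
    ring
  have h7 : 0 ≤ 2 * (-deriv φ s / φ s ^ 2) * (inner ℝ u v) ^ 2 := by
    have := hφ' s
    have : 0 ≤ -deriv φ s / φ s ^ 2 := div_nonneg (by linarith) (by positivity)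
    positivity
  have h8 := real_inner_le_norm ((φ s)⁻¹ • v + ((-deriv φ s / φ s ^ 2) * (2 * inner ℝ u v)) • u) v
  rw [h6] at h8
  have hv' : 0 < ‖v‖ := norm_pos_iff.2 hv
  have h9 : |κ u| + 1 ≤ (φ s)⁻¹ := by
    rw [le_inv_comm₀ (by positivity) (hφ0 _)]
    exact (h u).1
  have h10 : (φ s)⁻¹ * ‖v‖ ≤
      ‖(φ s)⁻¹ • v + ((-deriv φ s / φ s ^ 2) * (2 * inner ℝ u v)) • u‖ := by
    refine le_of_mul_le_mul_right ?_ hv'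
    nlinarith
  refine lt_of_lt_of_le ?_ h10
  have := le_abs_self (κ u)
  exact mul_lt_mul_of_pos_right (by linarith) hv'

/-- Smooth maps to a space of larger dimension are approximated by immersions. -/
theorem exists_immersion {p m : ℕ} (hpm : p + 1 ≤ m) {f₀ : EuclideanSpace ℝ (Fin p) → Fin m → ℝ}
    (hf₀ : ContDiff ℝ (⊤ : ℕ∞) f₀) {γ : EuclideanSpace ℝ (Fin p) → ℝ} (hγ : Continuous γ)
    (hγ0 : ∀ u, 0 < γ u) : ∃ f : EuclideanSpace ℝ (Fin p) → Fin m → ℝ, ContDiff ℝ (⊤ : ℕ∞) f ∧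
      (∀ u, ‖f u - f₀ u‖ ≤ γ u) ∧ ∀ u v, v ≠ 0 → fderiv ℝ f u v ≠ 0 := by
  obtain ⟨c, hc, ⟨M, hM⟩, hcw⟩ := exists_torus p
  have hM0 : 0 ≤ M := (abs_nonneg _).trans (hM 0 0)
  obtain ⟨ε, hε, hε0, hεγ, -⟩ := exists_contDiff_small (γ := fun u => γ u / (M + 1))
    (by fun_prop) (fun u => by have := hγ0 u; positivity)
  have hDf₀ : Continuous (fderiv ℝ f₀) := hf₀.continuous_fderiv (by simp)
  have hDε : Continuous (fderiv ℝ ε) := hε.continuous_fderiv (by simp)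
  let κ : EuclideanSpace ℝ (Fin p) → ℝ := fun u =>
    (‖fderiv ℝ f₀ u‖ + ‖fderiv ℝ ε u‖ * M) / ε u
  have hκ : Continuous κ := Continuous.div (by fun_prop) hε.continuous fun u => (hε0 u).ne'
  have hκ0 : ∀ u, 0 ≤ κ u := fun u => by have := hε0 u; positivity
  obtain ⟨Θ, hΘ, hΘv⟩ := exists_expanding (κ := fun u => (p + 1) * κ u) (by fun_prop)
  let E : EuclideanSpace ℝ (Fin p) →L[ℝ] (Fin p → ℝ) :=
    (EuclideanSpace.equiv (Fin p) ℝ).toContinuousLinearMap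
  let g : Fin m → EuclideanSpace ℝ (Fin p) → ℝ := fun i u =>
    if h : (i : ℕ) < p + 1 then f₀ u i + ε u * c ⟨i, h⟩ (E (Θ u)) else f₀ u i
  have hf₀i : ∀ i, ContDiff ℝ (⊤ : ℕ∞) fun u => f₀ u i := fun i => (contDiff_pi.1 hf₀) i
  have hcE : ∀ i, ContDiff ℝ (⊤ : ℕ∞) fun u => c i (E (Θ u)) := fun i =>
    (hc i).comp (E.contDiff.comp hΘ)
  have hg : ∀ i, ContDiff ℝ (⊤ : ℕ∞) (g i) := fun i => by
    by_cases h : (i : ℕ) < p + 1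
    · simp only [g, h, dif_pos]
      exact (hf₀i i).add (hε.mul (hcE _))
    · simp only [g, h, dif_neg, not_false_iff]
      exact hf₀i i
  refine ⟨fun u i => g i u, contDiff_pi.2 hg, fun u => ?_, fun u v hv h0 => ?_⟩
  · rw [pi_norm_le_iff_of_nonneg (hγ0 u).le]
    intro i
    by_cases h : (i : ℕ) < p + 1
    · simp only [g, h, dif_pos, Pi.sub_apply, add_sub_cancel_left, Real.norm_eq_abs, abs_mul]
      rw [abs_of_pos (hε0 u)]
      calc ε u * |c ⟨i, h⟩ (E (Θ u))| ≤ γ u / (M + 1) * M :=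
            mul_le_mul (hεγ u) (hM _ _) (abs_nonneg _) (by have := hγ0 u; positivity)
        _ ≤ γ u := by
          rw [div_mul_eq_mul_div, div_le_iff₀ (by positivity)]
          nlinarith [hγ0 u]
    · simp only [g, h, dif_neg, not_false_iff, Pi.sub_apply, sub_self, norm_zero]
      exact (hγ0 u).le
  · have hd : ∀ i : Fin (p + 1), ε u * fderiv ℝ (c i) (E (Θ u)) (E (fderiv ℝ Θ u v)) +
        c i (E (Θ u)) * fderiv ℝ ε u v + fderiv ℝ f₀ u v (Fin.castLE hpm i) = 0 := by
      intro i
      have h1 : HasFDerivAt (fun u i => g i u) _ u :=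
        ((contDiff_pi.2 hg).differentiable (by simp) u).hasFDerivAt
      have h2 := (hasFDerivAt_pi'.1 h1 (Fin.castLE hpm i)).fderiv
      have h3 : (fun u => g (Fin.castLE hpm i) u) =
          fun u => f₀ u (Fin.castLE hpm i) + ε u * c i (E (Θ u)) := by
        funext u; exact dif_pos i.isLt
      have h4 : HasFDerivAt (fun u => f₀ u (Fin.castLE hpm i)) _ u :=
        hasFDerivAt_pi'.1 (hf₀.differentiable (by simp) u).hasFDerivAt (Fin.castLE hpm i)
      have h5 : HasFDerivAt (fun u => c i (E (Θ u))) _ u :=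
        ((hc i).differentiable (by simp) (E (Θ u))).hasFDerivAt.comp u
          (E.hasFDerivAt.comp u (hΘ.differentiable (by simp) u).hasFDerivAt)
      have h6 := (h4.add ((hε.differentiable (by simp) u).hasFDerivAt.mul h5)).fderiv
      have h7 := congrArg (fun L => L v) (h2.symm.trans ((congrArg (fun q => fderiv ℝ q u) h3).trans h6))
      have h8 : fderiv ℝ (fun u i => g i u) u v (Fin.castLE hpm i) =
        fderiv ℝ f₀ u v (Fin.castLE hpm i) +
        (ε u * fderiv ℝ (c i) (E (Θ u)) (E (fderiv ℝ Θ u v)) +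
        c i (E (Θ u)) * fderiv ℝ ε u v) := h7
      rw [h0] at h8
      rw [add_comm, ← h8]; rfl
    have hb : ∀ i : Fin (p + 1), |fderiv ℝ (c i) (E (Θ u)) (E (fderiv ℝ Θ u v))| ≤ κ u * ‖v‖ := by
      intro i
      have h1 : |ε u * fderiv ℝ (c i) (E (Θ u)) (E (fderiv ℝ Θ u v))| ≤
          M * (‖fderiv ℝ ε u‖ * ‖v‖) + ‖fderiv ℝ f₀ u‖ * ‖v‖ := by
        have : ε u * fderiv ℝ (c i) (E (Θ u)) (E (fderiv ℝ Θ u v)) =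
          -(c i (E (Θ u)) * fderiv ℝ ε u v) - fderiv ℝ f₀ u v (Fin.castLE hpm i) := by
          linarith [hd i]
        rw [this]
        refine (abs_sub _ _).trans ?_
        rw [abs_neg, abs_mul]
        refine add_le_add (mul_le_mul (hM _ _) ((fderiv ℝ ε u).le_opNorm v) (abs_nonneg _) hM0) ?_
        exact (norm_le_pi_norm (fderiv ℝ f₀ u v) _).trans ((fderiv ℝ f₀ u).le_opNorm v)
      rw [abs_mul, abs_of_pos (hε0 u)] at h1
      simp only [κ]
      rw [div_mul_eq_mul_div, le_div_iff₀ (hε0 u)]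
      linarith
    have h1 := hcw (E (Θ u)) (E (fderiv ℝ Θ u v))
    have h2 : ∑ i, E (fderiv ℝ Θ u v) i ^ 2 = ‖fderiv ℝ Θ u v‖ ^ 2 :=
      (EuclideanSpace.real_norm_sq_eq _).symm
    have h3 : ∑ i, fderiv ℝ (c i) (E (Θ u)) (E (fderiv ℝ Θ u v)) ^ 2 ≤
        (p + 1) * (κ u * ‖v‖) ^ 2 := by
      calc _ ≤ ∑ i : Fin (p + 1), (κ u * ‖v‖) ^ 2 := Finset.sum_le_sum fun i _ => by
            rw [← sq_abs]; exact pow_le_pow_left₀ (abs_nonneg _) (hb i) 2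
        _ = _ := by simp
    have h4 := hΘv u v hv
    have h5 : 0 ≤ κ u * ‖v‖ := by have := hκ0 u; positivity
    have h6 : ((p + 1) * κ u * ‖v‖) ^ 2 < ‖fderiv ℝ Θ u v‖ ^ 2 :=
      pow_lt_pow_left₀ h4 (by have := hκ0 u; positivity) two_ne_zero
    have h7 : (0 : ℝ) ≤ p := by positivity
    nlinarith [mul_nonneg h7 (sq_nonneg (κ u * ‖v‖)), mul_nonneg h7 (mul_nonneg h7 (sq_nonneg (κ u * ‖v‖)))]

end

section

section Generic
variable (Ω : Type*) [NormedAddCommGroup Ω] [NormedSpace ℝ Ω] [FiniteDimensional ℝ Ω]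

/-- The filter of sets of full Lebesgue measure. -/
noncomputable def generic : Filter Ω :=
  letI : MeasurableSpace Ω := borel Ω
  haveI : BorelSpace Ω := ⟨rfl⟩
  ae (Measure.addHaar : Measure Ω)

variable {Ω}

theorem exists_of_generic {P : Ω → Prop} (h : ∀ᶠ t in generic Ω, P t) {x : Ω} {r : ℝ} (hr : 0 < r) :
    ∃ t ∈ ball x r, P t := by
  let _ : MeasurableSpace Ω := borel Ω
  have _ : BorelSpace Ω := ⟨rfl⟩
  by_contra hcon
  push Not at hcon
  have h1 : (Measure.addHaar : Measure Ω) (ball x r) = 0 :=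
    measure_mono_null (fun t ht => hcon t ht) h
  exact (measure_ball_pos (Measure.addHaar : Measure Ω) x hr).ne' h1

variable {X : Type*} [MetricSpace X] [MeasurableSpace X] [BorelSpace X]
  {ι : Type*} [Fintype ι]

theorem generic_hausdorffMeasure_eq_zero {e : ℝ} (he : 0 ≤ e) {T : Set X}
    (hT : μH[e + Fintype.card ι] T = 0)
    {R : X → Ω →L[ℝ] (ι → ℝ)} {a : X → ι → ℝ} (hR : CL R T) (ha : CL a T)
    (hsurj : ∀ τ ∈ T, Function.Surjective (R τ)) :
    ∀ᶠ t in generic Ω, μH[e] {τ ∈ T | R τ t = a τ} = 0 := by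
  let _ : MeasurableSpace Ω := borel Ω
  have _ : BorelSpace Ω := ⟨rfl⟩
  exact ae_hausdorffMeasure_eq_zero (Measure.addHaar : Measure Ω) he hT hR ha hsurj

/-- Genericity for families acting separately on each coordinate. -/
theorem generic_forall_coord {κ J : Type*} [Fintype κ] [Fintype J] {m : ℕ} {e : κ → Fin m}
    (he : Function.Injective e) {T : Set X}
    (hT : μH[(Fintype.card κ * Fintype.card J : ℝ)] T = 0)
    {r : X → J → Ω →L[ℝ] ℝ} (hr : ∀ j, CL (fun τ => r τ j) T)
    {a : X → κ → J → ℝ} (ha : ∀ i j, CL (fun τ => a τ i j) T)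
    (hsurj : ∀ τ ∈ T, ∀ b : J → ℝ, ∃ t, ∀ j, r τ j t = b j) :
    ∀ᶠ t in generic (Fin m → Ω), ∀ τ ∈ T, ¬ ∀ i j, r τ j (t (e i)) = a τ i j := by
  classical
  let R : X → (Fin m → Ω) →L[ℝ] (κ × J → ℝ) := fun τ =>
    ContinuousLinearMap.pi fun q => (r τ q.2).comp (ContinuousLinearMap.proj (e q.1))
  let _ : MeasurableSpace (Fin m → Ω) := borel (Fin m → Ω)
  have _ : BorelSpace (Fin m → Ω) := ⟨rfl⟩
  have hR : CL R T := by
    let Q : (J → Ω →L[ℝ] ℝ) →ₗ[ℝ] ((Fin m → Ω) →L[ℝ] (κ × J → ℝ)) :=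
      { toFun := fun s => ContinuousLinearMap.pi fun q =>
          (s q.2).comp (ContinuousLinearMap.proj (e q.1))
        map_add' := fun s s' => by ext; rfl
        map_smul' := fun c s => by ext; rfl }
    have h1 := (LinearMap.toContinuousLinearMap Q).lipschitz
    exact CL.lip_comp (F := fun τ => r τ) h1 (CL.pi hr)
  have := ae_forall_ne (Measure.addHaar : Measure (Fin m → Ω)) (T := T) (R := R)
    (a := fun τ q => a τ q.1 q.2) (by simpa using hT) hR (CL.pi fun q => ha q.1 q.2) (by
      intro τ hτ b
      choose t ht using fun i : κ => hsurj τ hτ fun j => b (i, j)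
      refine ⟨Function.extend e t 0, ?_⟩
      ext ⟨i, j⟩
      simp only [R, ContinuousLinearMap.coe_pi', ContinuousLinearMap.coe_comp, Function.comp,
        ContinuousLinearMap.proj_apply]
      rw [he.extend_apply]
      exact ht i j)
  refine Eventually.mono this fun t ht τ hτ h => ht τ hτ ?_
  ext ⟨i, j⟩
  exact h i j

omit [FiniteDimensional ℝ Ω] in
theorem exists_pair {φ₁ φ₂ : Ω →L[ℝ] ℝ} (h1 : ∃ t, φ₁ t ≠ 0) (h2 : ∃ t, φ₁ t = 0 ∧ φ₂ t ≠ 0)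
    (a b : ℝ) : ∃ t, φ₁ t = a ∧ φ₂ t = b := by
  obtain ⟨t, ht⟩ := h1
  obtain ⟨s, hs, hs'⟩ := h2
  refine ⟨(a / φ₁ t) • t + ((b - a / φ₁ t * φ₂ t) / φ₂ s) • s, ?_, ?_⟩
  · simp [hs, ht]
  · simp [hs']

end Generic

section Family

/-- Coefficients of quadratic polynomials. -/
abbrev Quad (p : ℕ) := Fin (p + 1) × Fin (p + 1) → ℝ

/-- A smooth family of evaluation functionals with interpolation properties. -/
theorem exists_family {p : ℕ} {γ : EuclideanSpace ℝ (Fin p) → ℝ} (hγ : Continuous γ)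
    (hγ0 : ∀ u, 0 < γ u) :
    ∃ E : EuclideanSpace ℝ (Fin p) → Quad p →L[ℝ] ℝ, ContDiff ℝ (⊤ : ℕ∞) E ∧
      (∀ u, ‖E u‖ ≤ γ u) ∧ (∀ u, ‖fderiv ℝ E u‖ ≤ γ u) ∧
      (∀ (o₁ o₂ : Option (EuclideanSpace ℝ (Fin p))) (u : EuclideanSpace ℝ (Fin p)),
        o₁ ≠ some u → o₂ ≠ some u →
        ∃ t, (∀ w ∈ o₁, E w t = 0) ∧ (∀ w ∈ o₂, E w t = 0) ∧ E u t ≠ 0) ∧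
      ∀ (o : Option (EuclideanSpace ℝ (Fin p))) (u v : EuclideanSpace ℝ (Fin p)), o ≠ some u →
        v ≠ 0 → ∃ t, (∀ w ∈ o, E w t = 0) ∧ E u t = 0 ∧ fderiv ℝ E u v t ≠ 0 := by
  let i : EuclideanSpace ℝ (Fin p) → (Fin (p + 1) → ℝ) := fun u => Fin.cons 1 u
  let i₀ : EuclideanSpace ℝ (Fin p) →L[ℝ] (Fin (p + 1) → ℝ) := ContinuousLinearMap.pi (Fin.cons 0 fun j => EuclideanSpace.proj j)
  let T : (Fin (p + 1) → ℝ) →L[ℝ] EuclideanSpace ℝ (Fin p) := ((EuclideanSpace.equiv (Fin p) ℝ).symm.toContinuousLinearMap).comp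
    (ContinuousLinearMap.pi fun j => ContinuousLinearMap.proj j.succ)
  let P : (Fin (p + 1) → ℝ) →L[ℝ] ℝ := ContinuousLinearMap.proj 0
  have hii₀ : ∀ u, i u = i₀ u + Fin.cons 1 0 := fun u => by
    ext j
    refine Fin.cases ?_ (fun j => ?_) j
    · change (1 : ℝ) = 0 + 1
      simp
    · change u j = u j + 0
      simp
  have hdi : ∀ u, HasFDerivAt i i₀ u := fun u => by
    have := (i₀.hasFDerivAt (x := u)).add_const (Fin.cons 1 0)
    rwa [show i = fun u => i₀ u + Fin.cons 1 0 from funext hii₀]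
  have hi : ContDiff ℝ (⊤ : ℕ∞) i := by
    rw [show i = fun u => i₀ u + Fin.cons 1 0 from funext hii₀]
    exact i₀.contDiff.add contDiff_const
  have hTi : ∀ u, T (i u) = u := fun u => by rfl
  have hPi : ∀ u, P (i u) = 1 := fun u => rfl
  have hTi₀ : ∀ u, T (i₀ u) = u := fun u => by rfl
  have hPi₀ : ∀ u, P (i₀ u) = 0 := fun u => rfl
  let B : EuclideanSpace ℝ (Fin p) → Quad p →L[ℝ] ℝ := fun u =>
    ∑ q : Fin (p + 1) × Fin (p + 1), (i u q.1 * i u q.2) • ContinuousLinearMap.proj q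
  have hB : ContDiff ℝ (⊤ : ℕ∞) B := by
    refine ContDiff.sum fun q _ => ?_
    have h1 := ((contDiff_pi.1 hi) q.1).mul ((contDiff_pi.1 hi) q.2)
    exact h1.smul contDiff_const
  have hBc := hB.continuous
  have hDB : Continuous (fderiv ℝ B) := hB.continuous_fderiv (by simp)
  have hnDB : Continuous fun u => ‖fderiv ℝ B u‖ := by
    have := continuous_norm (E := EuclideanSpace ℝ (Fin p) →L[ℝ] Quad p →L[ℝ] ℝ)
    exact this.comp hDB
  obtain ⟨ζ, hζ, hζ0, hζγ, hDζ⟩ := exists_contDiff_small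
    (γ := fun u => γ u / (1 + ‖B u‖ + ‖fderiv ℝ B u‖))
    (Continuous.div hγ ((continuous_const.add hBc.norm).add hnDB) fun u => by positivity)
    (fun u => by have := hγ0 u; positivity)
  have hE : ∀ u, HasFDerivAt (fun u => ζ u • B u)
      (ζ u • fderiv ℝ B u + (fderiv ℝ ζ u).smulRight (B u)) u := fun u =>
    (hζ.differentiable (by simp) u).hasFDerivAt.smul (hB.differentiable (by simp) u).hasFDerivAt
  have hprod : ∀ α β : (Fin (p + 1) → ℝ) →L[ℝ] ℝ, ∃ t : Quad p, ∀ u, B u t = α (i u) * β (i u) := by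
    intro α β
    refine ⟨fun q => α (Pi.single q.1 1) * β (Pi.single q.2 1), fun u => ?_⟩
    have h1 : ∀ (α : (Fin (p + 1) → ℝ) →L[ℝ] ℝ) (x : Fin (p + 1) → ℝ), α x = ∑ j, x j * α (Pi.single j 1) := fun α x => by
      conv_lhs => rw [← Finset.univ_sum_single x]
      rw [map_sum]
      refine Finset.sum_congr rfl fun j _ => ?_
      rw [← smul_eq_mul, ← map_smul, ← Pi.single_smul', smul_eq_mul, mul_one]
    rw [h1 α (i u), h1 β (i u), Finset.sum_mul_sum, ← Finset.sum_product']
    simp only [B, ContinuousLinearMap.sum_apply, ContinuousLinearMap.smul_apply,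
      ContinuousLinearMap.proj_apply, smul_eq_mul, Finset.univ_product_univ]
    refine Finset.sum_congr rfl fun q _ => by ring
  have haff : ∀ (o : Option (EuclideanSpace ℝ (Fin p))) (u : EuclideanSpace ℝ (Fin p)), o ≠ some u → ∃ α : (Fin (p + 1) → ℝ) →L[ℝ] ℝ,
      (∀ w ∈ o, α (i w) = 0) ∧ α (i u) ≠ 0 := by
    intro o u ho
    cases o with
    | none => exact ⟨P, by simp, by simp [hPi]⟩
    | some w =>
      have hwu : u - w ≠ 0 := fun h => ho (by rw [sub_eq_zero.1 h])
      refine ⟨(innerSL ℝ (u - w)).comp T - (inner ℝ (u - w) w) • P, ?_, ?_⟩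
      · intro w' hw'
        obtain rfl : w = w' := by simpa using hw'
        simp only [ContinuousLinearMap.sub_apply, ContinuousLinearMap.comp_apply, hTi, hPi,
          ContinuousLinearMap.smul_apply, innerSL_apply_apply, smul_eq_mul, mul_one, sub_self]
      · simp only [ContinuousLinearMap.sub_apply, ContinuousLinearMap.comp_apply, hTi, hPi,
          ContinuousLinearMap.smul_apply, innerSL_apply_apply, smul_eq_mul, mul_one]
        rw [← inner_sub_right]
        exact inner_self_ne_zero.2 hwu
  refine ⟨fun u => ζ u • B u, hζ.smul hB, fun u => ?_, fun u => ?_, ?_, ?_⟩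
  · rw [norm_smul, Real.norm_of_nonneg (hζ0 u).le]
    have h1 := hζγ u
    rw [le_div_iff₀ (by positivity)] at h1
    nlinarith [hζ0 u, norm_nonneg (B u), norm_nonneg (fderiv ℝ B u),
      mul_nonneg (hζ0 u).le (norm_nonneg (fderiv ℝ B u))]
  · rw [(hE u).fderiv]
    refine (ContinuousLinearMap.opNorm_add_le _ _).trans ?_
    rw [norm_smul, Real.norm_of_nonneg (hζ0 u).le, ContinuousLinearMap.norm_smulRight_apply]
    have h1 := hζγ u
    have h2 := hDζ u
    calc ζ u * ‖fderiv ℝ B u‖ + ‖fderiv ℝ ζ u‖ * ‖B u‖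
        ≤ γ u / (1 + ‖B u‖ + ‖fderiv ℝ B u‖) * ‖fderiv ℝ B u‖ +
          γ u / (1 + ‖B u‖ + ‖fderiv ℝ B u‖) * ‖B u‖ := by gcongr
      _ ≤ γ u := by
        rw [← mul_add, div_mul_eq_mul_div, div_le_iff₀ (by positivity)]
        nlinarith [hγ0 u]
  · intro o₁ o₂ u h1 h2
    obtain ⟨α, hα, hα'⟩ := haff o₁ u h1
    obtain ⟨β, hβ, hβ'⟩ := haff o₂ u h2
    obtain ⟨t, ht⟩ := hprod α β
    refine ⟨t, fun w hw => ?_, fun w hw => ?_, ?_⟩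
    · simp [ht, hα w hw]
    · simp [ht, hβ w hw]
    · simp [ht, hα', hβ', (hζ0 u).ne']
  · intro o u v h1 hv
    obtain ⟨α, hα, hα'⟩ := haff o u h1
    let β : (Fin (p + 1) → ℝ) →L[ℝ] ℝ := (innerSL ℝ v).comp T - (inner ℝ v u) • P
    have hβ : β (i u) = 0 := by simp [β, hTi, hPi]
    obtain ⟨t, ht⟩ := hprod α β
    refine ⟨t, fun w hw => ?_, ?_, ?_⟩
    · simp [ht, hα w hw]
    · simp [ht, hβ]
    · have h3 := hdi u
      have h4 : HasFDerivAt (fun u => α (i u) * β (i u)) _ u :=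
        (α.hasFDerivAt.comp u h3).mul (β.hasFDerivAt.comp u h3)
      have h5 : HasFDerivAt (fun u => B u t) ((fderiv ℝ B u).flip t) u :=
        (hB.differentiable (by simp) u).hasFDerivAt.clm_apply (hasFDerivAt_const t u) |>.congr_fderiv
          (by ext; simp)
      have h6 : (fun u => B u t) = fun u => α (i u) * β (i u) := funext ht
      rw [h6] at h5
      have h7 := congrArg (fun L => L v) (h5.unique h4)
      have h8 : fderiv ℝ B u v t = α (i u) * β (i₀ v) + β (i u) * α (i₀ v) := h7
      rw [(hE u).fderiv]
      have h9 : β (i₀ v) = inner ℝ v v := by simp [β, hTi₀, hPi₀]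
      rw [hβ, zero_mul, add_zero, h9] at h8
      have h10 : (inner ℝ v v : ℝ) ≠ 0 := inner_self_ne_zero.2 hv
      simp [h8, ht, hβ, (hζ0 u).ne', hα', hv]

end Family

end

section

theorem exists_pos_selection {Y : Type*} [MetricSpace Y] [SecondCountableTopology Y]
    {P : Y → ℝ → Prop} (hP : ∀ u r r', 0 < r' → r' ≤ r → P u r → P u r')
    (hloc : ∀ u, ∃ r > 0, ∀ᶠ u' in 𝓝 u, P u' r) :
    ∃ γ : Y → ℝ, Continuous γ ∧ (∀ u, 0 < γ u) ∧ ∀ u, P u (γ u) := by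
  have hconv : ∀ u, Convex ℝ {r : ℝ | 0 < r ∧ P u r} := by
    intro u
    refine Set.OrdConnected.convex (Set.ordConnected_iff.2 ?_)
    rintro a ha b hb - c hc
    exact ⟨ha.1.trans_le hc.1, hP u b c (ha.1.trans_le hc.1) hc.2 hb.2⟩
  obtain ⟨g, hg⟩ := exists_continuous_forall_mem_convex_of_local_const hconv fun u => by
    obtain ⟨r, hr, h⟩ := hloc u
    exact ⟨r, h.mono fun u' hu' => ⟨hr, hu'⟩⟩
  exact ⟨g, g.continuous, fun u => (hg u).1, fun u => (hg u).2⟩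

/-- A decomposition of a space into a closed set and an open cell. -/
structure Cell (N : Type*) [MetricSpace N] (p : ℕ) where
  L : Set N
  χ : EuclideanSpace ℝ (Fin p) → N
  ρ : N → EuclideanSpace ℝ (Fin p)
  closed : IsClosed L
  emb : IsOpenEmbedding χ
  ran : range χ = Lᶜ
  ρχ : ∀ u, ρ (χ u) = u
  CLχ : CL χ univ
  CLρ : CL ρ Lᶜ

namespace Cell
variable {N : Type*} [MetricSpace N] {p : ℕ} (C : Cell N p)

theorem χ_notMem (u) : C.χ u ∉ C.L := by
  have : C.χ u ∈ C.Lᶜ := by rw [← C.ran]; exact mem_range_self u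
  exact this

theorem χρ {x : N} (hx : x ∉ C.L) : C.χ (C.ρ x) = x := by
  have : x ∈ range C.χ := by rw [C.ran]; exact hx
  obtain ⟨u, rfl⟩ := this
  rw [C.ρχ]

theorem cases (x : N) : x ∈ C.L ∨ ∃ u, x = C.χ u := by
  by_cases h : x ∈ C.L
  · exact Or.inl h
  · exact Or.inr ⟨C.ρ x, (C.χρ h).symm⟩

theorem χ_inj {u v} : C.χ u = C.χ v ↔ u = v := C.emb.injective.eq_iff

theorem continuous_χ : Continuous C.χ := C.emb.continuous

theorem continuousAt_ρ {x : N} (hx : x ∉ C.L) : ContinuousAt C.ρ x := by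
  obtain h | ⟨u, rfl⟩ := C.cases x
  · exact absurd h hx
  · rw [← C.emb.continuousAt_iff]
    rw [show C.ρ ∘ C.χ = id from funext C.ρχ]
    exact continuousAt_id

theorem exists_d : ∃ d : N → ℝ, Continuous d ∧ (∀ x, 0 ≤ d x) ∧ ∀ x, d x = 0 ↔ x ∈ C.L := by
  by_cases h : C.L.Nonempty
  · exact ⟨fun x => infDist x C.L, continuous_infDist_pt _, fun x => infDist_nonneg,
      fun x => (C.closed.mem_iff_infDist_zero h).symm⟩
  · rw [Set.not_nonempty_iff_eq_empty] at h
    exact ⟨fun _ => 1, continuous_const, fun _ => zero_le_one, fun x => by simp [h]⟩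

/-- A continuous function vanishing exactly on `L`. -/
noncomputable def d : N → ℝ := C.exists_d.choose

theorem continuous_d : Continuous C.d := C.exists_d.choose_spec.1
theorem d_nonneg (x) : 0 ≤ C.d x := C.exists_d.choose_spec.2.1 x
theorem d_eq_zero {x} : C.d x = 0 ↔ x ∈ C.L := C.exists_d.choose_spec.2.2 x
theorem d_pos {x} (hx : x ∉ C.L) : 0 < C.d x :=
  (C.d_nonneg x).lt_of_ne fun h => hx (C.d_eq_zero.1 h.symm)
theorem d_χ_pos (u) : 0 < C.d (C.χ u) := C.d_pos (C.χ_notMem u)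

variable {G : Type*} [NormedAddCommGroup G]

/-- Extension by zero. -/
noncomputable def ext (η : EuclideanSpace ℝ (Fin p) → G) : N → G := Function.extend C.χ η 0

@[simp] theorem ext_χ (η : EuclideanSpace ℝ (Fin p) → G) (u) : C.ext η (C.χ u) = η u :=
  C.emb.injective.extend_apply _ _ _

theorem ext_of_mem (η : EuclideanSpace ℝ (Fin p) → G) {x} (hx : x ∈ C.L) : C.ext η x = 0 := by
  refine Function.extend_apply' _ _ _ ?_
  rintro ⟨u, rfl⟩
  exact C.χ_notMem u hx

theorem continuous_ext {η : EuclideanSpace ℝ (Fin p) → G} (hη : Continuous η) {b : N → ℝ}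
    (hb : Continuous b) (hb0 : ∀ x ∈ C.L, b x = 0) (h : ∀ u, ‖η u‖ ≤ b (C.χ u)) :
    Continuous (C.ext η) := by
  refine continuous_extend_zero C.emb hb (fun x hx => hb0 x ?_) hη h
  rw [C.ran] at hx
  exact not_not.1 hx

theorem CL_ext [NormedSpace ℝ G] {η : EuclideanSpace ℝ (Fin p) → G} (hη : ContDiff ℝ (⊤ : ℕ∞) η) (T : Set N) :
    CL (C.ext η) T := by
  have h1 : CL (C.ext η) C.L := by
    have : CL (fun _ : N => (0 : G)) C.L := (LipschitzWith.const (0 : G)).CL _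
    exact this.congr fun x hx => (C.ext_of_mem η hx).symm
  have h2 : CL (C.ext η) C.Lᶜ := by
    have h3 : CL η univ := CL.of_locallyLipschitz (hη.of_le (by simp)).locallyLipschitz _
    have h4 := CL.comp h3 C.CLρ fun _ _ => mem_univ _
    refine h4.congr fun x hx => ?_
    rw [← C.χρ hx]; simp [C.ρχ]
  exact (h1.union h2).mono (by rw [union_compl_self]; exact subset_univ T)

theorem CL_of_smooth [NormedSpace ℝ G] {f : N → G} (h1 : CL f C.L) (hf : ContDiff ℝ (⊤ : ℕ∞) (f ∘ C.χ))
    (T : Set N) : CL f T := by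
  have h2 := (C.CL_ext hf C.Lᶜ).congr (G := f) fun x hx => by
    rw [← C.χρ hx, ext_χ]; rfl
  exact (h1.union h2).mono (by rw [union_compl_self]; exact subset_univ T)

end Cell

variable {N : Type*} [MetricSpace N] {p m : ℕ}

/-- The two-variable map built from `f` and a correction `e`. -/
def HH (f : N → Fin m → ℝ) (e : N × N → Fin m → ℝ) (p : DP N) : Fin m → ℝ :=
  f p.1.1 - f p.1.2 + e p.1

/-- The invariants of the construction. -/
structure Cell.St (C : Cell N p) (f : N → Fin m → ℝ) (e : N × N → Fin m → ℝ) : Prop where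
  cont : Continuous f
  smooth : ContDiff ℝ (⊤ : ℕ∞) (f ∘ C.χ)
  imm : ∀ u v, v ≠ 0 → fderiv ℝ (f ∘ C.χ) u v ≠ 0
  CLf : CL f C.L
  econt : Continuous e
  eodd : ∀ x y, e (y, x) = -e (x, y)
  eL : ∀ x ∈ C.L, ∀ y ∈ C.L, e (x, y) = 0
  ediag : ∀ u, ∀ᶠ q in 𝓝 (C.χ u, C.χ u), e q = 0
  CLe : CL e univ
  ne : ∀ x y, x ≠ y → f x - f y + e (x, y) ≠ 0

namespace Cell.St
variable {C : Cell N p} {f : N → Fin m → ℝ} {e : N × N → Fin m → ℝ}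

theorem isOdd (h : C.St f e) : IsOdd (HH f e) where
  cont := by
    have := h.cont
    have := h.econt
    unfold HH
    fun_prop
  odd q := by
    simp only [HH, DP.swap]
    rw [h.eodd q.1.1 q.1.2]
    abel
  ne q := h.ne _ _ q.2

theorem CLf_univ (h : C.St f e) (T) : CL f T := C.CL_of_smooth h.CLf h.smooth T

end Cell.St

/-- Local lower bound for difference quotients of an immersion. -/
theorem exists_immersion_lower {Y V : Type*} [NormedAddCommGroup Y] [NormedSpace ℝ Y] [FiniteDimensional ℝ Y]
    [NormedAddCommGroup V] [NormedSpace ℝ V] {f : Y → V} (hf : ContDiff ℝ (⊤ : ℕ∞) f) (u : Y)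
    (hi : ∀ v, v ≠ 0 → fderiv ℝ f u v ≠ 0) :
    ∃ r > 0, ∀ᶠ q : Y × Y × Y in 𝓝 (u, u, u), 4 * r * ‖q.1 - q.2.1‖ ≤ ‖f q.1 - f q.2.1‖ ∧
      (∀ v, 4 * r * ‖v‖ ≤ ‖fderiv ℝ f q.2.2 v‖) ∧
      ‖f q.1 - f q.2.1 - fderiv ℝ f q.2.2 (q.1 - q.2.1)‖ ≤ r * ‖q.1 - q.2.1‖ := by
  have hker : LinearMap.ker (fderiv ℝ f u : Y →ₗ[ℝ] V) = ⊥ := by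
    rw [LinearMap.ker_eq_bot']
    intro v hv
    by_contra h
    exact hi v h hv
  obtain ⟨K, hK, hanti⟩ := LinearMap.exists_antilipschitzWith (fderiv ℝ f u : Y →ₗ[ℝ] V) hker
  have hK' : (0 : ℝ) < K := by exact_mod_cast hK
  have h0 : ∀ v, ‖v‖ ≤ K * ‖fderiv ℝ f u v‖ := fun v => by
    have := hanti.le_mul_dist v 0
    simpa using this
  set r : ℝ := 1 / (6 * K) with hr
  have hr0 : 0 < r := by positivity
  have h6 : ∀ v, 6 * r * ‖v‖ ≤ ‖fderiv ℝ f u v‖ := fun v => by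
    have h1 : 6 * r = (K : ℝ)⁻¹ := by rw [hr]; field_simp
    rw [h1, inv_mul_le_iff₀ hK']
    exact h0 v
  have hs : HasStrictFDerivAt f (fderiv ℝ f u) u :=
    hf.contDiffAt.hasStrictFDerivAt (by simp)
  have h1 := hs.isLittleO.def (half_pos hr0)
  have hc : Continuous (fderiv ℝ f) := hf.continuous_fderiv (by simp)
  have h2 : ∀ᶠ z in 𝓝 u, ‖fderiv ℝ f z - fderiv ℝ f u‖ < r / 2 := by
    have := Metric.continuousAt_iff'.1 (hc.continuousAt (x := u)) (r / 2) (half_pos hr0)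
    simpa [dist_eq_norm] using this
  refine ⟨r, hr0, ?_⟩
  have h1' : ∀ᶠ q : Y × Y × Y in 𝓝 (u, u, u), ‖f q.1 - f q.2.1 - fderiv ℝ f u (q.1 - q.2.1)‖ ≤ r / 2 * ‖q.1 - q.2.1‖ := by
    have ht : Tendsto (fun q : Y × Y × Y => (q.1, q.2.1)) (𝓝 (u, u, u)) (𝓝 (u, u)) := by
      have : Continuous (fun q : Y × Y × Y => (q.1, q.2.1)) := by fun_prop
      exact this.tendsto (u, u, u)
    exact ht.eventually h1
  have h2' : ∀ᶠ q : Y × Y × Y in 𝓝 (u, u, u), ‖fderiv ℝ f q.2.2 - fderiv ℝ f u‖ < r / 2 := by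
    have ht : Tendsto (fun q : Y × Y × Y => q.2.2) (𝓝 (u, u, u)) (𝓝 u) := by
      have : Continuous (fun q : Y × Y × Y => q.2.2) := by fun_prop
      exact this.tendsto (u, u, u)
    exact ht.eventually h2
  filter_upwards [h1', h2'] with q hq1 hq2
  have h3 : ∀ v, ‖fderiv ℝ f q.2.2 v - fderiv ℝ f u v‖ ≤ r / 2 * ‖v‖ := fun v => by
    rw [← ContinuousLinearMap.sub_apply]
    exact ((fderiv ℝ f q.2.2 - fderiv ℝ f u).le_opNorm v).trans (by gcongr)
  refine ⟨?_, fun v => ?_, ?_⟩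
  · set v := q.1 - q.2.1
    have h4 := h6 v
    have h5 : 0 ≤ r * ‖v‖ := by positivity
    have := norm_sub_norm_le (fderiv ℝ f u v) (f q.1 - f q.2.1)
    rw [norm_sub_rev (fderiv ℝ f u v)] at this
    linarith
  · have h4 := h6 v
    have h5 : 0 ≤ r * ‖v‖ := by positivity
    have h3 := h3 v
    have := norm_sub_norm_le (fderiv ℝ f u v) (fderiv ℝ f q.2.2 v)
    rw [norm_sub_rev (fderiv ℝ f u v)] at this
    linarith
  · set v := q.1 - q.2.1
    have h3 := h3 v
    calc _ = ‖(f q.1 - f q.2.1 - fderiv ℝ f u v) - (fderiv ℝ f q.2.2 v - fderiv ℝ f u v)‖ := by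
          congr 1; abel
      _ ≤ _ := (norm_sub_le _ _).trans (by linarith)

end

section

theorem exists_immersion_radius {Y V : Type*} [NormedAddCommGroup Y] [NormedSpace ℝ Y] [FiniteDimensional ℝ Y]
    [NormedAddCommGroup V] [NormedSpace ℝ V] {f : Y → V} (hf : ContDiff ℝ (⊤ : ℕ∞) f)
    (hi : ∀ u v, v ≠ 0 → fderiv ℝ f u v ≠ 0) :
    ∃ γ : Y → ℝ, Continuous γ ∧ (∀ u, 0 < γ u) ∧
      ∀ η : Y → V, ContDiff ℝ (⊤ : ℕ∞) η → ∀ u, ‖fderiv ℝ η u‖ ≤ γ u → ∀ v, v ≠ 0 →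
        fderiv ℝ (fun u => f u + η u) u v ≠ 0 := by
  obtain ⟨γ, hγ, hγ0, h⟩ := exists_pos_selection (Y := Y)
    (P := fun u r => ∀ v, v ≠ 0 → r * ‖v‖ < ‖fderiv ℝ f u v‖)
    (fun u r r' h1 h2 h v hv => (by gcongr : r' * ‖v‖ ≤ r * ‖v‖).trans_lt (h v hv))
    (fun u => by
      obtain ⟨r, hr, h⟩ := exists_immersion_lower hf u (hi u)
      refine ⟨r, hr, ?_⟩
      have ht : Tendsto (fun z : Y => (u, u, z)) (𝓝 u) (𝓝 (u, u, u)) := by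
        have : Continuous (fun z : Y => (u, u, z)) := by fun_prop
        exact this.tendsto u
      filter_upwards [ht.eventually h] with z hz v hv
      have := hz.2.1 v
      have h1 : 0 < r * ‖v‖ := by positivity
      linarith)
  refine ⟨γ, hγ, hγ0, fun η hη u hu v hv h0 => ?_⟩
  rw [show (fun u => f u + η u) = f + η from rfl, fderiv_add (hf.differentiable (by simp) u)
    (hη.differentiable (by simp) u), ContinuousLinearMap.add_apply] at h0
  have h1 := h u v hv
  rw [eq_neg_of_add_eq_zero_left h0, norm_neg] at h1
  have h2 := (fderiv ℝ η u).le_of_opNorm_le hu v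
  linarith

variable {N : Type*} [MetricSpace N] {p m : ℕ}

namespace Cell.St
variable {C : Cell N p} {f : N → Fin m → ℝ} {e : N × N → Fin m → ℝ}

theorem exists_lower_bound [CompactSpace N] (h : C.St f e) :
    ∃ γ : EuclideanSpace ℝ (Fin p) → ℝ, Continuous γ ∧ (∀ u, 0 < γ u) ∧
      ∀ z, ∀ u ∈ closedBall z 1, ∀ w, w ≠ C.χ u →
        (w ∈ C.L → 4 * γ z ≤ ‖f (C.χ u) - f w + e (C.χ u, w)‖) ∧
        (w ∉ C.L → 4 * γ z * min 1 ‖u - C.ρ w‖ ≤ ‖f (C.χ u) - f w + e (C.χ u, w)‖) := by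
  have hf := h.cont
  have he := h.econt
  have hχ := C.continuous_χ
  let Q : EuclideanSpace ℝ (Fin p) × N → ℝ → Prop := fun q r => q.2 ≠ C.χ q.1 →
    (q.2 ∈ C.L → 4 * r ≤ ‖f (C.χ q.1) - f q.2 + e (C.χ q.1, q.2)‖) ∧
    (q.2 ∉ C.L → 4 * r * min 1 ‖q.1 - C.ρ q.2‖ ≤ ‖f (C.χ q.1) - f q.2 + e (C.χ q.1, q.2)‖)
  have hQ : ∀ q r r', r' ≤ r → Q q r → Q q r' := by
    intro q r r' hr hq hne
    refine ⟨fun hL => ?_, fun hL => ?_⟩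
    · linarith [(hq hne).1 hL]
    · refine le_trans ?_ ((hq hne).2 hL)
      gcongr
  have hloc : ∀ q : EuclideanSpace ℝ (Fin p) × N, ∃ r > 0, ∀ᶠ q' in 𝓝 q, Q q' r := by
    rintro ⟨u, w⟩
    by_cases hw : w = C.χ u
    · subst hw
      obtain ⟨r, hr, hr'⟩ := exists_immersion_lower h.smooth u (h.imm u)
      refine ⟨r, hr, ?_⟩
      have hρ : ContinuousAt C.ρ (C.χ u) := C.continuousAt_ρ (C.χ_notMem u)
      have hρ2 : ContinuousAt (fun q : EuclideanSpace ℝ (Fin p) × N => C.ρ q.2) (u, C.χ u) :=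
        ContinuousAt.comp (f := Prod.snd) hρ continuousAt_snd
      have ht : Tendsto (fun q : EuclideanSpace ℝ (Fin p) × N => (q.1, C.ρ q.2, u)) (𝓝 (u, C.χ u))
          (𝓝 (u, u, u)) := by
        have h1 : ContinuousAt (fun q : EuclideanSpace ℝ (Fin p) × N => (q.1, C.ρ q.2, u)) (u, C.χ u) :=
          continuousAt_fst.prodMk (hρ2.prodMk continuousAt_const)
        have h2 := h1.tendsto
        simp only [C.ρχ] at h2
        exact h2
      have ht2 : Tendsto (fun q : EuclideanSpace ℝ (Fin p) × N => (C.χ q.1, q.2)) (𝓝 (u, C.χ u))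
          (𝓝 (C.χ u, C.χ u)) := by
        have : Continuous (fun q : EuclideanSpace ℝ (Fin p) × N => (C.χ q.1, q.2)) := by fun_prop
        exact this.tendsto (u, C.χ u)
      have hU : ∀ᶠ q : EuclideanSpace ℝ (Fin p) × N in 𝓝 (u, C.χ u), q.2 ∉ C.L := by
        have : IsOpen {q : EuclideanSpace ℝ (Fin p) × N | q.2 ∉ C.L} :=
          C.closed.isOpen_compl.preimage continuous_snd
        exact this.mem_nhds (C.χ_notMem u)
      filter_upwards [ht.eventually hr', ht2.eventually (h.ediag u), hU] with q h1 h2 h3 _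
      refine ⟨fun h4 => absurd h4 h3, fun _ => ?_⟩
      rw [h2, add_zero]
      have h4 := h1.1
      simp only [Function.comp, C.χρ h3] at h4
      refine le_trans ?_ h4
      gcongr
      exact min_le_right _ _
    · have h0 : 0 < ‖f (C.χ u) - f w + e (C.χ u, w)‖ := norm_pos_iff.2 (h.ne _ _ (Ne.symm hw))
      have hc : Continuous fun q : EuclideanSpace ℝ (Fin p) × N =>
        ‖f (C.χ q.1) - f q.2 + e (C.χ q.1, q.2)‖ := by fun_prop
      have h1 := (hc.tendsto (u, w)).eventually (lt_mem_nhds (half_lt_self h0))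
      refine ⟨‖f (C.χ u) - f w + e (C.χ u, w)‖ / 8, by positivity, ?_⟩
      filter_upwards [h1] with q hq _
      refine ⟨fun _ => by linarith, fun _ => ?_⟩
      have h2 : min 1 ‖q.1 - C.ρ q.2‖ ≤ 1 := min_le_left _ _
      have h3 : 0 ≤ min 1 ‖q.1 - C.ρ q.2‖ := le_min zero_le_one (norm_nonneg _)
      nlinarith
  obtain ⟨γ, hγ, hγ0, hP⟩ := exists_pos_selection (Y := EuclideanSpace ℝ (Fin p))
    (P := fun z r => ∀ u ∈ closedBall z 1, ∀ w, Q (u, w) r)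
    (fun z r r' _ hr hz u hu w => hQ _ _ _ hr (hz u hu w))
    (fun z => by
      have hK : IsCompact (closedBall z 2 ×ˢ (univ : Set N)) :=
        (isCompact_closedBall z 2).prod isCompact_univ
      have : ∃ r > 0, ∀ q ∈ closedBall z 2 ×ˢ (univ : Set N), Q q r := by
        refine hK.induction_on (p := fun S => ∃ r > 0, ∀ q ∈ S, Q q r) ⟨1, one_pos, by simp⟩ ?_ ?_ ?_
        · rintro s t hst ⟨r, hr, hq⟩
          exact ⟨r, hr, fun q hqs => hq q (hst hqs)⟩
        · rintro s t ⟨r, hr, hq⟩ ⟨r', hr', hq'⟩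
          refine ⟨min r r', lt_min hr hr', ?_⟩
          rintro q (hs | ht)
          · exact hQ _ _ _ (min_le_left _ _) (hq q hs)
          · exact hQ _ _ _ (min_le_right _ _) (hq' q ht)
        · intro q _
          obtain ⟨r, hr, hev⟩ := hloc q
          exact ⟨_, mem_nhdsWithin_of_mem_nhds hev, r, hr, fun q' hq' => hq'⟩
      obtain ⟨r, hr, hrQ⟩ := this
      refine ⟨r, hr, ?_⟩
      filter_upwards [ball_mem_nhds z one_pos] with z' hz' u hu w
      refine hrQ _ ⟨?_, mem_univ _⟩
      rw [mem_closedBall] at hu ⊢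
      rw [mem_ball] at hz'
      linarith [dist_triangle u z' z])
  exact ⟨γ, hγ, hγ0, fun z u hu w => hP z u hu w⟩

/-- Small smooth perturbations preserve the invariants. -/
theorem exists_perturb [CompactSpace N] (h : C.St f e) :
    ∃ γ : EuclideanSpace ℝ (Fin p) → ℝ, Continuous γ ∧ (∀ u, 0 < γ u) ∧
      ∀ η : EuclideanSpace ℝ (Fin p) → Fin m → ℝ, ContDiff ℝ (⊤ : ℕ∞) η → (∀ u, ‖η u‖ ≤ γ u) →
        (∀ u, ‖fderiv ℝ η u‖ ≤ γ u) →
        C.St (fun x => f x + C.ext η x) e ∧ ElemHom (HH f e) (HH (fun x => f x + C.ext η x) e) := by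
  obtain ⟨γ₁, hγ₁, hγ₁0, h1⟩ := h.exists_lower_bound
  obtain ⟨γ₂, hγ₂, hγ₂0, h2⟩ := exists_immersion_radius h.smooth h.imm
  have hd := C.continuous_d
  have hχ := C.continuous_χ
  refine ⟨fun u => min (γ₁ u) (min (γ₂ u) (C.d (C.χ u))), by fun_prop, fun u =>
    lt_min (hγ₁0 u) (lt_min (hγ₂0 u) (C.d_χ_pos u)), fun η hη hηγ hDη => ?_⟩
  have hη1 : ∀ u, ‖η u‖ ≤ γ₁ u := fun u => (hηγ u).trans (min_le_left _ _)
  have hη3 : ∀ u, ‖η u‖ ≤ C.d (C.χ u) := fun u =>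
    (hηγ u).trans ((min_le_right _ _).trans (min_le_right _ _))
  have hD1 : ∀ u, ‖fderiv ℝ η u‖ ≤ γ₁ u := fun u => (hDη u).trans (min_le_left _ _)
  have hD2 : ∀ u, ‖fderiv ℝ η u‖ ≤ γ₂ u := fun u =>
    (hDη u).trans ((min_le_right _ _).trans (min_le_left _ _))
  have hUL : ∀ u, ∀ w ∈ C.L, ‖η u‖ < ‖f (C.χ u) - f w + e (C.χ u, w)‖ := fun u w hw => by
    have h3 := (h1 u u (mem_closedBall_self zero_le_one) w
      (fun h => C.χ_notMem u (h ▸ hw))).1 hw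
    linarith [hη1 u, hγ₁0 u]
  have hsymm : ∀ x y, ‖f x - f y + e (x, y)‖ = ‖f y - f x + e (y, x)‖ := fun x y => by
    rw [h.eodd x y, ← norm_neg]; congr 1; abel
  have hlt : ∀ x y, x ≠ y → ‖C.ext η x - C.ext η y‖ < ‖f x - f y + e (x, y)‖ := by
    intro x y hxy
    have hpos : 0 < ‖f x - f y + e (x, y)‖ := norm_pos_iff.2 (h.ne x y hxy)
    obtain hx | ⟨u, rfl⟩ := C.cases x <;> obtain hy | ⟨u', rfl⟩ := C.cases y
    · simpa [C.ext_of_mem η hx, C.ext_of_mem η hy] using hpos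
    · rw [C.ext_of_mem η hx, C.ext_χ, zero_sub, norm_neg, hsymm]
      exact hUL u' x hx
    · rw [C.ext_of_mem η hy, C.ext_χ, sub_zero]
      exact hUL u y hy
    · have huu : u ≠ u' := fun h => hxy (by rw [h])
      have hn : 0 < ‖u - u'‖ := norm_pos_iff.2 (sub_ne_zero.2 huu)
      simp only [C.ext_χ]
      have h3 : ∀ z, u ∈ closedBall z 1 → 4 * γ₁ z * min 1 ‖u - u'‖ ≤
          ‖f (C.χ u) - f (C.χ u') + e (C.χ u, C.χ u')‖ := fun z hz => by
        have := (h1 z u hz (C.χ u') (Ne.symm hxy)).2 (C.χ_notMem u')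
        rwa [C.ρχ] at this
      by_cases hle : ‖u - u'‖ ≤ 1
      · rw [min_eq_right hle] at h3
        have h4 := (convex_segment u' u).norm_image_sub_le_of_norm_fderiv_le (𝕜 := ℝ) (f := η)
          (C := ‖f (C.χ u) - f (C.χ u') + e (C.χ u, C.χ u')‖ / (4 * ‖u - u'‖))
          (fun z _ => hη.differentiable (by simp) z) (fun z hz => by
            refine (hD1 z).trans ?_
            rw [le_div_iff₀ (by positivity)]
            have := h3 z (by
              rw [mem_closedBall, dist_eq_norm]
              rw [segment_eq_image'] at hz
              obtain ⟨θ, hθ, rfl⟩ := hz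
              have : u - (u' + θ • (u - u')) = (1 - θ) • (u - u') := by module
              rw [this, norm_smul, Real.norm_of_nonneg (by linarith [hθ.2])]
              nlinarith [hθ.1])
            linarith) (left_mem_segment ℝ u' u) (right_mem_segment ℝ u' u)
        have h5 : ‖f (C.χ u) - f (C.χ u') + e (C.χ u, C.χ u')‖ / (4 * ‖u - u'‖) * ‖u - u'‖ =
          ‖f (C.χ u) - f (C.χ u') + e (C.χ u, C.χ u')‖ / 4 := by field_simp
        rw [h5] at h4
        linarith
      · rw [min_eq_left (not_le.1 hle).le] at h3
        have h4 := h3 u (mem_closedBall_self zero_le_one)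
        have h5 := (h1 u' u' (mem_closedBall_self zero_le_one) (C.χ u) hxy).2 (C.χ_notMem u)
        rw [C.ρχ, norm_sub_rev u' u, min_eq_left (not_le.1 hle).le, hsymm] at h5
        have := norm_sub_le (η u) (η u')
        linarith [hη1 u, hη1 u']
  have hSt : C.St (fun x => f x + C.ext η x) e :=
    { cont := h.cont.add (C.continuous_ext hη.continuous hd (fun x hx => C.d_eq_zero.2 hx) hη3)
      smooth := by
        have : (fun x => f x + C.ext η x) ∘ C.χ = fun u => (f ∘ C.χ) u + η u := by
          ext u; simp
        rw [this]
        exact h.smooth.add hη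
      imm := by
        have : (fun x => f x + C.ext η x) ∘ C.χ = fun u => (f ∘ C.χ) u + η u := by
          ext u; simp
        rw [this]
        exact fun u v hv => h2 η hη u (hD2 u) v hv
      CLf := h.CLf.congr fun x hx => by simp [C.ext_of_mem η hx]
      econt := h.econt
      eodd := h.eodd
      eL := h.eL
      ediag := h.ediag
      CLe := h.CLe
      ne := fun x y hxy h0 => by
        have h3 : f x - f y + e (x, y) = -(C.ext η x - C.ext η y) := by
          rw [← sub_eq_zero, ← h0]; abel
        have h4 := hlt x y hxy
        rw [h3, norm_neg] at h4
        exact lt_irrefl _ h4 }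
  refine ⟨hSt, ElemHom.of_segment h.isOdd hSt.isOdd fun q s hs0 hs1 h0 => ?_⟩
  have h3 : HH f e q = -(s • (C.ext η q.1.1 - C.ext η q.1.2)) := by
    rw [← sub_eq_zero, ← h0]
    simp only [HH]
    module
  have h4 := hlt _ _ q.2
  have h5 : ‖HH f e q‖ ≤ ‖C.ext η q.1.1 - C.ext η q.1.2‖ := by
    rw [h3, norm_neg, norm_smul, Real.norm_of_nonneg hs0]
    exact mul_le_of_le_one_left (norm_nonneg _) hs1
  exact absurd h4 (not_lt.2 h5)

end Cell.St

end

section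

theorem CL.apply {X : Type*} [PseudoEMetricSpace X] {m : ℕ} {F : X → Fin m → ℝ} {T : Set X}
    (h : CL F T) (i : Fin m) : CL (fun x => F x i) T :=
  CL.lip_comp (LipschitzWith.eval (α := fun _ : Fin m => ℝ) i) h

theorem CL.comp_lip {X Y Z : Type*} [PseudoEMetricSpace X] [PseudoEMetricSpace Y] [PseudoEMetricSpace Z]
    {F : X → Y} {G : Y → Z} {T : Set X} {K : ℝ≥0} (hG : CL G univ) (hF : LipschitzWith K F) :
    CL (fun x => G (F x)) T :=
  CL.comp hG (hF.CL T) (mapsTo_univ _ _)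

variable {p m : ℕ}

/-- A map with values in `ℝᵐ` built from a family of functionals. -/
def fam (E : EuclideanSpace ℝ (Fin p) → Quad p →L[ℝ] ℝ) (t : Fin m → Quad p)
    (u : EuclideanSpace ℝ (Fin p)) : Fin m → ℝ := fun i => E u (t i)

section fam
variable {E : EuclideanSpace ℝ (Fin p) → Quad p →L[ℝ] ℝ} (hE : ContDiff ℝ (⊤ : ℕ∞) E)
  (t : Fin m → Quad p)
include hE

theorem contDiff_fam : ContDiff ℝ (⊤ : ℕ∞) (fam E t) :=
  contDiff_pi.2 fun i => hE.clm_apply contDiff_const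

theorem fderiv_fam (u v) (i : Fin m) : fderiv ℝ (fam E t) u v i = fderiv ℝ E u v (t i) := by
  have h1 := (hE.differentiable (by simp) u).hasFDerivAt
  have h2 : HasFDerivAt (fam E t) (ContinuousLinearMap.pi fun i => (fderiv ℝ E u).flip (t i)) u := by
    refine hasFDerivAt_pi.2 fun i => ?_
    exact (h1.clm_apply (hasFDerivAt_const (t i) u)).congr_fderiv (by ext; simp)
  rw [h2.fderiv]
  rfl

omit hE in
theorem norm_fam_le {c : ℝ} {u} (hc : ‖E u‖ ≤ c) (ht : ‖t‖ ≤ 1) : ‖fam E t u‖ ≤ c := by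
  have h0 := (norm_nonneg _).trans hc
  refine (pi_norm_le_iff_of_nonneg h0).2 fun i => ?_
  have h1 := (norm_le_pi_norm t i).trans ht
  calc _ ≤ c * ‖t i‖ := (E u).le_of_opNorm_le hc _
    _ ≤ c := mul_le_of_le_one_right h0 h1

theorem norm_fderiv_fam_le {c : ℝ} {u} (hc : ‖fderiv ℝ E u‖ ≤ c) (ht : ‖t‖ ≤ 1) :
    ‖fderiv ℝ (fam E t) u‖ ≤ c := by
  have h0 : 0 ≤ c := (ContinuousLinearMap.opNorm_nonneg (fderiv ℝ E u)).trans hc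
  refine ContinuousLinearMap.opNorm_le_bound _ h0 fun v => ?_
  refine (pi_norm_le_iff_of_nonneg (by positivity)).2 fun i => ?_
  rw [fderiv_fam hE]
  have h1 := (norm_le_pi_norm t i).trans ht
  calc _ ≤ ‖fderiv ℝ E u v‖ * ‖t i‖ := (fderiv ℝ E u v).le_opNorm _
    _ ≤ ‖fderiv ℝ E u v‖ := mul_le_of_le_one_right (norm_nonneg _) h1
    _ ≤ c * ‖v‖ := (fderiv ℝ E u).le_of_opNorm_le hc v

end fam

variable {N : Type*} [MetricSpace N]

theorem Cell.ext_fam (C : Cell N p) (E : EuclideanSpace ℝ (Fin p) → Quad p →L[ℝ] ℝ)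
    (t : Fin m → Quad p) (x : N) (i : Fin m) : C.ext (fam E t) x i = C.ext E x (t i) := by
  obtain hx | ⟨u, rfl⟩ := C.cases x
  · simp [C.ext_of_mem _ hx]
  · simp [fam]

/-- The interpolation properties of a family of functionals. -/
structure Interp (E : EuclideanSpace ℝ (Fin p) → Quad p →L[ℝ] ℝ) : Prop where
  two : ∀ (o₁ o₂ : Option (EuclideanSpace ℝ (Fin p))) (u : EuclideanSpace ℝ (Fin p)),
        o₁ ≠ some u → o₂ ≠ some u →
        ∃ t, (∀ w ∈ o₁, E w t = 0) ∧ (∀ w ∈ o₂, E w t = 0) ∧ E u t ≠ 0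
  deriv : ∀ (o : Option (EuclideanSpace ℝ (Fin p))) (u v : EuclideanSpace ℝ (Fin p)), o ≠ some u →
        v ≠ 0 → ∃ t, (∀ w ∈ o, E w t = 0) ∧ E u t = 0 ∧ fderiv ℝ E u v t ≠ 0

namespace Cell
variable {E : EuclideanSpace ℝ (Fin p) → Quad p →L[ℝ] ℝ} (C : Cell N p)

theorem exists_option {x z : N} (hz : z ∉ C.L) (hx : x ≠ z) :
    ∃ o : Option (EuclideanSpace ℝ (Fin p)), o ≠ some (C.ρ z) ∧
      ∀ t, (∀ w ∈ o, E w t = 0) → C.ext E x t = 0 := by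
  obtain h | ⟨u, rfl⟩ := C.cases x
  · exact ⟨none, by simp, fun t _ => by simp [C.ext_of_mem _ h]⟩
  · refine ⟨some u, fun h => hx ?_, fun t ht => by simpa using ht⟩
    rw [Option.some.inj h, C.χρ hz]

theorem interp_two (hE : Interp E) {x y z : N} (hz : z ∉ C.L) (hx : x ≠ z) (hy : y ≠ z) :
    ∃ t, C.ext E x t = 0 ∧ C.ext E y t = 0 ∧ C.ext E z t ≠ 0 := by
  obtain ⟨o, ho, h1⟩ := C.exists_option (E := E) hz hx
  obtain ⟨o', ho', h2⟩ := C.exists_option (E := E) hz hy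
  obtain ⟨t, ht, ht', h⟩ := hE.two o o' _ ho ho'
  refine ⟨t, h1 t ht, h2 t ht', ?_⟩
  rw [← C.χρ hz]
  simpa [C.ρχ] using h

theorem interp_deriv (hE : Interp E) {w : N} {u v} (hw : w ≠ C.χ u) (hv : v ≠ 0) :
    ∃ t, C.ext E w t = 0 ∧ E u t = 0 ∧ fderiv ℝ E u v t ≠ 0 := by
  obtain ⟨o, ho, h1⟩ := C.exists_option (E := E) (C.χ_notMem u) hw
  rw [C.ρχ] at ho
  obtain ⟨t, ht, ht', h⟩ := hE.deriv o u v ho hv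
  exact ⟨t, h1 t ht, ht', h⟩

end Cell

/-- The positive part of the set where all but the `k`-th coordinate vanish. -/
def Pos (f : N → Fin m → ℝ) (e : N × N → Fin m → ℝ) (k : Fin m) (x y : N) : Prop :=
  x ≠ y ∧ (∀ i ≠ k, f x i - f y i + e (x, y) i = 0) ∧ 0 < f x k - f y k + e (x, y) k

/-- Triples on which a chain is not excluded by perturbation in the open cell. -/
def Cell.bad (C : Cell N p) (f : N → Fin m → ℝ) (e : N × N → Fin m → ℝ) (k : Fin m) : Set (N × N × N) :=
  {τ | τ.1 ∈ C.L ∧ τ.2.2 ∈ C.L ∧ τ.2.1 ∉ C.L ∧ τ.1 ≠ τ.2.2 ∧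
    (∀ i ≠ k, (f τ.1 - f τ.2.2 + e (τ.1, τ.2.1) + e (τ.2.1, τ.2.2)) i = 0) ∧
    (f τ.1 - f τ.2.2 + e (τ.1, τ.2.1) + e (τ.2.1, τ.2.2)) k ≠ 0}

theorem lip₁ {A B D : Type*} [PseudoEMetricSpace A] [PseudoEMetricSpace B] [PseudoEMetricSpace D] :
    LipschitzWith 1 (fun τ : A × B × D => τ.1) := LipschitzWith.prod_fst

theorem lip₂ {A B D : Type*} [PseudoEMetricSpace A] [PseudoEMetricSpace B] [PseudoEMetricSpace D] :
    LipschitzWith (1 * 1) (fun τ : A × B × D => τ.2.1) := LipschitzWith.prod_fst.comp LipschitzWith.prod_snd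

theorem lip₃ {A B D : Type*} [PseudoEMetricSpace A] [PseudoEMetricSpace B] [PseudoEMetricSpace D] :
    LipschitzWith (1 * 1) (fun τ : A × B × D => τ.2.2) := LipschitzWith.prod_snd.comp LipschitzWith.prod_snd

theorem card_ne (k : Fin m) : (Fintype.card {i // i ≠ k} : ℝ) = m - 1 := by
  rw [Fintype.card_subtype_compl, Fintype.card_fin, Fintype.card_subtype_eq, Nat.cast_sub, Nat.cast_one]
  exact k.pos

/-- Genericity for pairs of functionals. -/
theorem generic_pair {Ω : Type*} [NormedAddCommGroup Ω] [NormedSpace ℝ Ω] [FiniteDimensional ℝ Ω]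
    {X : Type*} [MetricSpace X] [MeasurableSpace X] [BorelSpace X] (k : Fin m) {T : Set X}
    (hT : μH[2 * (m : ℝ) - 2] T = 0) {r₁ r₂ : X → Ω →L[ℝ] ℝ} (h₁ : CL r₁ T) (h₂ : CL r₂ T)
    {a₁ a₂ : X → Fin m → ℝ} (ha₁ : CL a₁ T) (ha₂ : CL a₂ T)
    (hsurj : ∀ τ ∈ T, ∀ b c : ℝ, ∃ t, r₁ τ t = b ∧ r₂ τ t = c) :
    ∀ᶠ t in generic (Fin m → Ω), ∀ τ ∈ T,
      (∀ i ≠ k, r₁ τ (t i) = a₁ τ i ∧ r₂ τ (t i) = a₂ τ i) → False := by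
  have hinj : Function.Injective (Subtype.val : {i // i ≠ k} → Fin m) := Subtype.val_injective
  have hcard2 : ((Fintype.card {i // i ≠ k} : ℝ) * Fintype.card Bool : ℝ) = 2 * (m : ℝ) - 2 := by
    rw [card_ne]; simp; ring
  have := generic_forall_coord (Ω := Ω) (J := Bool) (m := m) hinj (T := T)
    (by rw [hcard2]; exact hT) (r := fun τ j => if j then r₁ τ else r₂ τ)
    (by rintro (_ | _) <;> simpa)
    (a := fun τ i j => if j then a₁ τ i else a₂ τ i)
    (by
      rintro i (_ | _)
      · simpa using ha₂.apply i.1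
      · simpa using ha₁.apply i.1)
    (by
      intro τ hτ b
      obtain ⟨t, h1, h2⟩ := hsurj τ hτ (b true) (b false)
      refine ⟨t, ?_⟩
      rintro (_ | _) <;> simpa)
  refine this.mono fun t ht τ hτ h => ht τ hτ ?_
  rintro i (_ | _)
  · simpa using (h i.1 i.2).2
  · simpa using (h i.1 i.2).1

namespace Cell.St
variable {C : Cell N p} {f : N → Fin m → ℝ} {e : N × N → Fin m → ℝ}
  {E : EuclideanSpace ℝ (Fin p) → Quad p →L[ℝ] ℝ}
variable [CompactSpace N] [SecondCountableTopology N] [MeasurableSpace N] [BorelSpace N]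

theorem neg_CL {X : Type*} [PseudoEMetricSpace X] {F : X → Fin m → ℝ} {T : Set X} (h : CL F T) :
    CL (fun x => -F x) T :=
  CL.lip_comp (G := fun x : Fin m → ℝ => -x) (LipschitzWith.id.neg) h

theorem generic_chain (h : C.St f e) (k : Fin m) (hE : ContDiff ℝ (⊤ : ℕ∞) E) (hI : Interp E)
    (hN : μH[2 * (m : ℝ) - 2] (univ : Set (N × N × N)) = 0) :
    ∀ᶠ t in generic (Fin m → Quad p), ∀ τ ∈ {τ : N × N × N | τ.1 ≠ τ.2.1 ∧ τ.2.1 ≠ τ.2.2 ∧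
      τ.1 ≠ τ.2.2 ∧ τ.2.1 ∉ C.L ∧ (τ.1 ∈ C.L → τ.2.2 ∉ C.L)},
      (∀ i ≠ k, (C.ext E τ.1 - C.ext E τ.2.1) (t i) = (-(f τ.1 - f τ.2.1 + e (τ.1, τ.2.1))) i ∧
        (C.ext E τ.2.1 - C.ext E τ.2.2) (t i) = (-(f τ.2.1 - f τ.2.2 + e (τ.2.1, τ.2.2))) i) →
      False := by
  have hf := h.CLf_univ univ
  have he := h.CLe
  have hÊ := C.CL_ext hE univ
  refine generic_pair (Ω := Quad p) k (measure_mono_null (subset_univ _) hN)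
    (r₁ := fun τ => C.ext E τ.1 - C.ext E τ.2.1) (r₂ := fun τ => C.ext E τ.2.1 - C.ext E τ.2.2)
    (a₁ := fun τ => -(f τ.1 - f τ.2.1 + e (τ.1, τ.2.1)))
    (a₂ := fun τ => -(f τ.2.1 - f τ.2.2 + e (τ.2.1, τ.2.2)))
    ((CL.comp_lip hÊ lip₁).sub (CL.comp_lip hÊ lip₂))
    ((CL.comp_lip hÊ lip₂).sub (CL.comp_lip hÊ lip₃))
    (neg_CL (((CL.comp_lip hf lip₁).sub (CL.comp_lip hf lip₂)).add
          (CL.comp_lip he (lip₁.prodMk lip₂))))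
    (neg_CL (((CL.comp_lip hf lip₂).sub (CL.comp_lip hf lip₃)).add
          (CL.comp_lip he (lip₂.prodMk lip₃)))) ?_
  rintro ⟨x, y, z⟩ ⟨hxy, hyz, hxz, hy, hor⟩ b c
  simp only at hxy hyz hxz hy hor
  by_cases hx : x ∈ C.L
  · refine exists_pair ?_ ?_ b c
    · obtain ⟨t, h1, -, h2⟩ := C.interp_two hI hy hxy hxy
      exact ⟨t, by simp [h1, h2]⟩
    · obtain ⟨t, h1, h2, h3⟩ := C.interp_two hI (hor hx) hxz hyz
      exact ⟨t, by simp [h1, h2], by simp [h2, h3]⟩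
  · obtain ⟨t, h1, h2⟩ := exists_pair (φ₁ := C.ext E y - C.ext E z) (φ₂ := C.ext E x - C.ext E y)
      (by
        obtain ⟨t, h1, -, h2⟩ := C.interp_two hI hy hyz.symm hyz.symm
        exact ⟨t, by simp [h1, h2]⟩)
      (by
        obtain ⟨t, h1, h2, h3⟩ := C.interp_two hI hx hxy.symm hxz.symm
        exact ⟨t, by simp [h1, h2], by simp [h1, h3]⟩) c b
    exact ⟨t, h2, h1⟩

theorem generic_boundary (h : C.St f e) (k : Fin m) (hE : ContDiff ℝ (⊤ : ℕ∞) E) (hI : Interp E)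
    (hB : μH[(m : ℝ) - 1] (C.bad f e k) = 0) :
    ∀ᶠ t in generic (Fin m → Quad p), ∀ τ ∈ C.bad f e k,
      (∀ i ≠ k, C.ext E τ.2.1 (t i) = (f τ.1 - f τ.2.1 + e (τ.1, τ.2.1)) i) → False := by
  have hf := h.CLf_univ univ
  have he := h.CLe
  have hÊ := C.CL_ext hE univ
  have hinj : Function.Injective (Subtype.val : {i // i ≠ k} → Fin m) := Subtype.val_injective
  have hcard1 : ((Fintype.card {i // i ≠ k} : ℝ) * Fintype.card Unit : ℝ) = (m : ℝ) - 1 := by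
    rw [card_ne]; simp
  have := generic_forall_coord (Ω := Quad p) (J := Unit) (m := m) hinj
    (T := C.bad f e k) (by rw [hcard1]; exact hB)
    (r := fun τ _ => C.ext E τ.2.1) (fun _ => CL.comp_lip hÊ lip₂)
    (a := fun τ i _ => (f τ.1 - f τ.2.1 + e (τ.1, τ.2.1)) i)
    (fun i _ => (((CL.comp_lip hf lip₁).sub (CL.comp_lip hf lip₂)).add
          (CL.comp_lip he (lip₁.prodMk lip₂))).apply i.1)
    (by
      rintro ⟨x, y, z⟩ ⟨hx, -, hy, -⟩ b
      simp only at hx hy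
      obtain ⟨t, -, -, ht⟩ := C.interp_two hI hy (x := x) (y := x) (fun h => hy (h ▸ hx))
        (fun h => hy (h ▸ hx))
      exact ⟨(b () / C.ext E y t) • t, fun _ => by simp [ht]⟩)
  exact this.mono fun t ht τ hτ h => ht τ hτ fun i _ => h i.1 i.2

theorem CL_fderiv {G : Type*} [NormedAddCommGroup G] [NormedSpace ℝ G]
    {F : EuclideanSpace ℝ (Fin p) → G} (hF : ContDiff ℝ (⊤ : ℕ∞) F)
    (T : Set (EuclideanSpace ℝ (Fin p) × EuclideanSpace ℝ (Fin p) × N)) :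
    CL (fun τ => fderiv ℝ F τ.1 τ.2.1) T := by
  have h1 : ContDiff ℝ 1 (fun q : EuclideanSpace ℝ (Fin p) × EuclideanSpace ℝ (Fin p) =>
      fderiv ℝ F q.1 q.2) := by
    have := hF.fderiv_right (m := 1) (by norm_cast)
    exact (this.comp contDiff_fst).clm_apply contDiff_snd
  exact CL.comp_lip (CL.of_locallyLipschitz h1.locallyLipschitz univ) (lip₁.prodMk lip₂)

theorem generic_tangent (h : C.St f e) (k : Fin m) (hE : ContDiff ℝ (⊤ : ℕ∞) E) (hI : Interp E)
    (hY : μH[2 * (m : ℝ) - 2] (univ : Set (EuclideanSpace ℝ (Fin p) × EuclideanSpace ℝ (Fin p) × N)) = 0) :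
    ∀ᶠ t in generic (Fin m → Quad p), ∀ τ ∈ {τ : EuclideanSpace ℝ (Fin p) × EuclideanSpace ℝ (Fin p) × N |
      τ.2.1 ≠ 0 ∧ τ.2.2 ≠ C.χ τ.1},
      (∀ i ≠ k, fderiv ℝ E τ.1 τ.2.1 (t i) = (-fderiv ℝ (f ∘ C.χ) τ.1 τ.2.1) i ∧
        (E τ.1 - C.ext E τ.2.2) (t i) = (-(f (C.χ τ.1) - f τ.2.2 + e (C.χ τ.1, τ.2.2))) i) →
      False := by
  have hf := h.CLf_univ univ
  have he := h.CLe
  have hÊ := C.CL_ext hE univ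
  have hEl := CL.of_locallyLipschitz
    (hE.of_le (by simp : (1 : WithTop ℕ∞) ≤ ((⊤ : ℕ∞) : WithTop ℕ∞))).locallyLipschitz univ
  have hχ1 : CL (fun τ : EuclideanSpace ℝ (Fin p) × EuclideanSpace ℝ (Fin p) × N => C.χ τ.1) univ :=
    CL.comp_lip C.CLχ lip₁
  have h1 := CL.comp hf hχ1 (mapsTo_univ _ _)
  have h2 := CL.comp he (hχ1.prodMk (LipschitzWith.CL lip₃ univ)) (mapsTo_univ _ _)
  refine generic_pair (Ω := Quad p) k (measure_mono_null (subset_univ _) hY)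
    (r₁ := fun τ => fderiv ℝ E τ.1 τ.2.1) (r₂ := fun τ => E τ.1 - C.ext E τ.2.2)
    (a₁ := fun τ => -fderiv ℝ (f ∘ C.χ) τ.1 τ.2.1)
    (a₂ := fun τ => -(f (C.χ τ.1) - f τ.2.2 + e (C.χ τ.1, τ.2.2)))
    (CL_fderiv hE _)
    ((CL.comp_lip hEl lip₁).sub (CL.comp_lip hÊ lip₃))
    (neg_CL (CL_fderiv h.smooth _))
    (neg_CL (((h1.sub (CL.comp_lip hf lip₃)).add h2).mono (subset_univ _))) ?_
  rintro ⟨u, v, w⟩ ⟨hv, hw⟩ b c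
  simp only at hv hw
  obtain ⟨t, h1, h2⟩ := exists_pair (φ₁ := E u - C.ext E w) (φ₂ := fderiv ℝ E u v)
    (by
      obtain ⟨t, h1, -, h2⟩ := C.interp_two hI (C.χ_notMem u) hw hw
      rw [C.ext_χ] at h2
      exact ⟨t, by simp [h1, h2]⟩)
    (by
      obtain ⟨t, h1, h2, h3⟩ := C.interp_deriv hI hw hv
      exact ⟨t, by simp [h1, h2], h3⟩) c b
  exact ⟨t, h2, h1⟩

/-- Generic perturbation removes chains through the open cell and degenerate directions. -/
theorem exists_generic (h : C.St f e) (k : Fin m)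
    (hN : μH[2 * (m : ℝ) - 2] (univ : Set (N × N × N)) = 0)
    (hY : μH[2 * (m : ℝ) - 2] (univ : Set (EuclideanSpace ℝ (Fin p) × EuclideanSpace ℝ (Fin p) × N)) = 0)
    (hB : μH[(m : ℝ) - 1] (C.bad f e k) = 0) :
    ∃ f', C.St f' e ∧ ElemHom (HH f e) (HH f' e) ∧ (∀ x ∈ C.L, f' x = f x) ∧
      (∀ x y z, y ∉ C.L → Pos f' e k x y → Pos f' e k y z → False) ∧
      ∀ u v w, v ≠ 0 → w ≠ C.χ u → (∀ i ≠ k, fderiv ℝ (f' ∘ C.χ) u v i = 0) →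
        (∀ i ≠ k, f' (C.χ u) i - f' w i + e (C.χ u, w) i = 0) → False := by
  obtain ⟨γ, hγ, hγ0, hpert⟩ := h.exists_perturb
  obtain ⟨E, hE, hEγ, hDEγ, hE2, hE3⟩ := exists_family hγ hγ0
  have hI : Interp E := ⟨hE2, hE3⟩
  obtain ⟨t, htball, ⟨ht1, ht2⟩, ht3⟩ := exists_of_generic
    (((h.generic_chain k hE hI hN).and (h.generic_boundary k hE hI hB)).and
      (h.generic_tangent k hE hI hY)) (x := 0) one_pos
  have htn : ‖t‖ ≤ 1 := (mem_ball_zero_iff.1 htball).le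
  obtain ⟨hSt, hHom⟩ := hpert (fam E t) (contDiff_fam hE t) (fun u => norm_fam_le t (hEγ u) htn)
    (fun u => norm_fderiv_fam_le hE t (hDEγ u) htn)
  have hfam : ∀ x i, (fun x => f x + C.ext (fam E t) x) x i =
      f x i + C.ext E x (t i) := fun x i => by simp [C.ext_fam]
  refine ⟨_, hSt, hHom, fun x hx => by simp [C.ext_of_mem _ hx], ?_, ?_⟩
  · rintro x y z hy ⟨hxy, h1, h1k⟩ ⟨hyz, h2, h2k⟩
    simp only [hfam] at h1 h2 h1k h2k
    have hxz : x ≠ z := by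
      rintro rfl
      have := congrFun (h.eodd x y) k
      simp only [Pi.neg_apply] at this
      linarith
    by_cases hor : x ∈ C.L → z ∉ C.L
    · refine ht1 (x, y, z) ⟨hxy, hyz, hxz, hy, hor⟩ fun i hi => ?_
      have h1 := h1 i hi
      have h2 := h2 i hi
      simp only [ContinuousLinearMap.sub_apply, Pi.neg_apply, Pi.add_apply, Pi.sub_apply]
      constructor <;> linarith
    · push Not at hor
      have hx0 : ∀ s, C.ext E x s = 0 := fun s => by rw [C.ext_of_mem _ hor.1]; rfl
      have hz0 : ∀ s, C.ext E z s = 0 := fun s => by rw [C.ext_of_mem _ hor.2]; rfl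
      simp only [hx0, hz0] at h1 h2 h1k h2k
      refine ht2 (x, y, z) ⟨hor.1, hor.2, hy, hxz, fun i hi => ?_, ?_⟩ fun i hi => ?_
      · have h1 := h1 i hi
        have h2 := h2 i hi
        simp only [Pi.add_apply, Pi.sub_apply]
        linarith
      · refine ne_of_gt ?_
        simp only [Pi.add_apply, Pi.sub_apply]
        linarith
      · have h1 := h1 i hi
        simp only [Pi.add_apply, Pi.sub_apply]
        linarith
  · intro u v w hv hw h1 h2
    refine ht3 (u, v, w) ⟨hv, hw⟩ fun i hi => ?_
    have h2 := h2 i hi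
    have h1 := h1 i hi
    simp only [hfam, C.ext_χ, Pi.add_apply, fam] at h2
    have hcomp : (fun x => f x + C.ext (fam E t) x) ∘ C.χ = (f ∘ C.χ) + fam E t := by
      ext u; simp
    rw [hcomp, fderiv_add (h.smooth.differentiable (by simp) u)
      ((contDiff_fam hE t).differentiable (by simp) u), ContinuousLinearMap.add_apply, Pi.add_apply,
      fderiv_fam hE] at h1
    simp only [ContinuousLinearMap.sub_apply, Pi.neg_apply, Pi.add_apply, Pi.sub_apply]
    constructor <;> linarith

end Cell.St

end

section

variable {p m : ℕ} {N : Type*} [MetricSpace N]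

/-- A continuous two-variable function vanishing on `L × L` is bounded by a sum of one-variable
functions vanishing exactly on `L`. -/
theorem Cell.exists_sum_bound [CompactSpace N] (C : Cell N p) {F : N × N → ℝ} (hF : Continuous F)
    (hL : ∀ x ∈ C.L, ∀ y ∈ C.L, F (x, y) = 0) (hs : ∀ x y, F (y, x) = F (x, y)) :
    ∃ b : N → ℝ, Continuous b ∧ (∀ x ∈ C.L, b x = 0) ∧ (∀ x, x ∉ C.L → 0 < b x) ∧
      ∀ x y, |F (x, y)| ≤ b x + b y := by
  let h : N → ℝ := fun y => sSup ((fun z => |F (z, y)|) '' C.L) + C.d y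
  have hc1 : Continuous fun y => sSup ((fun z => |F (z, y)|) '' C.L) :=
    C.closed.isCompact.continuous_sSup (f := fun y z => |F (z, y)|) (by
      show Continuous fun q : N × N => |F (q.2, q.1)|
      fun_prop)
  have hh : Continuous h := hc1.add C.continuous_d
  have hbdd : ∀ y, BddAbove ((fun z => |F (z, y)|) '' C.L) := fun y =>
    (C.closed.isCompact.image (by fun_prop)).bddAbove
  have hsup0 : ∀ y, 0 ≤ sSup ((fun z => |F (z, y)|) '' C.L) := fun y =>
    Real.sSup_nonneg (by rintro _ ⟨z, -, rfl⟩; exact abs_nonneg _)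
  have hle : ∀ z ∈ C.L, ∀ y, |F (z, y)| ≤ h y := fun z hz y => by
    have h1 : |F (z, y)| ≤ sSup ((fun z => |F (z, y)|) '' C.L) := le_csSup (hbdd y) ⟨z, hz, rfl⟩
    have := C.d_nonneg y
    simp only [h]
    linarith
  have hhL : ∀ y ∈ C.L, h y = 0 := fun y hy => by
    have h1 : sSup ((fun z => |F (z, y)|) '' C.L) ≤ 0 := Real.sSup_nonpos (by
      rintro _ ⟨z, hz, rfl⟩
      simp [hL z hz y hy])
    simp only [h]
    rw [C.d_eq_zero.2 hy]
    linarith [hsup0 y]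
  have hhU : ∀ y, y ∉ C.L → 0 < h y := fun y hy => by
    have := C.d_pos hy
    have := hsup0 y
    simp only [h]
    linarith
  let a : N → ℝ := fun x => sSup ((fun y => |F (x, y)| - h y) '' univ)
  have ha : Continuous a := isCompact_univ.continuous_sSup (f := fun x y => |F (x, y)| - h y) (by
      show Continuous fun q : N × N => |F (q.1, q.2)| - h q.2
      fun_prop)
  have haL : ∀ x ∈ C.L, a x ≤ 0 := fun x hx => Real.sSup_nonpos (by
      rintro _ ⟨y, -, rfl⟩
      have := hle x hx y
      simp only
      linarith)
  have hle' : ∀ x y, |F (x, y)| - h y ≤ a x := fun x y =>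
    le_csSup (isCompact_univ.image (by fun_prop)).bddAbove ⟨y, mem_univ _, rfl⟩
  refine ⟨fun x => max (a x) 0 + h x, by fun_prop, fun x hx => ?_, fun x hx => ?_, fun x y => ?_⟩
  · simp [haL x hx, hhL x hx]
  · have := hhU x hx
    have := le_max_right (a x) 0
    linarith
  · have h1 := hle' x y
    have h2 := le_max_left (a x) 0
    have h3 := le_max_right (a y) 0
    have h4 : 0 ≤ h x := by
      by_cases hx : x ∈ C.L
      · rw [hhL x hx]
      · exact (hhU x hx).le
    linarith

theorem exists_contDiff_zero_one {s t : Set (EuclideanSpace ℝ (Fin p))} (hs : IsClosed s)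
    (ht : IsClosed t) (hd : Disjoint s t) :
    ∃ f : EuclideanSpace ℝ (Fin p) → ℝ, ContDiff ℝ (⊤ : ℕ∞) f ∧ (∀ x ∈ s, f x = 0) ∧
      (∀ x ∈ t, f x = 1) ∧ ∀ x, 0 ≤ f x ∧ f x ≤ 1 := by
  obtain ⟨f, h0, h1, h⟩ := exists_contMDiffMap_zero_one_of_isClosed
    (modelWithCornersSelf ℝ (EuclideanSpace ℝ (Fin p))) hs ht hd (n := (⊤ : ℕ∞))
  exact ⟨f, f.contMDiff.contDiff, h0, h1, h⟩

/-- The set where all coordinates other than `k` vanish. -/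
def Zer (f : N → Fin m → ℝ) (e : N × N → Fin m → ℝ) (k : Fin m) (x y : N) : Prop :=
  ∀ i ≠ k, f x i - f y i + e (x, y) i = 0

/-- Points of the cell with a degenerate direction. -/
def Cell.deg (C : Cell N p) (f : N → Fin m → ℝ) (k : Fin m) : Set (EuclideanSpace ℝ (Fin p)) :=
  {u | ∃ v, v ≠ 0 ∧ ∀ i ≠ k, fderiv ℝ (f ∘ C.χ) u v i = 0}

namespace Cell.St
variable {C : Cell N p} {f : N → Fin m → ℝ} {e : N × N → Fin m → ℝ}

theorem isClosed_deg (h : C.St f e) (k : Fin m) : IsClosed (C.deg f k) := by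
  have hc : Continuous fun q : EuclideanSpace ℝ (Fin p) × EuclideanSpace ℝ (Fin p) =>
      fderiv ℝ (f ∘ C.χ) q.1 q.2 := by
    have := h.smooth.continuous_fderiv (by simp)
    fun_prop
  let S : Set (EuclideanSpace ℝ (Fin p) × sphere (0 : EuclideanSpace ℝ (Fin p)) 1) :=
    {q | ∀ i ≠ k, fderiv ℝ (f ∘ C.χ) q.1 q.2 i = 0}
  have hS : IsClosed S := by
    have : S = ⋂ i, ⋂ (_ : i ≠ k), {q | fderiv ℝ (f ∘ C.χ) q.1 q.2 i = 0} := by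
      ext q; simp [S]
    rw [this]
    refine isClosed_iInter fun i => isClosed_iInter fun _ => isClosed_eq ?_ continuous_const
    exact (continuous_apply i).comp (hc.comp (by fun_prop : Continuous fun q :
      EuclideanSpace ℝ (Fin p) × sphere (0 : EuclideanSpace ℝ (Fin p)) 1 => (q.1, q.2.1)))
  have : C.deg f k = Prod.fst '' S := by
    ext u
    constructor
    · rintro ⟨v, hv, h⟩
      refine ⟨(u, ⟨‖v‖⁻¹ • v, by simp [norm_smul, hv]⟩), fun i hi => ?_, rfl⟩
      simp [h i hi]
    · rintro ⟨⟨u, v⟩, h, rfl⟩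
      exact ⟨v, ne_zero_of_mem_unit_sphere v, h⟩
  rw [this]
  exact isClosedMap_fst_of_compactSpace _ hS

/-- Near a nondegenerate point of the diagonal there are no zeros of the partial map. -/
theorem eventually_not_zer (h : C.St f e) (k : Fin m) {u} (hu : u ∉ C.deg f k) :
    ∀ᶠ q : EuclideanSpace ℝ (Fin p) × EuclideanSpace ℝ (Fin p) in 𝓝 (u, u),
      Zer f e k (C.χ q.1) (C.χ q.2) → q.1 = q.2 := by
  let f' : EuclideanSpace ℝ (Fin p) → {i // i ≠ k} → ℝ := fun u i => f (C.χ u) i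
  let R : (Fin m → ℝ) →L[ℝ] ({i // i ≠ k} → ℝ) :=
    ContinuousLinearMap.pi fun i => ContinuousLinearMap.proj i.1
  have hR : f' = R ∘ (f ∘ C.χ) := rfl
  have hf' : ContDiff ℝ (⊤ : ℕ∞) f' := by rw [hR]; exact R.contDiff.comp h.smooth
  have hD : ∀ v i, fderiv ℝ f' u v i = fderiv ℝ (f ∘ C.χ) u v i.1 := fun v i => by
    rw [hR, (R.hasFDerivAt.comp u (h.smooth.differentiable (by simp) u).hasFDerivAt).fderiv]
    rfl
  obtain ⟨r, hr, hev⟩ := exists_immersion_lower hf' u fun v hv h0 => hu ⟨v, hv, fun i hi => by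
    rw [← hD v ⟨i, hi⟩, h0]; rfl⟩
  have ht : Tendsto (fun q : EuclideanSpace ℝ (Fin p) × EuclideanSpace ℝ (Fin p) => (q.1, q.2, u))
      (𝓝 (u, u)) (𝓝 (u, u, u)) := by
    have : Continuous (fun q : EuclideanSpace ℝ (Fin p) × EuclideanSpace ℝ (Fin p) => (q.1, q.2, u)) := by
      fun_prop
    exact this.tendsto (u, u)
  have ht' : Tendsto (fun q : EuclideanSpace ℝ (Fin p) × EuclideanSpace ℝ (Fin p) => (C.χ q.1, C.χ q.2))
      (𝓝 (u, u)) (𝓝 (C.χ u, C.χ u)) := by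
    have hχ := C.continuous_χ
    have : Continuous (fun q : EuclideanSpace ℝ (Fin p) × EuclideanSpace ℝ (Fin p) => (C.χ q.1, C.χ q.2)) := by
      fun_prop
    exact this.tendsto (u, u)
  filter_upwards [ht.eventually hev, ht'.eventually (h.ediag u)] with q h1 h2 h3
  have h4 : f' q.1 - f' q.2 = 0 := by
    ext i
    have := h3 i.1 i.2
    rw [h2] at this
    simpa [f'] using this
  have h5 := h1.1
  rw [h4, norm_zero] at h5
  have h6 : ‖q.1 - q.2‖ ≤ 0 := by
    by_contra hcon
    push Not at hcon
    have : 0 < 4 * r * ‖q.1 - q.2‖ := by positivity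
    linarith
  exact sub_eq_zero.1 (norm_le_zero_iff.1 h6)

theorem isClosed_zer (h : C.St f e) (k : Fin m) : IsClosed {q : N × N | Zer f e k q.1 q.2} := by
  have h1 := h.cont
  have h2 := h.econt
  have : {q : N × N | Zer f e k q.1 q.2} =
      ⋂ i, ⋂ (_ : i ≠ k), {q | f q.1 i - f q.2 i + e (q.1, q.2) i = 0} := by
    ext q; simp [Zer]
  rw [this]
  refine isClosed_iInter fun i => isClosed_iInter fun _ => isClosed_eq ?_ continuous_const
  fun_prop

theorem zer_symm (h : C.St f e) {k : Fin m} {x y : N} (hz : Zer f e k x y) : Zer f e k y x := fun i hi => by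
  have := hz i hi
  rw [h.eodd x y, Pi.neg_apply]
  linarith

theorem ne_of_zer (h : C.St f e) {k : Fin m} {x y : N} (hxy : x ≠ y) (hz : Zer f e k x y) :
    f x k - f y k + e (x, y) k ≠ 0 := fun h0 => h.ne x y hxy <| by
  ext i
  by_cases hi : i = k
  · subst hi; simpa using h0
  · simpa using hz i hi

theorem isOpen_near (h : C.St f e) : ∀ x y, (x, y) ∈ interior {q | e q = 0} → (y, x) ∈ interior {q | e q = 0} := by
  intro x y hxy
  rw [mem_interior_iff_mem_nhds] at hxy ⊢
  have : Tendsto (Prod.swap : N × N → N × N) (𝓝 (y, x)) (𝓝 (x, y)) := continuous_swap.tendsto (y, x)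
  filter_upwards [this hxy] with q hq
  have : e (q.2, q.1) = 0 := hq
  have h1 := h.eodd q.2 q.1
  rw [this, neg_zero] at h1
  exact h1

/-- The points of the cell from which a given family of pairs starts form a closed set. -/
theorem isClosed_source [CompactSpace N] (h : C.St f e) (k : Fin m) {V : Set (EuclideanSpace ℝ (Fin p))}
    (hV : IsOpen V) (hdV : C.deg f k ⊆ V) {s : ℝ} :
    IsClosed {u | ∃ w, w ≠ C.χ u ∧ Zer f e k (C.χ u) w ∧ 0 ≤ s * (f (C.χ u) k - f w k + e (C.χ u, w) k) ∧
      ¬ (u ∈ V ∧ w ∈ C.χ '' V ∧ (C.χ u, w) ∈ interior {q | e q = 0})} := by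
  let T : Set (EuclideanSpace ℝ (Fin p) × N) := {q | Zer f e k (C.χ q.1) q.2 ∧
    0 ≤ s * (f (C.χ q.1) k - f q.2 k + e (C.χ q.1, q.2) k) ∧
    q ∉ {q | q.1 ∈ V ∧ q.2 ∈ C.χ '' V ∧ (C.χ q.1, q.2) ∈ interior {q | e q = 0}}}
  have hχ := C.continuous_χ
  have hf := h.cont
  have he := h.econt
  have hm : Continuous fun q : EuclideanSpace ℝ (Fin p) × N => (C.χ q.1, q.2) := by fun_prop
  have hO : IsOpen {q : EuclideanSpace ℝ (Fin p) × N | q.1 ∈ V ∧ q.2 ∈ C.χ '' V ∧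
      (C.χ q.1, q.2) ∈ interior {q | e q = 0}} :=
    (hV.preimage continuous_fst).inter (((C.emb.isOpenMap V hV).preimage continuous_snd).inter
      (isOpen_interior.preimage hm))
  have hle : IsClosed {q : EuclideanSpace ℝ (Fin p) × N |
      0 ≤ s * (f (C.χ q.1) k - f q.2 k + e (C.χ q.1, q.2) k)} :=
    isClosed_le continuous_const (by fun_prop)
  have hT : IsClosed T := ((h.isClosed_zer k).preimage hm).inter (hle.inter hO.isClosed_compl)
  let S : Set (EuclideanSpace ℝ (Fin p) × N) := {q | q.2 ≠ C.χ q.1} ∩ T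
  have hS : IsClosed S := by
    rw [← isOpen_compl_iff, isOpen_iff_eventually]
    rintro ⟨u, w⟩ hq
    by_cases hw : w = C.χ u
    · subst hw
      by_cases hu : u ∈ C.deg f k
      · have h1 : ∀ᶠ q in 𝓝 (u, C.χ u), q ∈ {q : EuclideanSpace ℝ (Fin p) × N | q.1 ∈ V ∧ q.2 ∈ C.χ '' V ∧
            (C.χ q.1, q.2) ∈ interior {q | e q = 0}} :=
          hO.mem_nhds ⟨hdV hu, ⟨u, hdV hu, rfl⟩, mem_interior_iff_mem_nhds.2 (h.ediag u)⟩
        filter_upwards [h1] with q hq hqS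
        exact hqS.2.2.2 hq
      · have h1 := h.eventually_not_zer k hu
        rw [nhds_prod_eq] at h1 ⊢
        rw [← C.emb.map_nhds_eq u]
        have h2 : ∀ᶠ q in (𝓝 u) ×ˢ (map C.χ (𝓝 u)), q.2 ∈ range C.χ → Zer f e k (C.χ q.1) (C.χ (C.ρ q.2)) → q.1 = C.ρ q.2 := by
          have : (𝓝 u) ×ˢ (map C.χ (𝓝 u)) = map (fun q : EuclideanSpace ℝ (Fin p) × EuclideanSpace ℝ (Fin p) => (q.1, C.χ q.2)) ((𝓝 u) ×ˢ (𝓝 u)) := by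
            conv_lhs => rw [← map_id (f := 𝓝 u)]
            rw [Filter.prod_map_map_eq]
            simp
          rw [this, eventually_map]
          filter_upwards [h1] with q hq _
          simpa [C.ρχ] using hq
        have h3 : ∀ᶠ q in (𝓝 u) ×ˢ (map C.χ (𝓝 u)), q.2 ∈ range C.χ := by
          refine tendsto_snd.eventually (p := fun w => w ∈ range C.χ) ?_
          rw [eventually_map]
          exact Eventually.of_forall fun v => mem_range_self v
        filter_upwards [h2, h3] with q h2 ⟨v, hv⟩ hqS
        have h4 := h2 ⟨v, hv⟩
        rw [← hv, C.ρχ] at h4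
        exact hqS.1 (by rw [← hv, h4 (by rw [hv]; exact hqS.2.1)])
    · have h1 : (u, w) ∈ Tᶜ := fun h => hq ⟨hw, h⟩
      filter_upwards [hT.isOpen_compl.mem_nhds h1] with q hq hqS
      exact hq hqS.2
  have : {u | ∃ w, w ≠ C.χ u ∧ Zer f e k (C.χ u) w ∧ 0 ≤ s * (f (C.χ u) k - f w k + e (C.χ u, w) k) ∧
      ¬ (u ∈ V ∧ w ∈ C.χ '' V ∧ (C.χ u, w) ∈ interior {q | e q = 0})} = Prod.fst '' S := by
    ext u
    constructor
    · rintro ⟨w, h1, h2⟩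
      exact ⟨(u, w), ⟨h1, h2⟩, rfl⟩
    · rintro ⟨⟨u, w⟩, ⟨h1, h2⟩, rfl⟩
      exact ⟨w, h1, h2⟩
  rw [this]
  exact isClosedMap_fst_of_compactSpace _ hS

theorem isClosed_far [CompactSpace N] (h : C.St f e) (k : Fin m) :
    IsClosed {u | ∃ w, Zer f e k (C.χ u) w ∧ (C.χ u, w) ∉ interior {q | e q = 0}} := by
  have hχ := C.continuous_χ
  have hm : Continuous fun q : EuclideanSpace ℝ (Fin p) × N => (C.χ q.1, q.2) := by fun_prop
  have hS : IsClosed {q : EuclideanSpace ℝ (Fin p) × N | Zer f e k (C.χ q.1) q.2 ∧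
      (C.χ q.1, q.2) ∈ (interior {q | e q = 0})ᶜ} :=
    ((h.isClosed_zer k).preimage hm).inter (isOpen_interior.isClosed_compl.preimage hm)
  have : {u | ∃ w, Zer f e k (C.χ u) w ∧ (C.χ u, w) ∉ interior {q | e q = 0}} =
      Prod.fst '' {q : EuclideanSpace ℝ (Fin p) × N | Zer f e k (C.χ q.1) q.2 ∧
      (C.χ q.1, q.2) ∈ (interior {q | e q = 0})ᶜ} := by
    ext u
    constructor
    · rintro ⟨w, h1, h2⟩
      exact ⟨(u, w), ⟨h1, h2⟩, rfl⟩
    · rintro ⟨⟨u, w⟩, ⟨h1, h2⟩, rfl⟩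
      exact ⟨w, h1, h2⟩
  rw [this]
  exact isClosedMap_fst_of_compactSpace _ hS

end Cell.St

end

section

variable {p m : ℕ} {N : Type*} [MetricSpace N]

theorem convex_pos {A B s : ℝ} (hA : 0 < A) (hB : 0 < B) (h0 : 0 ≤ s) (h1 : s ≤ 1) :
    0 < (1 - s) * A + s * B := by
  rcases h0.eq_or_lt with rfl | h
  · simpa using hA
  · have := mul_pos h hB
    have := mul_nonneg (sub_nonneg.2 h1) hA.le
    linarith

namespace Cell.St
variable {C : Cell N p} {f : N → Fin m → ℝ} {e : N × N → Fin m → ℝ}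

/-- The correcting function for the `k`-th coordinate. -/
theorem exists_correction [CompactSpace N] (h : C.St f e) (k : Fin m)
    (hchain : ∀ x y z, y ∉ C.L → Pos f e k x y → Pos f e k y z → False)
    (htan : ∀ u v w, v ≠ 0 → w ≠ C.χ u → (∀ i ≠ k, fderiv ℝ (f ∘ C.χ) u v i = 0) →
        (∀ i ≠ k, f (C.χ u) i - f w i + e (C.χ u, w) i = 0) → False) :
    ∃ ψ : EuclideanSpace ℝ (Fin p) → ℝ, ContDiff ℝ (⊤ : ℕ∞) ψ ∧ Continuous (C.ext ψ) ∧
      (∀ u ∈ C.deg f k, ∀ᶠ u' in 𝓝 u, ψ u' = 0) ∧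
      ∀ x y, Pos f e k x y → 0 < f x k - f y k + C.ext ψ x - C.ext ψ y := by
  set O : Set (N × N) := interior {q | e q = 0} with hO
  have hOe : ∀ q ∈ O, e q = 0 := fun q hq => interior_subset (s := {q | e q = 0}) hq
  have hdiag : ∀ u, (C.χ u, C.χ u) ∈ O := fun u => mem_interior_iff_mem_nhds.2 (h.ediag u)
  let A : Set (EuclideanSpace ℝ (Fin p)) := {u | ∃ w, Zer f e k (C.χ u) w ∧ (C.χ u, w) ∉ O}
  have hA : IsClosed A := h.isClosed_far k
  have hdA : C.deg f k ⊆ Aᶜ := by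
    rintro u ⟨v, hv, hD⟩ ⟨w, hw, hwO⟩
    exact htan u v w hv (fun hwu => hwO (hwu ▸ hdiag u)) hD hw
  obtain ⟨V, hV, hdV, hVA⟩ := normal_exists_closure_subset (h.isClosed_deg k) hA.isOpen_compl hdA
  obtain ⟨κ, hκ, hκ0, hκ1, hκ01⟩ := exists_contDiff_zero_one isClosed_closure hA
    (disjoint_compl_right_iff_subset.2 hVA |>.mono_right (compl_compl A).ge)
  let Ex : N → N → Prop := fun x y => x ∈ C.χ '' V ∧ y ∈ C.χ '' V ∧ (x, y) ∈ O
  have hExs : ∀ x y, Ex x y → Ex y x := fun x y ⟨h1, h2, h3⟩ => ⟨h2, h1, h.isOpen_near x y h3⟩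
  have hExχ : ∀ u w, Ex (C.χ u) w ↔ (u ∈ V ∧ w ∈ C.χ '' V ∧ (C.χ u, w) ∈ O) := fun u w => by
    simp only [Ex, C.emb.injective.mem_set_image]
  let S : ℝ → Set (EuclideanSpace ℝ (Fin p)) := fun s => {u | ∃ w, w ≠ C.χ u ∧ Zer f e k (C.χ u) w ∧
    0 ≤ s * (f (C.χ u) k - f w k + e (C.χ u, w) k) ∧
      ¬ (u ∈ V ∧ w ∈ C.χ '' V ∧ (C.χ u, w) ∈ O)}
  have hS : ∀ s, IsClosed (S s) := fun s => h.isClosed_source k hV hdV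
  have hdisj : Disjoint (S (-1)) (S 1) := by
    rw [Set.disjoint_left]
    rintro u ⟨w, h1, h2, h3, -⟩ ⟨w', h1', h2', h3', -⟩
    refine hchain w (C.χ u) w' (C.χ_notMem u) ⟨h1, h.zer_symm h2, ?_⟩ ⟨h1'.symm, h2', ?_⟩
    · refine lt_of_le_of_ne ?_ (h.ne_of_zer h1 (h.zer_symm h2)).symm
      rw [h.eodd (C.χ u) w, Pi.neg_apply]
      linarith
    · refine lt_of_le_of_ne ?_ (h.ne_of_zer h1'.symm h2').symm
      linarith
  obtain ⟨s, hs, hs0, hs1, hs01⟩ := exists_contDiff_zero_one (hS (-1)) (hS 1) hdisj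
  have heC := h.econt
  obtain ⟨b, hb, hb0, hbpos, hble⟩ := C.exists_sum_bound (F := fun q => |e q k|) (by fun_prop)
    (fun x hx y hy => by simp [h.eL x hx y hy]) (fun x y => by simp [h.eodd x y])
  have hbχ : Continuous fun u => b (C.χ u) := hb.comp C.continuous_χ
  obtain ⟨ε, hε, hεb, -⟩ := Continuous.exists_contDiff_approx (⊤ : ℕ∞)
    (f := fun u => (3 / 2 : ℝ) * b (C.χ u)) (ε := fun u => (1 / 2 : ℝ) * b (C.χ u)) (hbχ.const_mul _) (hbχ.const_mul _)
    (fun u => by have := hbpos _ (C.χ_notMem u); positivity)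
  have hε1 : ∀ u, b (C.χ u) ≤ ε u ∧ ε u ≤ 2 * b (C.χ u) := fun u => by
    have := hεb u
    rw [Real.dist_eq, abs_lt] at this
    constructor <;> linarith
  have hbχ0 : ∀ u, 0 < b (C.χ u) := fun u => hbpos _ (C.χ_notMem u)
  let ψ : EuclideanSpace ℝ (Fin p) → ℝ := fun u => ε u * κ u * (2 * s u - 1)
  have hψ : ContDiff ℝ (⊤ : ℕ∞) ψ := (hε.mul hκ).mul ((contDiff_const.mul hs).sub contDiff_const)
  have hψV : ∀ u ∈ V, ψ u = 0 := fun u hu => by simp [ψ, hκ0 u (subset_closure hu)]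
  have hextV : ∀ x ∈ C.χ '' V, C.ext ψ x = 0 := by
    rintro _ ⟨u, hu, rfl⟩
    rw [C.ext_χ, hψV u hu]
  have hX : ∀ x y, Pos f e k x y → ¬ Ex x y → 0 ≤ C.ext ψ x ∧ ((x, y) ∉ O → b x ≤ C.ext ψ x) := by
    rintro x y ⟨hxy, hz, hp⟩ hE
    obtain hx | ⟨u, rfl⟩ := C.cases x
    · simp [C.ext_of_mem ψ hx, hb0 x hx]
    · have h1 : s u = 1 := hs1 u ⟨y, hxy.symm, hz, by linarith, by rw [← hExχ]; exact hE⟩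
      simp only [C.ext_χ, ψ, h1]
      have h2 := hκ01 u
      have h3 := hε1 u
      have h4 := hbχ0 u
      refine ⟨?_, fun hn => ?_⟩
      · have : 0 ≤ ε u * κ u := mul_nonneg (h4.le.trans h3.1) h2.1
        linarith
      · rw [hκ1 u ⟨y, hz, hn⟩]
        linarith
  have hY : ∀ x y, Pos f e k x y → ¬ Ex x y → C.ext ψ y ≤ 0 ∧ ((x, y) ∉ O → C.ext ψ y ≤ -b y) := by
    rintro x y ⟨hxy, hz, hp⟩ hE
    obtain hy | ⟨u, rfl⟩ := C.cases y
    · simp [C.ext_of_mem ψ hy, hb0 y hy]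
    · have h1 : s u = 0 := hs0 u ⟨x, hxy, h.zer_symm hz, by
          rw [h.eodd x (C.χ u), Pi.neg_apply]; linarith, by
          rw [← hExχ]; exact fun hh => hE (hExs _ _ hh)⟩
      simp only [C.ext_χ, ψ, h1]
      have h2 := hκ01 u
      have h3 := hε1 u
      have h4 := hbχ0 u
      refine ⟨?_, fun hn => ?_⟩
      · have : 0 ≤ ε u * κ u := mul_nonneg (h4.le.trans h3.1) h2.1
        linarith
      · rw [hκ1 u ⟨x, h.zer_symm hz, fun hh => hn (h.isOpen_near _ _ hh)⟩]
        linarith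
  refine ⟨ψ, hψ, ?_, fun u hu => ?_, fun x y hP => ?_⟩
  · refine C.continuous_ext hψ.continuous (b := fun x => 2 * b x) (by fun_prop)
      (fun x hx => by simp [hb0 x hx]) fun u => ?_
    have h2 := hκ01 u
    have h3 := hε1 u
    have h4 := hbχ0 u
    have h5 := hs01 u
    rw [Real.norm_eq_abs, abs_mul, abs_mul, abs_of_nonneg h2.1, abs_of_nonneg (h4.le.trans h3.1)]
    have h6 : |2 * s u - 1| ≤ 1 := abs_le.2 ⟨by linarith, by linarith⟩
    calc ε u * κ u * |2 * s u - 1| ≤ ε u * 1 * 1 := by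
          have := h4.le.trans h3.1
          have := h2.1
          have := h2.2
          gcongr
      _ ≤ _ := by linarith
  · filter_upwards [hV.mem_nhds (hdV hu)] with u' hu' using hψV u' hu'
  · have hp := hP.2.2
    by_cases hE : Ex x y
    · rw [hextV x hE.1, hextV y hE.2.1]
      rw [hOe _ hE.2.2] at hp
      simp only [Pi.zero_apply] at hp
      linarith
    · have h1 := hX x y hP hE
      have h2 := hY x y hP hE
      by_cases hn : (x, y) ∈ O
      · rw [hOe _ hn] at hp
        simp only [Pi.zero_apply] at hp
        linarith [h1.1, h2.1]
      · have h3 := hble x y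
        simp only [abs_abs] at h3
        have := le_abs_self (e (x, y) k)
        linarith [h1.2 hn, h2.2 hn]

/-- Removal of the `k`-th coordinate of the correction. -/
theorem exists_remove [CompactSpace N] (h : C.St f e) (k : Fin m)
    (hchain : ∀ x y z, y ∉ C.L → Pos f e k x y → Pos f e k y z → False)
    (htan : ∀ u v w, v ≠ 0 → w ≠ C.χ u → (∀ i ≠ k, fderiv ℝ (f ∘ C.χ) u v i = 0) →
        (∀ i ≠ k, f (C.χ u) i - f w i + e (C.χ u, w) i = 0) → False) :
    ∃ f', C.St f' (fun q => Function.update (e q) k 0) ∧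
      ElemHom (HH f e) (HH f' (fun q => Function.update (e q) k 0)) ∧ ∀ x ∈ C.L, f' x = f x := by
  obtain ⟨ψ, hψ, hcont, hdeg, hpos⟩ := h.exists_correction k hchain htan
  let f' : N → Fin m → ℝ := fun x => f x + Pi.single k (C.ext ψ x)
  have hk : ∀ x, f' x k = f x k + C.ext ψ x := fun x => by simp [f']
  have hi : ∀ x, ∀ i ≠ k, f' x i = f x i := fun x i hi => by simp [f', hi]
  have hsing : ContDiff ℝ (⊤ : ℕ∞) (fun u => (Pi.single k (ψ u) : Fin m → ℝ)) :=
    (ContinuousLinearMap.single ℝ (fun _ : Fin m => ℝ) k).contDiff.comp hψ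
  have hcomp : f' ∘ C.χ = fun u => (f ∘ C.χ) u + Pi.single k (ψ u) := by
    ext u : 1; simp [f']
  have hsmooth : ContDiff ℝ (⊤ : ℕ∞) (f' ∘ C.χ) := by
    rw [hcomp]; exact h.smooth.add hsing
  have hL : ∀ x ∈ C.L, f' x = f x := fun x hx => by simp [f', C.ext_of_mem ψ hx]
  have hkey : ∀ x y, x ≠ y → ∀ s : ℝ, 0 ≤ s → s ≤ 1 →
      (1 - s) • (f x - f y + e (x, y)) + s • (f' x - f' y + Function.update (e (x, y)) k 0) ≠ 0 := by
    intro x y hxy s hs0 hs1 h0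
    have hz : Zer f e k x y := fun i hik => by
      have := congrFun h0 i
      simp only [Pi.add_apply, Pi.sub_apply, Pi.smul_apply, smul_eq_mul, hi _ i hik, ne_eq, hik, not_false_eq_true,
        Function.update_of_ne, Pi.zero_apply] at this
      linarith
    have h0k := congrFun h0 k
    simp only [Pi.add_apply, Pi.sub_apply, Pi.smul_apply, smul_eq_mul, hk, Function.update_self,
      Pi.zero_apply] at h0k
    have hne := h.ne_of_zer hxy hz
    obtain hp | hp := lt_or_gt_of_ne hne
    · have h1 : Pos f e k y x := ⟨hxy.symm, h.zer_symm hz, by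
        rw [h.eodd x y, Pi.neg_apply]; linarith⟩
      have h2 := hpos y x h1
      have := convex_pos (A := -(f x k - f y k + e (x, y) k)) (by linarith) h2 hs0 hs1
      nlinarith
    · have h1 : Pos f e k x y := ⟨hxy, hz, hp⟩
      have h2 := hpos x y h1
      have := convex_pos hp h2 hs0 hs1
      nlinarith
  have hSt : C.St f' (fun q => Function.update (e q) k 0) := by
    refine ⟨?_, hsmooth, ?_, ?_, ?_, ?_, ?_, ?_, ?_, ?_⟩
    · exact h.cont.add ((ContinuousLinearMap.single ℝ (fun _ : Fin m => ℝ) k).continuous.comp hcont)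
    · intro u v hv h0
      have hd : u ∈ C.deg f k := by
        refine ⟨v, hv, fun i hik => ?_⟩
        have h1 := congrFun h0 i
        rw [hcomp, fderiv_fun_add (h.smooth.differentiable (by simp) u)
          (hsing.differentiable (by simp) u), ContinuousLinearMap.add_apply, Pi.add_apply] at h1
        have h2 : fderiv ℝ (fun u => (Pi.single k (ψ u) : Fin m → ℝ)) u v i = 0 := by
          have := ((ContinuousLinearMap.single ℝ (fun _ : Fin m => ℝ) k).hasFDerivAt.comp u
            (hψ.differentiable (by simp) u).hasFDerivAt).fderiv
          have h3 : (fun u => (Pi.single k (ψ u) : Fin m → ℝ)) =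
            (ContinuousLinearMap.single ℝ (fun _ : Fin m => ℝ) k) ∘ ψ := rfl
          rw [h3, this]
          simp [hik]
        rw [h2] at h1
        simpa using h1
      have heq : f' ∘ C.χ =ᶠ[𝓝 u] f ∘ C.χ := by
        filter_upwards [hdeg u hd] with u' hu'
        rw [hcomp]
        simp [hu']
      rw [heq.fderiv_eq] at h0
      exact h.imm u v hv h0
    · exact h.CLf.congr fun x hx => (hL x hx).symm
    · exact h.econt.update k continuous_const
    · intro x y
      ext i
      by_cases hik : i = k
      · subst hik; simp
      · simp [hik, h.eodd x y]
    · intro x hx y hy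
      simp [h.eL x hx y hy]
    · intro u
      filter_upwards [h.ediag u] with q hq
      simp [hq]
    · refine CL.pi fun i => ?_
      by_cases hik : i = k
      · subst hik
        simpa using (LipschitzWith.const (0 : ℝ)).CL (X := N × N) univ
      · simpa [hik] using h.CLe.apply i
    · intro x y hxy
      simpa using hkey x y hxy 1 zero_le_one le_rfl
  exact ⟨f', hSt, ElemHom.of_segment h.isOdd hSt.isOdd fun q s h0 h1 => hkey _ _ q.2 s h0 h1, hL⟩

end Cell.St

end

section

variable {p m : ℕ} {N : Type*} [MetricSpace N]

/-- Keep only the first `k` coordinates. -/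
def trunc (k : ℕ) (e : N × N → Fin m → ℝ) (q : N × N) : Fin m → ℝ := fun i => if i.val < k then e q i else 0

namespace Cell.St
variable {C : Cell N p} {f : N → Fin m → ℝ} {e : N × N → Fin m → ℝ}

theorem bad_congr {f' : N → Fin m → ℝ} (hf : ∀ x ∈ C.L, f' x = f x) (k : Fin m) :
    C.bad f' e k ⊆ C.bad f e k := by
  rintro τ ⟨h1, h2, h3, h4, h5, h6⟩
  rw [hf _ h1, hf _ h2] at h5 h6
  exact ⟨h1, h2, h3, h4, h5, h6⟩

theorem exists_final [CompactSpace N] [SecondCountableTopology N] [MeasurableSpace N] [BorelSpace N]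
    (h : C.St f e)
    (hN : μH[2 * (m : ℝ) - 2] (univ : Set (N × N × N)) = 0)
    (hY : μH[2 * (m : ℝ) - 2] (univ : Set (EuclideanSpace ℝ (Fin p) × EuclideanSpace ℝ (Fin p) × N)) = 0)
    (hB : ∀ k : Fin m, μH[(m : ℝ) - 1] (C.bad f (trunc (k + 1) e) k) = 0) :
    ∀ j k : ℕ, j + k = m → ∃ f', C.St f' (trunc k e) ∧ AHom (HH f e) (HH f' (trunc k e)) ∧
      ∀ x ∈ C.L, f' x = f x := by
  intro j
  induction j with
  | zero =>
    intro k hk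
    have : trunc k e = e := by
      ext q i
      simp [trunc, show i.val < k by omega]
    rw [this]
    exact ⟨f, h, Relation.ReflTransGen.refl, fun _ _ => rfl⟩
  | succ j ih =>
    intro k hk
    obtain ⟨f₁, h1, hA1, hL1⟩ := ih (k + 1) (by omega)
    obtain ⟨f₂, h2, hA2, hL2, hc, ht⟩ := h1.exists_generic ⟨k, by omega⟩ hN hY
      (measure_mono_null (bad_congr hL1 _) (hB ⟨k, by omega⟩))
    obtain ⟨f₃, h3, hA3, hL3⟩ := h2.exists_remove ⟨k, by omega⟩ hc ht
    have : (fun q => Function.update (trunc (k + 1) e q) ⟨k, by omega⟩ 0) = trunc k e := by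
      ext q i
      by_cases hi : i = ⟨k, by omega⟩
      · subst hi; simp [trunc]
      · have : i.val ≠ k := fun hh => hi (Fin.ext hh)
        have h4 : i.val < k + 1 ↔ i.val < k := by omega
        simp [hi, trunc, h4]
    rw [this] at h3 hA3
    exact ⟨f₃, h3, hA1.trans (hA2.aHom.trans hA3.aHom), fun x hx =>
      (hL3 x hx).trans ((hL2 x hx).trans (hL1 x hx))⟩

theorem comp_linear (h : C.St f e) {A : (Fin m → ℝ) →L[ℝ] (Fin m → ℝ)} (hA : ∀ w, w ≠ 0 → A w ≠ 0) :
    C.St (fun x => A (f x)) (fun q => A (e q)) where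
  cont := A.continuous.comp h.cont
  smooth := A.contDiff.comp h.smooth
  imm u v hv := by
    have : (fun x => A (f x)) ∘ C.χ = A ∘ (f ∘ C.χ) := rfl
    rw [this, (A.hasFDerivAt.comp u (h.smooth.differentiable (by simp) u).hasFDerivAt).fderiv]
    exact hA _ (h.imm u v hv)
  CLf := CL.lip_comp A.lipschitz h.CLf
  econt := A.continuous.comp h.econt
  eodd x y := by rw [h.eodd, map_neg]
  eL x hx y hy := by rw [h.eL x hx y hy, map_zero]
  ediag u := (h.ediag u).mono fun q hq => by rw [hq, map_zero]
  CLe := CL.lip_comp A.lipschitz h.CLe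
  ne x y hxy := by
    rw [← map_sub, ← map_add]
    exact hA _ (h.ne x y hxy)

/-- The linear functionals `A ↦ φ (A w)`, as a linear map in `w`. -/
noncomputable def evalComp {E : Type*} [NormedAddCommGroup E] [NormedSpace ℝ E] (φ : E →L[ℝ] ℝ) :
    E →ₗ[ℝ] (E →L[ℝ] E) →L[ℝ] ℝ where
  toFun w := φ.comp (ContinuousLinearMap.apply ℝ E w)
  map_add' w w' := by ext A; simp
  map_smul' c w := by ext A; simp

theorem exists_lipschitz_evalComp {E : Type*} [NormedAddCommGroup E] [NormedSpace ℝ E]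
    (φ : E →L[ℝ] ℝ) : ∃ K, LipschitzWith K (evalComp φ) := by
  refine ⟨‖φ‖₊, LipschitzWith.of_dist_le_mul fun w w' => ?_⟩
  rw [dist_eq_norm, dist_eq_norm, ← map_sub]
  refine ContinuousLinearMap.opNorm_le_bound _ (by positivity) fun A => ?_
  show ‖φ (A (w - w'))‖ ≤ ‖φ‖ * ‖w - w'‖ * ‖A‖
  calc _ ≤ ‖φ‖ * (‖A‖ * ‖w - w'‖) := (φ.le_opNorm _).trans (by gcongr; exact A.le_opNorm _)
    _ = _ := by ring

/-- The linear functionals `A ↦ (A w) i`, as a linear map in `w`. -/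
noncomputable abbrev row (i : Fin m) : (Fin m → ℝ) →ₗ[ℝ] ((Fin m → ℝ) →L[ℝ] (Fin m → ℝ)) →L[ℝ] ℝ :=
  evalComp (E := Fin m → ℝ) (ContinuousLinearMap.proj i)

theorem exists_lipschitz_row (i : Fin m) :
    ∃ K, LipschitzWith K (evalComp (E := Fin m → ℝ) (ContinuousLinearMap.proj i)) :=
  exists_lipschitz_evalComp (E := Fin m → ℝ) _

theorem exists_lipschitzWith_linearMap {E F : Type*} [NormedAddCommGroup E] [NormedSpace ℝ E]
    [FiniteDimensional ℝ E] [NormedAddCommGroup F] [NormedSpace ℝ F] (L : E →ₗ[ℝ] F) :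
    ∃ K, LipschitzWith K L :=
  ⟨_, (LinearMap.toContinuousLinearMap L).lipschitz⟩

theorem row_apply (i : Fin m) (w : Fin m → ℝ) (A : (Fin m → ℝ) →L[ℝ] (Fin m → ℝ)) :
    row i w A = A w i := rfl

set_option maxHeartbeats 1000000 in
theorem generic_rotate [SecondCountableTopology N] [MeasurableSpace N] [BorelSpace N] (h : C.St f e)
    (hN : μH[2 * (m : ℝ) - 2] (univ : Set (N × N × N)) = 0) (k : Fin m) :
    ∀ᶠ A in generic ((Fin m → ℝ) →L[ℝ] (Fin m → ℝ)),
      μH[(m : ℝ) - 1] (C.bad (fun x => A (f x)) (trunc (k + 1) fun q => A (e q)) k) = 0 := by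
  let W : N × N × N → Fin m → ℝ := fun τ => f τ.1 - f τ.2.2 + (e (τ.1, τ.2.1) + e (τ.2.1, τ.2.2))
  let W' : N × N × N → Fin m → ℝ := fun τ => f τ.1 - f τ.2.2
  have hf := h.CLf_univ univ
  have he := h.CLe
  let T : Set (N × N × N) := {τ | τ.1 ∈ C.L ∧ τ.2.2 ∈ C.L ∧ τ.1 ≠ τ.2.2 ∧ W τ ≠ 0}
  have hW' : CL W' T := (CL.comp_lip hf lip₁).sub (CL.comp_lip hf lip₃)
  have hW : CL W T := hW'.add ((CL.comp_lip he (lip₁.prodMk lip₂)).add (CL.comp_lip he (lip₂.prodMk lip₃)))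
  let P : ({i // i ≠ k} → ((Fin m → ℝ) →L[ℝ] (Fin m → ℝ)) →L[ℝ] ℝ) →ₗ[ℝ]
      (((Fin m → ℝ) →L[ℝ] (Fin m → ℝ)) →L[ℝ] ({i // i ≠ k} → ℝ)) :=
    { toFun := fun s => ContinuousLinearMap.pi s
      map_add' := fun s s' => by ext; rfl
      map_smul' := fun c s => by ext; rfl }
  let R₀ : N × N × N → {i // i ≠ k} → ((Fin m → ℝ) →L[ℝ] (Fin m → ℝ)) →L[ℝ] ℝ := fun τ i =>
    if i.1.val < k.val then row i.1 (W τ) else row i.1 (W' τ)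
  have hR₀ : CL R₀ T := CL.pi fun i => by
    simp only [R₀]
    split_ifs
    · exact CL.lip_comp (exists_lipschitz_row i.1).choose_spec hW
    · exact CL.lip_comp (exists_lipschitz_row i.1).choose_spec hW'
  obtain ⟨_, hP⟩ := exists_lipschitzWith_linearMap
    (E := {i // i ≠ k} → ((Fin m → ℝ) →L[ℝ] (Fin m → ℝ)) →L[ℝ] ℝ)
    (F := ((Fin m → ℝ) →L[ℝ] (Fin m → ℝ)) →L[ℝ] ({i // i ≠ k} → ℝ)) P
  have hR : CL (fun τ => P (R₀ τ)) T := CL.lip_comp (F := R₀) hP hR₀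
  have hm : (1 : ℝ) ≤ m := by exact_mod_cast k.pos
  have key := generic_hausdorffMeasure_eq_zero (Ω := (Fin m → ℝ) →L[ℝ] (Fin m → ℝ))
    (ι := {i // i ≠ k}) (e := (m : ℝ) - 1) (T := T) (by linarith)
    (by rw [card_ne, show (m : ℝ) - 1 + (m - 1) = 2 * m - 2 by ring]
        exact measure_mono_null (subset_univ _) hN)
    hR (a := fun _ => 0) ((LipschitzWith.const 0).CL T) (by
      rintro τ ⟨h1, h2, h3, h4⟩ b
      have h5 : W' τ ≠ 0 := by
        have := h.ne τ.1 τ.2.2 h3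
        rwa [h.eL _ h1 _ h2, add_zero] at this
      obtain ⟨j, hj⟩ := Function.ne_iff.1 h4
      obtain ⟨j', hj'⟩ := Function.ne_iff.1 h5
      simp only [Pi.zero_apply] at hj hj'
      refine ⟨ContinuousLinearMap.pi fun i => if hi : i ≠ k then
        if i.val < k.val then (b ⟨i, hi⟩ / W τ j) • ContinuousLinearMap.proj j
          else (b ⟨i, hi⟩ / W' τ j') • ContinuousLinearMap.proj j' else 0, ?_⟩
      ext i
      show R₀ τ i _ = b i
      simp only [R₀]
      split_ifs with hlt
      · rw [row_apply]
        have hlt' : i.1 < k := hlt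
        simp [i.2, hlt', hj]
      · rw [row_apply]
        have hlt' : ¬ i.1 < k := hlt
        simp [i.2, hlt', hj'])
  refine key.mono fun A hA => measure_mono_null ?_ hA
  rintro τ ⟨h1, h2, -, h4, h5, h6⟩
  have hw : ∀ i, i.val < k.val + 1 → (A (f τ.1) - A (f τ.2.2) + (trunc (k + 1) fun q => A (e q)) (τ.1, τ.2.1) +
      (trunc (k + 1) fun q => A (e q)) (τ.2.1, τ.2.2)) i = A (W τ) i := fun i hi => by
    simp only [W, map_add, map_sub, Pi.add_apply, Pi.sub_apply, trunc, hi, if_true]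
    ring
  refine ⟨⟨h1, h2, h4, fun hW0 => ?_⟩, ?_⟩
  · rw [hw k (by omega), hW0, map_zero] at h6
    exact h6 rfl
  · ext i
    show R₀ τ i A = 0
    have h7 := h5 i.1 i.2
    simp only [R₀]
    split_ifs with hlt
    · rw [row_apply, ← hw _ (by omega)]
      exact h7
    · have h8 : ¬ i.1.val < k.val + 1 := by
        have : i.1.val ≠ k.val := fun hh => i.2 (Fin.ext hh)
        omega
      rw [row_apply]
      simpa [trunc, h8, W'] using h7

theorem exists_embedding [CompactSpace N] [SecondCountableTopology N] [MeasurableSpace N] [BorelSpace N]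
    (h : C.St f e)
    (hN : μH[2 * (m : ℝ) - 2] (univ : Set (N × N × N)) = 0)
    (hY : μH[2 * (m : ℝ) - 2] (univ : Set (EuclideanSpace ℝ (Fin p) × EuclideanSpace ℝ (Fin p) × N)) = 0) :
    ∃ F : N → Fin m → ℝ, Continuous F ∧ Function.Injective F ∧ CL F univ ∧
      AHom (HH f e) (fun q => F q.1.1 - F q.1.2) := by
  obtain ⟨A, hA, hAk⟩ := exists_of_generic (eventually_all.2 (h.generic_rotate hN))
    (x := ContinuousLinearMap.id ℝ (Fin m → ℝ)) (r := 1 / 2) (by norm_num)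
  have hA' : ∀ w, ‖A w - w‖ ≤ 1 / 2 * ‖w‖ := fun w => by
    have : A w - w = (A - ContinuousLinearMap.id ℝ (Fin m → ℝ)) w := rfl
    rw [this]
    refine ContinuousLinearMap.le_of_opNorm_le _ ?_ w
    rw [mem_ball, dist_eq_norm] at hA
    exact hA.le
  have hseg : ∀ w, w ≠ 0 → ∀ s : ℝ, 0 ≤ s → s ≤ 1 → (1 - s) • w + s • A w ≠ 0 := by
    intro w hw s hs0 hs1 h0
    have h1 : w = -(s • (A w - w)) := by
      have : w + s • (A w - w) = 0 := by rw [← h0]; module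
      exact eq_neg_of_add_eq_zero_left this
    have h2 : ‖w‖ ≤ s * (1 / 2 * ‖w‖) := by
      calc ‖w‖ = s * ‖A w - w‖ := by
            conv_lhs => rw [h1]
            rw [norm_neg, norm_smul, Real.norm_of_nonneg hs0]
        _ ≤ _ := mul_le_mul_of_nonneg_left (hA' w) hs0
    have := norm_pos_iff.2 hw
    nlinarith
  have hne : ∀ w, w ≠ 0 → A w ≠ 0 := fun w hw => by
    simpa using hseg w hw 1 zero_le_one le_rfl
  have hSt := h.comp_linear hne
  have hH1 : ElemHom (HH f e) (HH (fun x => A (f x)) fun q => A (e q)) :=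
    ElemHom.of_segment h.isOdd hSt.isOdd fun q s h0 h1 => by
      have := hseg _ (h.isOdd.ne q) s h0 h1
      simpa [HH] using this
  obtain ⟨F, hF, hH2, -⟩ := hSt.exists_final hN hY hAk m 0 (by omega)
  have h0 : ∀ q, trunc 0 (fun q => A (e q)) q = 0 := fun q => by ext i; simp [trunc]
  refine ⟨F, hF.cont, fun x y hxy => ?_, hF.CLf_univ univ, ?_⟩
  · by_contra hne
    apply hF.ne x y hne
    rw [h0, hxy]; simp
  · have : HH F (trunc 0 fun q => A (e q)) = fun q => F q.1.1 - F q.1.2 := by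
      ext q : 1
      simp [HH, h0]
    rw [← this]
    exact hH1.aHom.trans hH2

end Cell.St

end

section

variable {p m : ℕ}

theorem hausdorffMeasure_univ_eq_zero {X : Type*} [MetricSpace X] [MeasurableSpace X] [BorelSpace X]
    {d : ℝ} (hd : 0 ≤ d) (h : dimH (univ : Set X) < ENNReal.ofReal d) : μH[d] (univ : Set X) = 0 := by
  have := hausdorffMeasure_of_dimH_lt (s := (univ : Set X)) (d := d.toNNReal) h
  rwa [Real.coe_toNNReal d hd] at this

theorem generic_derivative (hpm : p + 1 < m) {f : EuclideanSpace ℝ (Fin p) → Fin m → ℝ}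
    {E : EuclideanSpace ℝ (Fin p) → Quad p →L[ℝ] ℝ} (hI : Interp E)
    {q : {v : EuclideanSpace ℝ (Fin p) // v ≠ 0} → Fin m → ℝ} (hq : CL q univ) :
    ∀ᶠ t in generic (Fin m → Quad p), ∀ (v : {v : EuclideanSpace ℝ (Fin p) // v ≠ 0}) (c : ℝ),
      ¬ ∀ i, fderiv ℝ f 0 v i + c * q v i + fderiv ℝ E 0 v (t i) = 0 := by
  have hμ : μH[((Fintype.card (Fin m) : ℝ) * (Fintype.card Unit : ℝ))]
      (univ : Set ({v : EuclideanSpace ℝ (Fin p) // v ≠ 0} × ℝ)) = 0 := by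
    refine hausdorffMeasure_univ_eq_zero (by positivity) ?_
    let j : {v : EuclideanSpace ℝ (Fin p) // v ≠ 0} × ℝ → EuclideanSpace ℝ (Fin p) × ℝ :=
      Prod.map Subtype.val id
    have hj : Isometry j := isometry_subtype_coe.prodMap isometry_id
    rw [← hj.dimH_image]
    refine (dimH_mono (subset_univ _)).trans_lt ?_
    rw [Real.dimH_univ_eq_finrank]
    simp
    exact_mod_cast hpm
  have h1 : LipschitzWith 1 (fun τ : {v : EuclideanSpace ℝ (Fin p) // v ≠ 0} × ℝ =>
      (τ.1 : EuclideanSpace ℝ (Fin p))) := fun x y => LipschitzWith.prod_fst x y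
  have hv : CL (fun τ : {v : EuclideanSpace ℝ (Fin p) // v ≠ 0} × ℝ => fderiv ℝ E 0 τ.1) univ := by
    have h2 := (fderiv ℝ E 0).lipschitz
    exact (h2.comp h1).CL _
  have hfv : CL (fun τ : {v : EuclideanSpace ℝ (Fin p) // v ≠ 0} × ℝ => fderiv ℝ f 0 τ.1) univ := by
    have h2 := (fderiv ℝ f 0).lipschitz
    exact (h2.comp h1).CL _
  have hq' : CL (fun τ : {v : EuclideanSpace ℝ (Fin p) // v ≠ 0} × ℝ => τ.2 • q τ.1) univ := by
    have h1 : CL (fun z : ℝ × (Fin m → ℝ) => z.1 • z.2) univ :=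
      CL.of_locallyLipschitz (ContDiff.locallyLipschitz (𝕂 := ℝ) (contDiff_fst.smul contDiff_snd)) _
    have h2 : CL (fun τ : {v : EuclideanSpace ℝ (Fin p) // v ≠ 0} × ℝ => (τ.2, q τ.1)) univ :=
      CL.prodMk (LipschitzWith.prod_snd.CL _) (CL.comp_lip hq LipschitzWith.prod_fst)
    exact CL.comp h1 h2 (mapsTo_univ _ _)
  have := generic_forall_coord (Ω := Quad p) (J := Unit) (m := m) (e := (id : Fin m → Fin m))
    Function.injective_id (T := univ) hμ (r := fun τ _ => fderiv ℝ E 0 τ.1) (fun _ => hv)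
    (a := fun τ i _ => (-(fderiv ℝ f 0 τ.1 + τ.2 • q τ.1)) i)
    (fun i _ => (Cell.St.neg_CL (hfv.add hq')).apply i) (by
      intro τ _ b
      obtain ⟨t, -, -, ht⟩ := hI.deriv none 0 τ.1 (by simp) τ.1.2
      refine ⟨(b () / fderiv ℝ E 0 τ.1 t) • t, fun j => ?_⟩
      rw [map_smul, smul_eq_mul, div_mul_cancel₀ _ ht])
  refine this.mono fun t ht v c hcon => ht (v, c) (mem_univ _) fun i j => ?_
  have := hcon i
  simp only [Pi.neg_apply, Pi.add_apply, Pi.smul_apply, smul_eq_mul, id]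
  linarith

theorem exists_immersion_transverse (hpm : p + 1 < m) {f₀ : EuclideanSpace ℝ (Fin p) → Fin m → ℝ}
    (hf₀ : Continuous f₀) {γ : EuclideanSpace ℝ (Fin p) → ℝ} (hγ : Continuous γ) (hγ0 : ∀ u, 0 < γ u)
    {q : {v : EuclideanSpace ℝ (Fin p) // v ≠ 0} → Fin m → ℝ} (hq : CL q univ) :
    ∃ f : EuclideanSpace ℝ (Fin p) → Fin m → ℝ, ContDiff ℝ (⊤ : ℕ∞) f ∧
      (∀ u, ‖f u - f₀ u‖ ≤ γ u) ∧ (∀ u v, v ≠ 0 → fderiv ℝ f u v ≠ 0) ∧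
      ∀ (v : {v : EuclideanSpace ℝ (Fin p) // v ≠ 0}) (c : ℝ), fderiv ℝ f 0 v + c • q v ≠ 0 := by
  have hγ3 : ∀ u, 0 < γ u / 3 := fun u => by have := hγ0 u; positivity
  obtain ⟨f₁, hf₁, hf₁₀, -⟩ := hf₀.exists_contDiff_approx ⊤ (ε := fun u => γ u / 3)
    (by fun_prop) hγ3
  obtain ⟨f₂, hf₂, hf₂₁, hi⟩ := exists_immersion hpm.le hf₁ (γ := fun u => γ u / 3)
    (by fun_prop) hγ3
  obtain ⟨γ', hγ', hγ'0, hr⟩ := exists_immersion_radius hf₂ hi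
  obtain ⟨E, hE, hEγ, hDE, hE2, hE3⟩ := exists_family (γ := fun u => min (γ' u) (γ u / 3))
    (by fun_prop) fun u => lt_min (hγ'0 u) (hγ3 u)
  obtain ⟨t, ht, ht'⟩ := exists_of_generic (generic_derivative hpm (f := f₂) ⟨hE2, hE3⟩ hq) (x := 0) one_pos
  have htn : ‖t‖ ≤ 1 := (mem_ball_zero_iff.1 ht).le
  have hd : ∀ v, fderiv ℝ (fun u => f₂ u + fam E t u) 0 v = fderiv ℝ f₂ 0 v + fderiv ℝ (fam E t) 0 v := fun v => by
    rw [fderiv_fun_add (hf₂.differentiable (by simp) 0) ((contDiff_fam hE t).differentiable (by simp) 0)]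
    rfl
  refine ⟨fun u => f₂ u + fam E t u, hf₂.add (contDiff_fam hE t), fun u => ?_,
    fun u v hv => hr _ (contDiff_fam hE t) u
      (norm_fderiv_fam_le hE t ((hDE u).trans (min_le_left _ _)) htn) v hv, fun v c h0 => ?_⟩
  · have h1 := norm_fam_le t ((hEγ u).trans (min_le_right _ _)) htn
    have h2 := hf₂₁ u
    have h3 := hf₁₀ u
    rw [dist_eq_norm] at h3
    calc ‖f₂ u + fam E t u - f₀ u‖ = ‖fam E t u + (f₂ u - f₁ u) + (f₁ u - f₀ u)‖ := by congr 1; abel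
      _ ≤ _ := norm_add₃_le
      _ ≤ γ u := by linarith
  · refine ht' v c fun i => ?_
    have := congrFun h0 i
    rw [hd] at this
    simp only [Pi.add_apply, Pi.smul_apply, smul_eq_mul, Pi.zero_apply, fderiv_fam hE] at this
    linarith

end

section

variable {p m : ℕ}

theorem add_smul_ne_zero {V : Type*} [NormedAddCommGroup V] [NormedSpace ℝ V] {a b : V} (h : ‖b - a‖ < ‖a‖)
    {s : ℝ} (h0 : 0 ≤ s) (h1 : s ≤ 1) : (1 - s) • a + s • b ≠ 0 := by
  intro h2
  have h3 : a = -(s • (b - a)) := by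
    rw [eq_neg_iff_add_eq_zero, ← h2]
    module
  have h4 : ‖a‖ = s * ‖b - a‖ := by
    conv_lhs => rw [h3]
    rw [norm_neg, norm_smul, Real.norm_of_nonneg h0]
  nlinarith [norm_nonneg (b - a)]

/-- Negation on nonzero vectors. -/
def negNZ {Y : Type*} [NormedAddCommGroup Y] (v : {v : Y // v ≠ 0}) : {v : Y // v ≠ 0} :=
  ⟨-v, neg_ne_zero.2 v.2⟩

theorem exists_odd_CL_approx {q : {v : EuclideanSpace ℝ (Fin p) // v ≠ 0} → Fin m → ℝ}
    (hq : Continuous q) (hodd : ∀ v, q (negNZ v) = -q v) (hq0 : ∀ v, q v ≠ 0) :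
    ∃ q' : {v : EuclideanSpace ℝ (Fin p) // v ≠ 0} → Fin m → ℝ, Continuous q' ∧ CL q' univ ∧
      (∀ v, q' (negNZ v) = -q' v) ∧ ∀ v, ‖q' v - q v‖ < ‖q v‖ := by
  obtain ⟨F, hF, hFCL, hFq, -⟩ := exists_CL_approx hq (δ := fun v => ‖q v‖ / 2) (by fun_prop)
    fun v => by have := norm_pos_iff.2 (hq0 v); positivity
  have hneg : LipschitzWith 1 (negNZ : {v : EuclideanSpace ℝ (Fin p) // v ≠ 0} → _) :=
    LipschitzWith.of_dist_le_mul fun v w => by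
      simp only [negNZ, Subtype.dist_eq, dist_neg_neg, NNReal.coe_one, one_mul, le_refl]
  have hL : LipschitzWith _ (fun x : Fin m → ℝ => (1 / 2 : ℝ) • x) := lipschitzWith_smul _
  have hnn : ∀ v : {v : EuclideanSpace ℝ (Fin p) // v ≠ 0}, negNZ (negNZ v) = v := fun v =>
    Subtype.ext (neg_neg v.1)
  have hnc := hneg.continuous
  refine ⟨fun v => (1 / 2 : ℝ) • (F v - F (negNZ v)), by fun_prop,
    CL.lip_comp hL (hFCL.sub (CL.comp_lip hFCL hneg)), fun v => ?_, fun v => ?_⟩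
  · simp only [hnn]; module
  · have h1 := hFq v
    have h2 := hFq (negNZ v)
    have h3 := norm_pos_iff.2 (hq0 v)
    rw [hodd, norm_neg] at h2
    have : (1 / 2 : ℝ) • (F v - F (negNZ v)) - q v =
        (1 / 2 : ℝ) • ((F v - q v) - (F (negNZ v) - -q v)) := by module
    rw [this, norm_smul]
    have := norm_sub_le (F v - q v) (F (negNZ v) - -q v)
    rw [Real.norm_of_nonneg (by norm_num)]
    linarith

/-- Equivariant maps reachable by homotopies fixed on `C₀`, with prescribed restriction along `ι`. -/
def Reach {X Z' : Type*} [TopologicalSpace X] (g : DP X → Fin m → ℝ) (ι : Z' → DP X) (C₀ : Set (DP X))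
    (φ : Z' → Fin m → ℝ) : Prop :=
  ∃ g', IsOdd g' ∧ AHom g g' ∧ (∀ z, g' (ι z) = φ z) ∧ ∀ z ∈ C₀, g' z = g z

theorem Reach.step {X Z' : Type*} [MetricSpace X] [TopologicalSpace Z']
    {σ' : Z' → Z'} {ι : Z' → DP X} (hι : IsClosedEmbedding ι) (hισ : ∀ z, ι (σ' z) = (ι z).swap)
    {C₀ : Set (DP X)} (hC₀ : IsClosed C₀) (hC₀σ : ∀ z ∈ C₀, z.swap ∈ C₀) (hdisj : ∀ z, ι z ∉ C₀)
    {g : DP X → Fin m → ℝ} {φ φ' : Z' → Fin m → ℝ} (h : Reach g ι C₀ φ)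
    (H : ℝ → Z' → Fin m → ℝ) (hH : Continuous fun q : ℝ × Z' => H q.1 q.2) (hHσ : ∀ s z, H s (σ' z) = -H s z)
    (hH0 : ∀ s z, 0 ≤ s → s ≤ 1 → H s z ≠ 0) (hHφ : ∀ z, H 0 z = φ z) (hHφ' : ∀ z, H 1 z = φ' z) :
    Reach g ι C₀ φ' := by
  obtain ⟨g', hg', hgg', hgι, hgC⟩ := h
  obtain ⟨g'', h1, h2, h3, h4⟩ := hg'.extend hι hισ hC₀ hC₀σ hdisj
    (H := fun q => H q.1 q.2) (hH.comp (by fun_prop : Continuous fun q : unitInterval × Z' => ((q.1 : ℝ), q.2)))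
    (fun s z => hHσ s z) (fun q => hH0 _ _ q.1.2.1 q.1.2.2) (fun z => by
      rw [hgι, ← hHφ z]
      simp)
  refine ⟨g'', h1, hgg'.trans h2.aHom, fun z => ?_, fun z hz => (h4 z hz).trans (hgC z hz)⟩
  rw [h3, ← hHφ' z]
  simp

theorem exists_immersion_nhds {f : EuclideanSpace ℝ (Fin p) → Fin m → ℝ} (hf : ContDiff ℝ (⊤ : ℕ∞) f)
    (hi : ∀ u v, v ≠ 0 → fderiv ℝ f u v ≠ 0) (u : EuclideanSpace ℝ (Fin p)) :
    ∀ᶠ q : EuclideanSpace ℝ (Fin p) × EuclideanSpace ℝ (Fin p) in 𝓝 (u, u), q.1 ≠ q.2 →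
      ‖f q.1 - f q.2 - fderiv ℝ f ((1 / 2 : ℝ) • (q.1 + q.2)) (q.1 - q.2)‖ <
        ‖fderiv ℝ f ((1 / 2 : ℝ) • (q.1 + q.2)) (q.1 - q.2)‖ := by
  obtain ⟨r, hr, h⟩ := exists_immersion_lower hf u (hi u)
  have hc : Tendsto (fun q : EuclideanSpace ℝ (Fin p) × EuclideanSpace ℝ (Fin p) =>
      (q.1, q.2, (1 / 2 : ℝ) • (q.1 + q.2))) (𝓝 (u, u)) (𝓝 (u, u, u)) := by
    have : Continuous (fun q : EuclideanSpace ℝ (Fin p) × EuclideanSpace ℝ (Fin p) =>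
      (q.1, q.2, (1 / 2 : ℝ) • (q.1 + q.2))) := by fun_prop
    have h2 := this.tendsto (u, u)
    have h3 : (1 / 2 : ℝ) • (u + u) = u := by module
    simp only [h3] at h2
    exact h2
  filter_upwards [hc.eventually h] with q hq hne
  have h1 := norm_pos_iff.2 (sub_ne_zero.2 hne)
  have h2 := hq.2.1 (q.1 - q.2)
  have h3 := hq.2.2
  have := mul_pos hr h1
  linarith

namespace Cell
variable {N : Type*} [MetricSpace N]

theorem exists_gauge (C : Cell N p) {P : N × N → Prop} (hP : ∀ u, ∀ᶠ q in 𝓝 (C.χ u, C.χ u), P q) :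
    ∃ θ : N → ℝ, Continuous θ ∧ (∀ x ∈ C.L, θ x = 0) ∧ (∀ u, 0 < θ (C.χ u)) ∧
      ∀ u y, dist (C.χ u) y ≤ θ (C.χ u) → P (C.χ u, y) := by
  have hχ := C.continuous_χ
  obtain ⟨γ, hγ, hγ0, h⟩ := exists_pos_selection (Y := EuclideanSpace ℝ (Fin p))
    (P := fun u r => ∀ y, dist (C.χ u) y ≤ r → P (C.χ u, y))
    (fun u r r' _ h1 h2 y hy => h2 y (hy.trans h1)) (fun u => by
      obtain ⟨ε, hε, hball⟩ := Metric.eventually_nhds_iff.1 (hP u)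
      refine ⟨ε / 3, by positivity, ?_⟩
      have h1 : ∀ᶠ u' in 𝓝 u, dist (C.χ u') (C.χ u) < ε / 3 :=
        hχ.continuousAt.eventually (Metric.ball_mem_nhds (C.χ u) (by positivity : 0 < ε / 3))
      filter_upwards [h1] with u' hu' y hy
      apply hball
      rw [Prod.dist_eq, max_lt_iff]
      refine ⟨hu'.trans (by linarith), ?_⟩
      have := dist_triangle_left y (C.χ u) (C.χ u')
      show dist y (C.χ u) < ε
      linarith)
  have hd := C.continuous_d
  refine ⟨C.ext fun u => min (γ u) (C.d (C.χ u)),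
    C.continuous_ext (b := C.d) (by fun_prop) hd (fun x hx => C.d_eq_zero.2 hx) (fun u => ?_),
    fun x hx => C.ext_of_mem _ hx, fun u => ?_, fun u y hy => h u y ?_⟩
  · rw [Real.norm_of_nonneg (le_min (hγ0 u).le (C.d_nonneg _))]
    exact min_le_right _ _
  · rw [C.ext_χ]
    exact lt_min (hγ0 u) (C.d_χ_pos u)
  · rw [C.ext_χ] at hy
    exact hy.trans (min_le_left _ _)

/-- The pair of opposite points of the cell determined by a nonzero vector. -/
noncomputable def opp (C : Cell N p) (v : {v : EuclideanSpace ℝ (Fin p) // v ≠ 0}) (c : EuclideanSpace ℝ (Fin p)) :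
    DP N :=
  ⟨(C.χ (c + (1 / 2 : ℝ) • v.1), C.χ (c + (-(1 / 2) : ℝ) • v.1)), fun h => v.2 (by
    have := add_left_cancel (C.χ_inj.1 h)
    have h2 : (1 / 2 : ℝ) • v.1 - (-(1 / 2) : ℝ) • v.1 = v.1 := by module
    rw [← h2, this, sub_self])⟩

theorem continuous_opp (C : Cell N p) :
    Continuous fun q : {v : EuclideanSpace ℝ (Fin p) // v ≠ 0} × EuclideanSpace ℝ (Fin p) => C.opp q.1 q.2 := by
  have hχ := C.continuous_χ
  unfold opp
  fun_prop

theorem opp_neg (C : Cell N p) (v c) : C.opp (negNZ v) c = (C.opp v c).swap := by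
  apply Subtype.ext
  simp [opp, negNZ, DP.swap]

theorem exists_standard_near_diagonal (C : Cell N p) {g : DP N → Fin m → ℝ} (hg : IsOdd g)
    {f : N → Fin m → ℝ} (hf : ContDiff ℝ (⊤ : ℕ∞) (f ∘ C.χ))
    (hi : ∀ u v, v ≠ 0 → fderiv ℝ (f ∘ C.χ) u v ≠ 0)
    {q' : {v : EuclideanSpace ℝ (Fin p) // v ≠ 0} → Fin m → ℝ} (hq' : Continuous q')
    (hodd : ∀ v, q' (negNZ v) = -q' v) (hq'g : ∀ v, ‖q' v - g (C.opp v 0)‖ < ‖g (C.opp v 0)‖)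
    (htr : ∀ (v : {v : EuclideanSpace ℝ (Fin p) // v ≠ 0}) (c : ℝ),
      fderiv ℝ (f ∘ C.χ) 0 v + c • q' v ≠ 0) :
    ∃ g₂, IsOdd g₂ ∧ AHom g g₂ ∧ (∀ z : DP N, z.1.1 ∈ C.L → z.1.2 ∈ C.L → g₂ z = g z) ∧
      ∀ u, ∀ᶠ q : N × N in 𝓝 (C.χ u, C.χ u), ∀ h : q.1 ≠ q.2, g₂ ⟨q, h⟩ = f q.1 - f q.2 := by
  set φ := f ∘ C.χ with hφ
  have hχ := C.continuous_χ
  let P : N × N → Prop := fun q => q.2 ∉ C.L ∧ (C.ρ q.1 ≠ C.ρ q.2 →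
      ‖φ (C.ρ q.1) - φ (C.ρ q.2) - fderiv ℝ φ ((1 / 2 : ℝ) • (C.ρ q.1 + C.ρ q.2)) (C.ρ q.1 - C.ρ q.2)‖ <
        ‖fderiv ℝ φ ((1 / 2 : ℝ) • (C.ρ q.1 + C.ρ q.2)) (C.ρ q.1 - C.ρ q.2)‖)
  have hP : ∀ u, ∀ᶠ q in 𝓝 (C.χ u, C.χ u), P q := fun u => by
    have h1 : ∀ᶠ q : N × N in 𝓝 (C.χ u, C.χ u), q.2 ∉ C.L :=
      (C.closed.isOpen_compl.preimage continuous_snd).mem_nhds (C.χ_notMem u)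
    have h2 := C.continuousAt_ρ (C.χ_notMem u)
    have h3 : Tendsto (fun q : N × N => (C.ρ q.1, C.ρ q.2)) (𝓝 (C.χ u, C.χ u)) (𝓝 (u, u)) := by
      have h4 : ContinuousAt (fun q : N × N => (C.ρ q.1, C.ρ q.2)) (C.χ u, C.χ u) :=
        (ContinuousAt.comp (f := Prod.fst) h2 continuousAt_fst).prodMk
          (ContinuousAt.comp (f := Prod.snd) h2 continuousAt_snd)
      have := h4.tendsto
      simpa only [C.ρχ] using this
    exact h1.and (h3.eventually (exists_immersion_nhds hf hi u))
  obtain ⟨θ, hθ, hθL, hθ0, hθP⟩ := C.exists_gauge hP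
  let T : Set (DP N) := {z | dist z.1.1 z.1.2 ≤ θ z.1.1 ∧ dist z.1.1 z.1.2 ≤ θ z.1.2}
  have hTc : IsClosed T := by
    have h1 : IsClosed {z : DP N | dist z.1.1 z.1.2 ≤ θ z.1.1} := isClosed_le (by fun_prop) (by fun_prop)
    have h2 : IsClosed {z : DP N | dist z.1.1 z.1.2 ≤ θ z.1.2} := isClosed_le (by fun_prop) (by fun_prop)
    exact h1.inter h2
  have hT1 : ∀ z ∈ T, z.1.1 ∉ C.L := fun z hz hL => by
    have := hz.1
    rw [hθL _ hL] at this
    exact z.2 (dist_le_zero.1 this)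
  have hTs : ∀ z ∈ T, z.swap ∈ T := fun z hz => by
    refine ⟨?_, ?_⟩
    · show dist z.1.2 z.1.1 ≤ _
      rw [dist_comm]; exact hz.2
    · show dist z.1.2 z.1.1 ≤ _
      rw [dist_comm]; exact hz.1
  have hT2 : ∀ z ∈ T, z.1.2 ∉ C.L := fun z hz => hT1 z.swap (hTs z hz)
  have hTP : ∀ z ∈ T, P z.1 := fun z hz => by
    have h1 := C.χρ (hT1 z hz)
    have h2 := hθP (C.ρ z.1.1) z.1.2
    rw [h1] at h2
    exact h2 hz.1
  let σ : T → T := fun z => ⟨z.1.swap, hTs z.1 z.2⟩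
  let a : T → EuclideanSpace ℝ (Fin p) := fun z => C.ρ z.1.1.1
  let b : T → EuclideanSpace ℝ (Fin p) := fun z => C.ρ z.1.1.2
  have ha : Continuous a := continuous_iff_continuousAt.2 fun z =>
    ContinuousAt.comp (f := fun z : T => z.1.1.1) (C.continuousAt_ρ (hT1 z.1 z.2)) (by fun_prop)
  have hb : Continuous b := continuous_iff_continuousAt.2 fun z =>
    ContinuousAt.comp (f := fun z : T => z.1.1.2) (C.continuousAt_ρ (hT2 z.1 z.2)) (by fun_prop)
  have hχa : ∀ z, C.χ (a z) = z.1.1.1 := fun z => C.χρ (hT1 z.1 z.2)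
  have hχb : ∀ z, C.χ (b z) = z.1.1.2 := fun z => C.χρ (hT2 z.1 z.2)
  have hab : ∀ z, a z - b z ≠ 0 := fun z h => z.1.2 (by
    rw [← hχa, ← hχb, sub_eq_zero.1 h])
  let c : T → EuclideanSpace ℝ (Fin p) := fun z => (1 / 2 : ℝ) • (a z + b z)
  let v : T → {v : EuclideanSpace ℝ (Fin p) // v ≠ 0} := fun z => ⟨a z - b z, hab z⟩
  have hc : Continuous c := by fun_prop
  have hv : Continuous v := by fun_prop
  have hcσ : ∀ z, c (σ z) = c z := fun z => by
    show (1 / 2 : ℝ) • (b z + a z) = (1 / 2 : ℝ) • (a z + b z)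
    rw [add_comm]
  have hvσ : ∀ z, v (σ z) = negNZ (v z) := fun z => Subtype.ext (neg_sub (a z) (b z)).symm
  have hopp : ∀ z, C.opp (v z) (c z) = z.1 := fun z => by
    apply Subtype.ext
    have h1 : c z + (1 / 2 : ℝ) • (v z).1 = a z := by simp only [c, v]; module
    have h2 : c z + (-(1 / 2) : ℝ) • (v z).1 = b z := by simp only [c, v]; module
    show (C.χ _, C.χ _) = _
    rw [h1, h2, hχa, hχb]
  have hgo : ∀ v c, g (C.opp (negNZ v) c) = -g (C.opp v c) := fun v c => by rw [opp_neg, hg.odd]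
  let C₀ : Set (DP N) := {z | z.1.1 ∈ C.L ∧ z.1.2 ∈ C.L}
  have hC₀ : IsClosed C₀ := (C.closed.preimage (by fun_prop)).inter (C.closed.preimage (by fun_prop))
  have hι : IsClosedEmbedding (Subtype.val : T → DP N) := hTc.isClosedEmbedding_subtypeVal
  have hισ : ∀ z, (σ z : DP N) = DP.swap z := fun z => rfl
  have hC₀σ : ∀ z ∈ C₀, z.swap ∈ C₀ := fun z hz => ⟨hz.2, hz.1⟩
  have hdisj : ∀ z : T, (z : DP N) ∉ C₀ := fun z hz => hT1 z.1 z.2 hz.1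
  have hφ' : Continuous (fderiv ℝ φ) := hf.continuous_fderiv (by simp)
  have hφc : Continuous φ := hf.continuous
  have hoc := C.continuous_opp
  have hgc := hg.cont
  have hneg : ∀ (u : EuclideanSpace ℝ (Fin p)) (w : {v : EuclideanSpace ℝ (Fin p) // v ≠ 0}),
    fderiv ℝ φ u (negNZ w).1 = -fderiv ℝ φ u w.1 := fun u w => map_neg _ _
  have r0 : Reach g (Subtype.val : T → DP N) C₀ (fun z => g z) :=
    ⟨g, hg, Relation.ReflTransGen.refl, fun z => rfl, fun z _ => rfl⟩
  have r1 : Reach g (Subtype.val : T → DP N) C₀ (fun z => g (C.opp (v z) 0)) :=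
    r0.step hι hισ hC₀ hC₀σ hdisj (fun s z => g (C.opp (v z) ((1 - s) • c z)))
      (hgc.comp (hoc.comp (by fun_prop : Continuous fun q : ℝ × T => (v q.2, (1 - q.1) • c q.2))))
      (fun s z => by rw [hvσ, hcσ, hgo]) (fun s z _ _ => hg.ne _)
      (fun z => by rw [sub_zero, one_smul, hopp]) (fun z => by rw [sub_self, zero_smul])
  have r2 : Reach g (Subtype.val : T → DP N) C₀ (fun z => q' (v z)) :=
    r1.step hι hισ hC₀ hC₀σ hdisj (fun s z => (1 - s) • g (C.opp (v z) 0) + s • q' (v z))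
      (by
        have : Continuous fun q : ℝ × T => g (C.opp (v q.2) 0) :=
          hgc.comp (hoc.comp (by fun_prop : Continuous fun q : ℝ × T => (v q.2, (0 : EuclideanSpace ℝ (Fin p)))))
        fun_prop)
      (fun s z => by rw [hvσ, hgo, hodd]; module)
      (fun s z h0 h1 => add_smul_ne_zero (hq'g _) h0 h1)
      (fun z => by simp) (fun z => by simp)
  have r3 : Reach g (Subtype.val : T → DP N) C₀ (fun z => fderiv ℝ φ 0 (v z).1) :=
    r2.step hι hισ hC₀ hC₀σ hdisj (fun s z => (1 - s) • q' (v z) + s • fderiv ℝ φ 0 (v z).1)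
      (by fun_prop)
      (fun s z => by rw [hvσ, hneg, hodd]; module)
      (fun s z h0 h1 => by
        rcases h0.eq_or_lt with rfl | hs
        · have := hq'g (v z)
          intro h2
          rw [sub_zero, one_smul, zero_smul, add_zero] at h2
          rw [h2, zero_sub, norm_neg] at this
          exact lt_irrefl _ this
        · intro h2
          apply htr (v z) ((1 - s) / s)
          have h3 : s • (fderiv ℝ φ 0 (v z).1 + ((1 - s) / s) • q' (v z)) = 0 := by
            rw [← h2, smul_add, smul_smul, mul_div_cancel₀ _ hs.ne', add_comm]
          exact (smul_eq_zero.1 h3).resolve_left hs.ne')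
      (fun z => by simp) (fun z => by simp)
  have r4 : Reach g (Subtype.val : T → DP N) C₀ (fun z => fderiv ℝ φ (c z) (v z).1) :=
    r3.step hι hισ hC₀ hC₀σ hdisj (fun s z => fderiv ℝ φ (s • c z) (v z).1)
      (by
        have h1 : Continuous fun q : ℝ × T => fderiv ℝ φ (q.1 • c q.2) := hφ'.comp (by fun_prop)
        exact h1.clm_apply (by fun_prop))
      (fun s z => by rw [hvσ, hcσ, hneg])
      (fun s z _ _ => hi _ _ (v z).2)
      (fun z => by simp) (fun z => by simp)
  have r5 : Reach g (Subtype.val : T → DP N) C₀ (fun z => φ (a z) - φ (b z)) :=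
    r4.step hι hισ hC₀ hC₀σ hdisj
      (fun s z => (1 - s) • fderiv ℝ φ (c z) (v z).1 + s • (φ (a z) - φ (b z)))
      (by
        have h1 : Continuous fun q : ℝ × T => fderiv ℝ φ (c q.2) := hφ'.comp (by fun_prop)
        have h2 : Continuous fun q : ℝ × T => fderiv ℝ φ (c q.2) (v q.2).1 := h1.clm_apply (by fun_prop)
        fun_prop)
      (fun s z => by
        have h1 : a (σ z) = b z := rfl
        have h2 : b (σ z) = a z := rfl
        rw [hvσ, hcσ, hneg, h1, h2]; module)
      (fun s z h0 h1 => add_smul_ne_zero ((hTP z.1 z.2).2 (sub_ne_zero.1 (hab z))) h0 h1)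
      (fun z => by simp) (fun z => by simp)
  obtain ⟨g₂, hg₂, hgg₂, hT, hL⟩ := r5
  refine ⟨g₂, hg₂, hgg₂, fun z h1 h2 => hL z ⟨h1, h2⟩, fun u => ?_⟩
  have h1 : ∀ᶠ q : N × N in 𝓝 (C.χ u, C.χ u), dist q.1 q.2 < θ q.1 :=
    (isOpen_lt (by fun_prop) (by fun_prop)).mem_nhds (by simpa using hθ0 u)
  have h2 : ∀ᶠ q : N × N in 𝓝 (C.χ u, C.χ u), dist q.1 q.2 < θ q.2 :=
    (isOpen_lt (by fun_prop) (by fun_prop)).mem_nhds (by simpa using hθ0 u)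
  filter_upwards [h1, h2] with q h1 h2 hne
  have := hT ⟨⟨q, hne⟩, h1.le, h2.le⟩
  rw [this]
  show f (C.χ (a _)) - f (C.χ (b _)) = _
  rw [hχa, hχb]

end Cell

end

section

variable {p m : ℕ}

theorem CL.of_subtype {X Y : Type*} [PseudoEMetricSpace X] [PseudoEMetricSpace Y] {S : Set X}
    {F : S → Y} {G : X → Y} (hF : CL F univ) (hFG : ∀ s : S, G s = F s) : CL G S := by
  obtain ⟨c, hc, hK⟩ := hF
  refine ⟨fun n => Subtype.val '' c n, fun x hx => ?_, fun n => ?_⟩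
  · obtain ⟨n, hn⟩ := mem_iUnion.1 (hc (mem_univ (⟨x, hx⟩ : S)))
    exact mem_iUnion.2 ⟨n, ⟨x, hx⟩, hn, rfl⟩
  · obtain ⟨K, hK⟩ := hK n
    refine ⟨K, ?_⟩
    rintro _ ⟨x, hx, rfl⟩ _ ⟨y, hy, rfl⟩
    rw [hFG, hFG]
    exact hK hx hy

namespace Cell
variable {N : Type*} [MetricSpace N]

theorem exists_St (C : Cell N p) [SecondCountableTopology N] {f : N → Fin m → ℝ} (hf : Continuous f)
    (hs : ContDiff ℝ (⊤ : ℕ∞) (f ∘ C.χ)) (hi : ∀ u v, v ≠ 0 → fderiv ℝ (f ∘ C.χ) u v ≠ 0)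
    (hfL : CL f C.L) {g : DP N → Fin m → ℝ} (hg : IsOdd g)
    (hgL : ∀ z : DP N, z.1.1 ∈ C.L → z.1.2 ∈ C.L → g z = f z.1.1 - f z.1.2)
    (hgd : ∀ u, ∀ᶠ q : N × N in 𝓝 (C.χ u, C.χ u), ∀ h : q.1 ≠ q.2, g ⟨q, h⟩ = f q.1 - f q.2) :
    ∃ e, C.St f e ∧ AHom g (HH f e) := by
  have hd := C.continuous_d
  have hgc := hg.cont
  let b : N × N → ℝ := fun q => ‖f q.1 - f q.2‖ + dist q.1 q.2
  have hb : Continuous b := by fun_prop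
  have hb0 : ∀ q : N × N, q.1 ≠ q.2 → 0 < b q := fun q hq =>
    add_pos_of_nonneg_of_pos (norm_nonneg _) (dist_pos.2 hq)
  let l : DP N → ℝ := fun z => min 1 (b z.1 / ‖g z‖)
  have hl : Continuous l := by
    have : Continuous fun z : DP N => b z.1 / ‖g z‖ :=
      (by fun_prop : Continuous fun z : DP N => b z.1).div hgc.norm fun z => (norm_pos_iff.2 (hg.ne z)).ne'
    fun_prop
  have hl0 : ∀ z, 0 < l z := fun z =>
    lt_min one_pos (div_pos (hb0 z.1 z.2) (norm_pos_iff.2 (hg.ne z)))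
  have hls : ∀ z : DP N, l z.swap = l z := fun z => by
    simp only [l, b, hg.odd, norm_neg]
    simp only [DP.swap, norm_sub_rev (f z.1.2), dist_comm z.1.2]
  have hl1 : ∀ z : DP N, g z = f z.1.1 - f z.1.2 → l z = 1 := fun z hz => by
    refine min_eq_left ?_
    rw [hz, one_le_div (by rw [← hz]; exact norm_pos_iff.2 (hg.ne z))]
    exact le_add_of_nonneg_right dist_nonneg
  have hDPo : IsOpen {q : N × N | q.1 ≠ q.2} := isOpen_ne_fun continuous_fst continuous_snd
  let G₀ : N × N → Fin m → ℝ := Function.extend (Subtype.val : DP N → N × N) (fun z => l z • g z) 0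
  have hG₀ : Continuous G₀ := by
    refine continuous_extend_zero (hDPo.isOpenEmbedding_subtypeVal) hb (fun q hq => ?_) (by fun_prop) fun z => ?_
    · have : q.1 = q.2 := by
        by_contra h
        exact hq ⟨⟨q, h⟩, rfl⟩
      simp [b, this]
    · rw [norm_smul, Real.norm_of_nonneg (hl0 z).le]
      calc l z * ‖g z‖ ≤ b z.1 / ‖g z‖ * ‖g z‖ := by gcongr; exact min_le_right _ _
        _ = b z.1 := div_mul_cancel₀ _ (norm_pos_iff.2 (hg.ne z)).ne'
  have hG₀z : ∀ z : DP N, G₀ z.1 = l z • g z := fun z =>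
    Subtype.val_injective.extend_apply _ _ _
  have hG₀d : ∀ x, G₀ (x, x) = 0 := fun x => by
    refine Function.extend_apply' _ _ _ ?_
    rintro ⟨z, hz⟩
    exact z.2 (by rw [hz])
  have hG₀s : ∀ x y, G₀ (y, x) = -G₀ (x, y) := fun x y => by
    by_cases h : x = y
    · rw [h, hG₀d, neg_zero]
    · have h1 := hG₀z ⟨(x, y), h⟩
      have h2 := hG₀z (DP.swap ⟨(x, y), h⟩)
      rw [hls, hg.odd, smul_neg, ← h1] at h2
      exact h2
  have hG₀0 : ∀ q : N × N, q.1 ≠ q.2 → G₀ q ≠ 0 := fun q hq => by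
    rw [hG₀z ⟨q, hq⟩]
    exact smul_ne_zero (hl0 _).ne' (hg.ne _)
  let e₀ : N × N → Fin m → ℝ := fun q => G₀ q - (f q.1 - f q.2)
  have he₀ : Continuous e₀ := by fun_prop
  have he₀d : ∀ x, e₀ (x, x) = 0 := fun x => by simp [e₀, hG₀d]
  have he₀g : ∀ q, (∀ h : q.1 ≠ q.2, g ⟨q, h⟩ = f q.1 - f q.2) → e₀ q = 0 := by
    rintro ⟨x, y⟩ h
    by_cases hxy : x = y
    · rw [hxy, he₀d]
    · have h1 := h hxy
      have h2 := hG₀z ⟨(x, y), hxy⟩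
      rw [hl1 _ h1, one_smul, h1] at h2
      simp only [e₀, h2, sub_self]
  have he₀L : ∀ x ∈ C.L, ∀ y ∈ C.L, e₀ (x, y) = 0 := fun x hx y hy => he₀g _ fun h => hgL _ hx hy
  let δ : N × N → ℝ := fun q => min (‖G₀ q‖ / 2) (C.d q.1 + C.d q.2)
  have hδ : Continuous δ := by fun_prop
  let O : Set (N × N) := {q | q.1 ≠ q.2 ∧ (q.1 ∈ C.L → q.2 ∉ C.L)}
  have hO : IsOpen O := by
    have h1 : IsClosed {q : N × N | q.1 ∈ C.L ∧ q.2 ∈ C.L} :=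
      (C.closed.preimage continuous_fst).inter (C.closed.preimage continuous_snd)
    have h2 : O = {q : N × N | q.1 ≠ q.2} ∩ {q : N × N | q.1 ∈ C.L ∧ q.2 ∈ C.L}ᶜ := by
      ext q
      simp [O, not_and]
    rw [h2]
    exact hDPo.inter h1.isOpen_compl
  have hOe : ∀ q, q ∉ O → e₀ q = 0 := by
    rintro ⟨x, y⟩ h
    by_cases hxy : x = y
    · rw [hxy, he₀d]
    · have : x ∈ C.L ∧ y ∈ C.L := by
        by_contra hcon
        exact h ⟨hxy, fun h1 h2 => hcon ⟨h1, h2⟩⟩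
      exact he₀L _ this.1 _ this.2
  have hOδ : ∀ q, q ∉ O → δ q = 0 := by
    rintro ⟨x, y⟩ h
    by_cases hxy : x = y
    · have : 0 ≤ C.d x + C.d y := add_nonneg (C.d_nonneg _) (C.d_nonneg _)
      subst hxy
      simp only [δ, hG₀d, norm_zero, zero_div]
      exact min_eq_left this
    · have : x ∈ C.L ∧ y ∈ C.L := by
        by_contra hcon
        exact h ⟨hxy, fun h1 h2 => hcon ⟨h1, h2⟩⟩
      simp only [δ, C.d_eq_zero.2 this.1, C.d_eq_zero.2 this.2, add_zero]
      exact min_eq_right (by positivity)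
  have hδ0 : ∀ q : O, 0 < δ q := by
    rintro ⟨⟨x, y⟩, hxy, hL⟩
    refine lt_min (by have := norm_pos_iff.2 (hG₀0 _ hxy); positivity) ?_
    by_cases hx : x ∈ C.L
    · exact add_pos_of_nonneg_of_pos (C.d_nonneg _) (C.d_pos (hL hx))
    · exact add_pos_of_pos_of_nonneg (C.d_pos hx) (C.d_nonneg _)
  obtain ⟨F, hF, hFCL, hFe, hF0⟩ := exists_CL_approx (X := O) (e₀ := fun q => e₀ q) (by fun_prop)
    (δ := fun q => δ q) (by fun_prop) hδ0
  let h : N × N → Fin m → ℝ := Function.extend (Subtype.val : O → N × N) (fun q => F q - e₀ q) 0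
  have hhO : ∀ q : O, h q = F q - e₀ q := fun q => Subtype.val_injective.extend_apply _ _ _
  have hhn : ∀ q, q ∉ O → h q = 0 := fun q hq => by
    refine Function.extend_apply' _ _ _ ?_
    rintro ⟨z, rfl⟩
    exact hq z.2
  have hh : Continuous h := by
    refine continuous_extend_zero hO.isOpenEmbedding_subtypeVal hδ (fun q hq => hOδ q ?_) (by fun_prop) hFe
    simpa using hq
  have hhδ : ∀ q, ‖h q‖ ≤ ‖G₀ q‖ / 2 := fun q => by
    by_cases hq : q ∈ O
    · rw [hhO ⟨q, hq⟩]
      exact (hFe ⟨q, hq⟩).trans (min_le_left _ _)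
    · rw [hhn q hq, norm_zero]
      positivity
  let e' : N × N → Fin m → ℝ := fun q => e₀ q + h q
  have he' : Continuous e' := by fun_prop
  have he'0 : ∀ q, e₀ q = 0 → e' q = 0 := fun q hq => by
    by_cases hqO : q ∈ O
    · simp only [e', hhO ⟨q, hqO⟩, hF0 ⟨q, hqO⟩ hq, hq, sub_self, add_zero]
    · simp only [e', hhn q hqO, hq, add_zero]
  have he'CL : CL e' univ := by
    have h1 : CL e' O := hFCL.of_subtype fun q => by
      simp only [e', hhO q]; abel
    have h2 : CL e' Oᶜ := ((LipschitzWith.const (0 : Fin m → ℝ)).CL Oᶜ).congr fun q hq =>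
      (he'0 q (hOe q hq)).symm
    exact (h1.union h2).mono (by rw [union_compl_self])
  let e : N × N → Fin m → ℝ := fun q => (1 / 2 : ℝ) • (e' q - e' q.swap)
  have hswap : LipschitzWith 1 (Prod.swap : N × N → N × N) := LipschitzWith.of_dist_le_mul fun x y => by
    simp [Prod.dist_eq, max_comm]
  have hL : LipschitzWith _ (fun x : Fin m → ℝ => (1 / 2 : ℝ) • x) := lipschitzWith_smul _
  have heG : ∀ q : DP N, HH f e q = G₀ q.1 + (1 / 2 : ℝ) • (h q.1 - h q.1.swap) := fun q => by
    have h1 := hG₀s q.1.1 q.1.2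
    simp only [HH, e, e', e₀, Prod.swap, h1]
    module
  have hsmall : ∀ q : DP N, ‖HH f e q - G₀ q.1‖ < ‖G₀ q.1‖ := fun q => by
    rw [heG, add_sub_cancel_left, norm_smul, Real.norm_of_nonneg (by norm_num)]
    have h1 := norm_sub_le (h q.1) (h q.1.swap)
    have h2 := hhδ q.1
    have h3 := hhδ q.1.swap
    have h4 : ‖G₀ q.1.swap‖ = ‖G₀ q.1‖ := by
      rw [show q.1.swap = (q.1.2, q.1.1) from rfl, hG₀s, norm_neg]
    have h5 := norm_pos_iff.2 (hG₀0 q.1 q.2)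
    linarith
  have hes0 : ∀ q, e₀ q = 0 → e q = 0 := fun q hq => by
    have h1 : e₀ q.swap = 0 := by
      have h2 : e₀ q.swap = -e₀ q := by
        have := hG₀s q.1 q.2
        simp only [e₀, Prod.swap, this]
        abel
      rw [h2, hq, neg_zero]
    simp only [e, he'0 _ hq, he'0 _ h1, sub_zero, smul_zero]
  have hSt : C.St f e :=
    { cont := hf
      smooth := hs
      imm := hi
      CLf := hfL
      econt := by fun_prop
      eodd := fun x y => by simp only [e, Prod.swap]; module
      eL := fun x hx y hy => hes0 _ (he₀L x hx y hy)
      ediag := fun u => (hgd u).mono fun q hq => hes0 _ (he₀g q hq)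
      CLe := CL.lip_comp hL (he'CL.sub (CL.comp_lip he'CL hswap))
      ne := fun x y hxy h0 => by
        have h1 := hsmall ⟨(x, y), hxy⟩
        rw [show HH f e ⟨(x, y), hxy⟩ = 0 from h0, zero_sub, norm_neg] at h1
        exact lt_irrefl _ h1 }
  have hOdd : IsOdd fun z : DP N => G₀ z.1 :=
    ⟨by fun_prop, fun z => hG₀s _ _, fun z => hG₀0 _ z.2⟩
  refine ⟨e, hSt, (ElemHom.of_segment hg hOdd fun z s h0 h1 => ?_).aHom.trans
    (ElemHom.of_segment hOdd hSt.isOdd fun z s h0 h1 => add_smul_ne_zero (hsmall z) h0 h1).aHom⟩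
  rw [hG₀z, smul_smul, ← add_smul]
  have := convex_pos one_pos (hl0 z) h0 h1
  rw [mul_one] at this
  exact smul_ne_zero this.ne' (hg.ne z)

theorem exists_embedding (C : Cell N p) [CompactSpace N] [SecondCountableTopology N]
    [MeasurableSpace N] [BorelSpace N] (hpm : p + 1 < m)
    (hN : μH[2 * (m : ℝ) - 2] (univ : Set (N × N × N)) = 0)
    (hY : μH[2 * (m : ℝ) - 2] (univ : Set (EuclideanSpace ℝ (Fin p) × EuclideanSpace ℝ (Fin p) × N)) = 0)
    {f : N → Fin m → ℝ} (hf : Continuous f) (hfL : CL f C.L) {g : DP N → Fin m → ℝ} (hg : IsOdd g)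
    (hgL : ∀ z : DP N, z.1.1 ∈ C.L → z.1.2 ∈ C.L → g z = f z.1.1 - f z.1.2) :
    ∃ F : N → Fin m → ℝ, Continuous F ∧ Function.Injective F ∧ CL F univ ∧
      AHom g (fun q => F q.1.1 - F q.1.2) := by
  have hχ := C.continuous_χ
  have hd := C.continuous_d
  obtain ⟨q, hq, hqCL, hqodd, hqg⟩ := exists_odd_CL_approx (q := fun v => g (C.opp v 0))
    (hg.cont.comp (C.continuous_opp.comp (by fun_prop : Continuous fun v => (v, (0 : EuclideanSpace ℝ (Fin p))))))
    (fun v => by rw [C.opp_neg, hg.odd]) (fun v => hg.ne _)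
  obtain ⟨φ, hφ, hφf, hi, htr⟩ := exists_immersion_transverse hpm (f₀ := f ∘ C.χ) (by fun_prop)
    (γ := fun u => C.d (C.χ u)) (by fun_prop) C.d_χ_pos hqCL
  have hφc := hφ.continuous
  have hext : Continuous (C.ext fun u => φ u - f (C.χ u)) :=
    C.continuous_ext (b := C.d) (by fun_prop) hd (fun x hx => C.d_eq_zero.2 hx) hφf
  let f₁ : N → Fin m → ℝ := fun x => f x + C.ext (fun u => φ u - f (C.χ u)) x
  have hf₁ : Continuous f₁ := by fun_prop
  have hf₁L : ∀ x ∈ C.L, f₁ x = f x := fun x hx => by simp only [f₁, C.ext_of_mem _ hx, add_zero]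
  have hf₁χ : f₁ ∘ C.χ = φ := by
    ext u : 1
    simp only [f₁, Function.comp_apply, C.ext_χ]
    abel
  rw [← hf₁χ] at hφ hi htr
  obtain ⟨g₂, hg₂, hgg₂, hg₂L, hg₂d⟩ := C.exists_standard_near_diagonal hg hφ hi hq hqodd hqg htr
  obtain ⟨e, hSt, hHom⟩ := C.exists_St hf₁ hφ hi (hfL.congr fun x hx => (hf₁L x hx).symm) hg₂
    (fun z h1 h2 => by rw [hg₂L z h1 h2, hgL z h1 h2, hf₁L _ h1, hf₁L _ h2]) hg₂d
  obtain ⟨F, h1, h2, h3, h4⟩ := hSt.exists_embedding hN hY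
  exact ⟨F, h1, h2, h3, hgg₂.trans (hHom.trans h4)⟩

end Cell

end

section

theorem CL.of_nhds {X Y : Type*} [PseudoEMetricSpace X] [SecondCountableTopology X]
    [PseudoEMetricSpace Y] {F : X → Y} {T : Set X}
    (h : ∀ x ∈ T, ∃ K : ℝ≥0, ∃ t ∈ 𝓝 x, LipschitzOnWith K F t) : CL F T := by
  choose! K t ht hK using h
  obtain ⟨s, hsT, hsc, hs⟩ := TopologicalSpace.countable_cover_nhdsWithin
    (s := T) (f := t) fun x hx => mem_nhdsWithin_of_mem_nhds (ht x hx)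
  rcases s.eq_empty_or_nonempty with rfl | hne
  · exact ⟨fun _ => ∅, fun x hx => by simpa using hs hx, fun n => ⟨0, by simp⟩⟩
  · obtain ⟨e, he⟩ := hsc.exists_eq_range hne
    refine ⟨fun n => t (e n), ?_, fun n => ⟨K (e n), hK _ (hsT (he ▸ mem_range_self n))⟩⟩
    intro x hx
    obtain ⟨y, hy, hxy⟩ := mem_iUnion₂.1 (hs hx)
    rw [he] at hy
    obtain ⟨n, rfl⟩ := hy
    exact mem_iUnion.2 ⟨n, hxy⟩

section Simplex

variable {E : Type*} [NormedAddCommGroup E] [NormedSpace ℝ E]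

theorem exists_barycentric {ι : Type*} {v : ι → E} (hv : AffineIndependent ℝ v) (k : ι) :
    ∃ (l : E →ₗ[ℝ] ℝ) (a : ℝ), l (v k) + a = 1 ∧ ∀ j ≠ k, l (v j) + a = 0 := by
  have hli := (affineIndependent_iff_linearIndependent_vsub ℝ v k).1 hv
  let b := Module.Basis.span hli
  obtain ⟨l, hl⟩ := LinearMap.exists_extend (b.constr ℝ fun _ => (-1 : ℝ))
  refine ⟨l, 1 - l (v k), by ring, fun j hj => ?_⟩
  have h1 := LinearMap.congr_fun hl (b ⟨j, hj⟩)
  rw [Module.Basis.constr_basis] at h1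
  simp only [LinearMap.comp_apply, Submodule.subtype_apply, b, Module.Basis.span_apply, vsub_eq_sub,
    map_sub] at h1
  linarith

theorem mem_convexHull_range_iff {ι : Type*} [Fintype ι] {v : ι → E} {x : E} :
    x ∈ convexHull ℝ (range v) ↔ ∃ w : ι → ℝ, (∀ i, 0 ≤ w i) ∧ ∑ i, w i = 1 ∧ ∑ i, w i • v i = x := by
  constructor
  · intro hx
    refine convexHull_min (t := {x | ∃ w : ι → ℝ, (∀ i, 0 ≤ w i) ∧ ∑ i, w i = 1 ∧ ∑ i, w i • v i = x})
      ?_ ?_ hx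
    · classical
      rintro _ ⟨i, rfl⟩
      exact ⟨Pi.single i 1, fun j => by by_cases h : j = i <;> simp [Pi.single_apply, h],
        by simp [Pi.single_apply], by simp [Pi.single_apply]⟩
    · rintro _ ⟨w, hw, hw1, rfl⟩ _ ⟨w', hw', hw1', rfl⟩ a b ha hb hab
      refine ⟨fun i => a * w i + b * w' i, fun i => by have := hw i; have := hw' i; positivity, ?_, ?_⟩
      · rw [Finset.sum_add_distrib, ← Finset.mul_sum, ← Finset.mul_sum, hw1, hw1', mul_one, mul_one, hab]
      · simp only [add_smul, mul_smul, Finset.sum_add_distrib, Finset.smul_sum]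
  · rintro ⟨w, hw, hw1, rfl⟩
    exact (convex_convexHull ℝ _).sum_mem (fun i _ => hw i) hw1 fun i _ => subset_convexHull _ _ (mem_range_self i)

variable [FiniteDimensional ℝ E]

/-- Attaching a simplex along its boundary attaches an open cell. -/
theorem exists_cell {p : ℕ} {v : Fin (p + 1) → E} (hv : AffineIndependent ℝ v) {S S' : Set E}
    (hS : IsClosed S) (hS' : S' = S ∪ convexHull ℝ (range v))
    (hSv : ∀ x ∈ S, x ∈ convexHull ℝ (range v) → ∃ k, x ∈ convexHull ℝ (v '' {k}ᶜ))
    (hvS : ∀ k, convexHull ℝ (v '' {k}ᶜ) ⊆ S) :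
    ∃ C : Cell S' p, C.L = Subtype.val ⁻¹' S := by
  choose l a hl1 hl0 using fun k => exists_barycentric hv k
  let c : Fin (p + 1) → E → ℝ := fun k x => l k x + a k
  have hcc : ∀ k, ContDiff ℝ 1 (c k) := fun k =>
    ((l k).toContinuousLinearMap.contDiff).add contDiff_const
  have hcv : ∀ (w : Fin (p + 1) → ℝ), ∑ i, w i = 1 → ∀ k, c k (∑ i, w i • v i) = w k := by
    intro w hw k
    have h1 : c k (∑ i, w i • v i) = ∑ i, w i * (l k (v i) + a k) := by
      simp only [c, map_sum, map_smul, smul_eq_mul, mul_add, Finset.sum_add_distrib, ← Finset.sum_mul, hw,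
        one_mul]
    rw [h1, Finset.sum_eq_single k (fun j _ hj => by rw [hl0 k j hj, mul_zero]) (by simp), hl1, mul_one]
  have hface : ∀ k, ∀ x ∈ convexHull ℝ (v '' {k}ᶜ), c k x = 0 := by
    intro k x hx
    have : x ∈ {x | l k x = -a k} := by
      refine convexHull_min ?_ (convex_hyperplane (l k).isLinear _) hx
      rintro _ ⟨j, hj, rfl⟩
      have := hl0 k j hj
      simp only [mem_setOf_eq]; linarith
    simp only [mem_setOf_eq] at this
    simp [c, this]
  have hinter : ∀ w : Fin (p + 1) → ℝ, (∀ i, 0 < w i) → ∑ i, w i = 1 → ∑ i, w i • v i ∉ S := by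
    intro w hw hw1 hx
    obtain ⟨k, hk⟩ := hSv _ hx (mem_convexHull_range_iff.2 ⟨w, fun i => (hw i).le, hw1, rfl⟩)
    have := hface k _ hk
    rw [hcv w hw1] at this
    exact (hw k).ne' this
  have hout : ∀ x ∈ S', x ∉ S → ∃ w : Fin (p + 1) → ℝ, (∀ i, 0 < w i) ∧ ∑ i, w i = 1 ∧ ∑ i, w i • v i = x := by
    intro x hx hxS
    rw [hS'] at hx
    obtain ⟨w, hw, hw1, rfl⟩ := mem_convexHull_range_iff.1 (hx.resolve_left hxS)
    refine ⟨w, fun k => lt_of_le_of_ne (hw k) fun h0 => hxS (hvS k ?_), hw1, rfl⟩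
    have h1 : ∑ i ∈ Finset.univ.erase k, w i = 1 := by
      rw [← hw1, ← Finset.add_sum_erase _ _ (Finset.mem_univ k), ← h0, zero_add]
    have h2 : ∑ i, w i • v i = ∑ i ∈ Finset.univ.erase k, w i • v i := by
      rw [← Finset.add_sum_erase _ _ (Finset.mem_univ k), ← h0, zero_smul, zero_add]
    rw [h2]
    exact (convex_convexHull ℝ _).sum_mem (fun i _ => hw i) h1 fun i hi =>
      subset_convexHull _ _ ⟨i, by simpa using hi, rfl⟩
  let q : EuclideanSpace ℝ (Fin p) → Fin (p + 1) → ℝ := fun y => Fin.cons 1 fun i => Real.exp (y i)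
  have hq : ∀ y k, 0 < q y k := fun y k => by
    refine Fin.cases ?_ (fun i => ?_) k <;> simp [q, Real.exp_pos]
  have hqc : ∀ k, ContDiff ℝ 1 fun y => q y k := fun k => by
    refine Fin.cases ?_ (fun i => ?_) k
    · simp only [q, Fin.cons_zero]; fun_prop
    · simp only [q, Fin.cons_succ]; fun_prop
  let Z : EuclideanSpace ℝ (Fin p) → ℝ := fun y => ∑ k, q y k
  have hZ : ∀ y, 0 < Z y := fun y => Finset.sum_pos (fun k _ => hq y k) ⟨0, Finset.mem_univ _⟩
  have hZc : ContDiff ℝ 1 Z := ContDiff.sum fun k _ => hqc k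
  have hw0 : ∀ y k, 0 < q y k / Z y := fun y k => div_pos (hq y k) (hZ y)
  have hw1 : ∀ y, ∑ k, q y k / Z y = 1 := fun y => by
    rw [← Finset.sum_div]; exact div_self (hZ y).ne'
  let X : EuclideanSpace ℝ (Fin p) → E := fun y => ∑ k, (q y k / Z y) • v k
  have hXc : ContDiff ℝ 1 X := ContDiff.sum fun k _ =>
    (((hqc k).div hZc fun y => (hZ y).ne').smul contDiff_const)
  have hXS' : ∀ y, X y ∈ S' := fun y => by
    rw [hS']
    exact Or.inr (mem_convexHull_range_iff.2 ⟨_, fun i => (hw0 y i).le, hw1 y, rfl⟩)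
  let R : E → EuclideanSpace ℝ (Fin p) := fun x =>
    WithLp.toLp 2 fun i => Real.log (c i.succ x) - Real.log (c 0 x)
  have hRX : ∀ y, R (X y) = y := by
    intro y
    ext i
    simp only [R, X]
    rw [hcv _ (hw1 y), hcv _ (hw1 y), Real.log_div (hq _ _).ne' (hZ y).ne',
      Real.log_div (hq _ _).ne' (hZ y).ne']
    simp [q]
  have hXR : ∀ w : Fin (p + 1) → ℝ, (∀ i, 0 < w i) → ∑ i, w i = 1 →
      X (R (∑ i, w i • v i)) = ∑ i, w i • v i := by
    intro w hw hw1
    set x := ∑ i, w i • v i with hx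
    have h1 : ∀ k, q (R x) k = w k / w 0 := by
      intro k
      refine Fin.cases ?_ (fun i => ?_) k
      · simp [q, (hw 0).ne']
      · simp only [q, R, Fin.cons_succ]
        rw [hx, hcv w hw1, hcv w hw1, ← Real.log_div (hw _).ne' (hw 0).ne',
          Real.exp_log (div_pos (hw _) (hw 0))]
    have h2 : Z (R x) = 1 / w 0 := by
      simp only [Z, h1, ← Finset.sum_div, hw1]
    simp only [X, h1, h2]
    rw [hx]
    refine Finset.sum_congr rfl fun i _ => ?_
    congr 1
    have := (hw 0).ne'
    field_simp
  let O : Set E := {x | ∀ k, 0 < c k x}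
  have hRO : ∀ x ∈ O, ContDiffAt ℝ 1 R x := by
    intro x hx
    refine (PiLp.contDiff_toLp (𝕜 := ℝ) (p := 2)).contDiffAt.comp x (contDiffAt_pi.2 fun i => ?_)
    exact ((hcc _).contDiffAt.log (hx _).ne').sub ((hcc _).contDiffAt.log (hx _).ne')
  have hLO : ∀ x ∈ S', x ∉ S → x ∈ O := by
    intro x hx hxS k
    obtain ⟨w, hw, hw1, rfl⟩ := hout x hx hxS
    rw [hcv w hw1]; exact hw k
  let L : Set S' := Subtype.val ⁻¹' S
  have hL : IsClosed L := hS.preimage continuous_subtype_val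
  let χ : EuclideanSpace ℝ (Fin p) → S' := fun y => ⟨X y, hXS' y⟩
  let ρ : S' → EuclideanSpace ℝ (Fin p) := fun x => R x
  have hχc : Continuous χ := hXc.continuous.subtype_mk _
  have hρχ : ∀ y, ρ (χ y) = y := hRX
  have hχρ : ∀ x ∈ Lᶜ, χ (ρ x) = x := by
    rintro ⟨x, hx⟩ hxL
    obtain ⟨w, hw, hw1, rfl⟩ := hout x hx hxL
    exact Subtype.ext (hXR w hw hw1)
  have hχL : ∀ y, χ y ∈ Lᶜ := fun y => hinter _ (hw0 y) (hw1 y)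
  have hρc : ContinuousOn ρ Lᶜ := fun x hx =>
    ((hRO x (hLO x x.2 hx)).continuousAt.comp continuousAt_subtype_val).continuousWithinAt
  have hsec : SecondCountableTopology E := inferInstance
  refine ⟨⟨L, χ, ρ, hL, ?_, ?_, hρχ, ?_, ?_⟩, rfl⟩
  · refine IsOpenEmbedding.of_continuous_injective_isOpenMap hχc
      (Function.LeftInverse.injective hρχ) fun U hU => ?_
    have : χ '' U = Lᶜ ∩ ρ ⁻¹' U := by
      ext x
      constructor
      · rintro ⟨y, hy, rfl⟩
        exact ⟨hχL y, by simpa only [mem_preimage, hρχ] using hy⟩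
      · rintro ⟨hx, hxU⟩
        exact ⟨ρ x, hxU, hχρ x hx⟩
    rw [this]
    exact hρc.isOpen_inter_preimage hL.isOpen_compl hU
  · ext x
    constructor
    · rintro ⟨y, rfl⟩; exact hχL y
    · intro hx; exact ⟨ρ x, hχρ x hx⟩
  · exact CL.of_nhds fun x _ => by
      obtain ⟨K, t, ht, hK⟩ := hXc.contDiffAt.exists_lipschitzOnWith (x := x)
      exact ⟨K, t, ht, hK⟩
  · have h1 : CL R O := CL.of_nhds fun x hx => (hRO x hx).exists_lipschitzOnWith
    exact h1.comp (LipschitzWith.subtype_val S' |>.CL _) fun x hx => hLO x x.2 hx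

end Simplex

end

section

section Dimension

theorem lipschitzWith_prodMap {X Y X' Y' : Type*} [PseudoEMetricSpace X] [PseudoEMetricSpace Y]
    [PseudoEMetricSpace X'] [PseudoEMetricSpace Y'] {f : X → Y} {f' : X' → Y'} {K K' : ℝ≥0}
    (hf : LipschitzWith K f) (hf' : LipschitzWith K' f') :
    LipschitzWith (max (K * 1) (K' * 1)) (Prod.map f f') :=
  (hf.comp LipschitzWith.prod_fst).prodMk (hf'.comp LipschitzWith.prod_snd)

variable {E : Type*} [NormedAddCommGroup E] [NormedSpace ℝ E] [FiniteDimensional ℝ E]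

/-- The set `S` is covered by countably many Lipschitz images of `ℝⁿ`. -/
def CovBy (n : ℕ) (S : Set E) : Prop :=
  ∃ Φ : ℕ → (Fin n → ℝ) → E, (∀ i, ∃ K, LipschitzWith K (Φ i)) ∧ S ⊆ ⋃ i, range (Φ i)

theorem CovBy.of_finite {n : ℕ} {A : Finset (Finset E)} (hA : ∀ s ∈ A, s.card ≤ n + 1) :
    CovBy n (⋃ s ∈ A, convexHull ℝ (s : Set E)) := by
  have key : ∀ s : Finset E, s.card ≤ n + 1 → ∃ φ : (Fin n → ℝ) → E,
      (∃ K, LipschitzWith K φ) ∧ convexHull ℝ (s : Set E) ⊆ range φ := by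
    intro s hs
    rcases s.eq_empty_or_nonempty with rfl | hne
    · exact ⟨fun _ => 0, ⟨0, LipschitzWith.const 0⟩, by simp⟩
    · have : Nonempty s := hne.to_subtype
      obtain ⟨e⟩ : Nonempty (s ↪ Fin (n + 1)) := Function.Embedding.nonempty_of_card_le (by simpa using hs)
      let r : Fin (n + 1) → s := Function.invFun e
      have hr : ∀ x, r (e x) = x := Function.leftInverse_invFun e.injective
      let v : Fin (n + 1) → E := fun i => r i
      have hv : (s : Set E) ⊆ range v := fun x hx =>
        ⟨e ⟨x, hx⟩, by simp only [v, hr]⟩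
      let l : (Fin n → ℝ) →ₗ[ℝ] E := Fintype.linearCombination ℝ fun i : Fin n => v i.succ - v 0
      refine ⟨fun t => v 0 + l t, ⟨_, (LipschitzWith.const (v 0)).add l.toContinuousLinearMap.lipschitz⟩, ?_⟩
      intro x hx
      obtain ⟨w, hw, hw1, rfl⟩ := mem_convexHull_range_iff.1 (convexHull_mono hv hx)
      refine ⟨fun i => w i.succ, ?_⟩
      rw [Fin.sum_univ_succ] at hw1 ⊢
      have h1 : w 0 = 1 - ∑ i : Fin n, w i.succ := by linarith
      simp only [l, Fintype.linearCombination_apply, smul_sub, Finset.sum_sub_distrib]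
      rw [← Finset.sum_smul, h1, sub_smul, one_smul]
      abel
  choose! φ hφ hcov using key
  rcases A.eq_empty_or_nonempty with rfl | hne
  · exact ⟨fun _ _ => 0, fun i => ⟨0, LipschitzWith.const 0⟩, by simp⟩
  · obtain ⟨e, he⟩ := A.countable_toSet.exists_eq_range hne
    refine ⟨fun i => φ (e i), fun i => hφ _ (hA _ ?_), ?_⟩
    · have : e i ∈ (A : Set (Finset E)) := he ▸ mem_range_self i
      exact this
    · refine iUnion₂_subset fun s hs => ?_
      have : s ∈ range e := he ▸ (hs : s ∈ (A : Set (Finset E)))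
      obtain ⟨i, rfl⟩ := this
      exact (hcov _ (hA _ hs)).trans (subset_iUnion (fun i => range (φ (e i))) i)

variable {n : ℕ} {S : Set E}

theorem CovBy.dimH_triple (h : CovBy n S) :
    dimH (univ : Set (S × S × S)) ≤ (3 * n : ℕ) := by
  obtain ⟨Φ, hΦ, hS⟩ := h
  choose K hK using hΦ
  let j : S × S × S → E × E × E := Prod.map Subtype.val (Prod.map Subtype.val Subtype.val)
  have hj : Isometry j := isometry_subtype_coe.prodMap (isometry_subtype_coe.prodMap isometry_subtype_coe)
  rw [← hj.dimH_image]
  have h1 : j '' univ ⊆ ⋃ q : ℕ × ℕ × ℕ, range (Prod.map (Φ q.1) (Prod.map (Φ q.2.1) (Φ q.2.2))) := by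
    rintro _ ⟨⟨x, y, z⟩, -, rfl⟩
    obtain ⟨a, u, hu⟩ := mem_iUnion.1 (hS x.2)
    obtain ⟨b, v, hv⟩ := mem_iUnion.1 (hS y.2)
    obtain ⟨c, w, hw⟩ := mem_iUnion.1 (hS z.2)
    exact mem_iUnion.2 ⟨(a, b, c), (u, v, w), by simp [j, hu, hv, hw]⟩
  refine (dimH_mono h1).trans ?_
  rw [dimH_iUnion]
  refine iSup_le fun q => ?_
  refine (LipschitzWith.dimH_range_le
    (lipschitzWith_prodMap (hK q.1) (lipschitzWith_prodMap (hK q.2.1) (hK q.2.2)))).trans ?_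
  rw [Real.dimH_univ_eq_finrank]
  simp only [Module.finrank_prod, Module.finrank_fin_fun]
  exact_mod_cast (by omega : n + (n + n) ≤ 3 * n)

theorem CovBy.dimH_prod (h : CovBy n S) {p : ℕ} :
    dimH (univ : Set (EuclideanSpace ℝ (Fin p) × EuclideanSpace ℝ (Fin p) × S)) ≤ (2 * p + n : ℕ) := by
  obtain ⟨Φ, hΦ, hS⟩ := h
  choose K hK using hΦ
  let j : EuclideanSpace ℝ (Fin p) × EuclideanSpace ℝ (Fin p) × S →
      EuclideanSpace ℝ (Fin p) × EuclideanSpace ℝ (Fin p) × E := Prod.map id (Prod.map id Subtype.val)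
  have hj : Isometry j := isometry_id.prodMap (isometry_id.prodMap isometry_subtype_coe)
  rw [← hj.dimH_image]
  have h1 : j '' univ ⊆ ⋃ i : ℕ, range (Prod.map (id : EuclideanSpace ℝ (Fin p) → _)
      (Prod.map (id : EuclideanSpace ℝ (Fin p) → _) (Φ i))) := by
    rintro _ ⟨⟨x, y, z⟩, -, rfl⟩
    obtain ⟨c, w, hw⟩ := mem_iUnion.1 (hS z.2)
    exact mem_iUnion.2 ⟨c, (x, y, w), by simp [j, hw]⟩
  refine (dimH_mono h1).trans ?_
  rw [dimH_iUnion]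
  refine iSup_le fun i => ?_
  refine (LipschitzWith.dimH_range_le
    (lipschitzWith_prodMap LipschitzWith.id (lipschitzWith_prodMap LipschitzWith.id (hK i)))).trans ?_
  rw [Real.dimH_univ_eq_finrank]
  simp only [Module.finrank_prod, Module.finrank_fin_fun, finrank_euclideanSpace, Fintype.card_fin]
  exact_mod_cast (by omega : p + (p + n) ≤ 2 * p + n)

end Dimension

section Induction

variable {E : Type*} [NormedAddCommGroup E] [NormedSpace ℝ E] [FiniteDimensional ℝ E] {m n : ℕ}

/-- An equivariant map on the deleted product of `X` is realised on `S` by an injective map. -/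
def Realised (X : Set E) (m : ℕ) (S : Set E) : Prop :=
  ∃ f : E → Fin m → ℝ, Continuous f ∧ InjOn f S ∧ CL f S ∧ ∃ g : DP X → Fin m → ℝ, IsOdd g ∧
    ∀ p : DP X, (p.1.1 : E) ∈ S → (p.1.2 : E) ∈ S → g p = f p.1.1 - f p.1.2

theorem Realised.step {X S S' : Set E} {p : ℕ} (h : Realised X m S) (hS'X : S' ⊆ X)
    (hS' : IsCompact S') (C : Cell S' p) (hC : C.L = Subtype.val ⁻¹' S) (hpn : p ≤ n)
    (hcov : CovBy n S') (hmn : 3 * n + 3 ≤ 2 * m) : Realised X m S' := by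
  obtain ⟨f, hf, hinj, hCL, g, hg, hgf⟩ := h
  have : CompactSpace S' := isCompact_iff_compactSpace.1 hS'
  have hproper : ProperSpace E := FiniteDimensional.proper ℝ E
  let : MeasurableSpace E := borel E
  have : BorelSpace E := ⟨rfl⟩
  have hsec : SecondCountableTopology E := inferInstance
  have hm : (3 * n + 3 : ℝ) ≤ 2 * m := by exact_mod_cast hmn
  have hn0 : (0 : ℝ) ≤ n := Nat.cast_nonneg n
  have hd0 : (0 : ℝ) ≤ 2 * m - 2 := by linarith
  have hlt : ∀ k : ℕ, k ≤ 3 * n → (k : ℝ≥0∞) < ENNReal.ofReal (2 * (m : ℝ) - 2) := by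
    intro k hk
    rw [← ENNReal.ofReal_natCast]
    refine (ENNReal.ofReal_lt_ofReal_iff_of_nonneg (Nat.cast_nonneg k)).2 ?_
    have : (k : ℝ) ≤ 3 * n := by exact_mod_cast hk
    linarith
  let j : S' → X := inclusion hS'X
  have hj : IsClosedEmbedding j := by
    refine IsClosedEmbedding.of_continuous_injective_isClosedMap (continuous_inclusion hS'X)
      (inclusion_injective hS'X) (continuous_inclusion hS'X).isClosedMap
  obtain ⟨F, hF, hFinj, hFCL, hom⟩ := C.exists_embedding (m := m) (by omega)
    (hausdorffMeasure_univ_eq_zero hd0 (hcov.dimH_triple.trans_lt (hlt _ le_rfl)))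
    (hausdorffMeasure_univ_eq_zero hd0 (hcov.dimH_prod.trans_lt (hlt _ (by omega))))
    (f := fun x => f x) (hf.comp continuous_subtype_val)
    (hCL.comp ((LipschitzWith.subtype_val S').CL _) fun x hx => by rw [hC] at hx; exact hx)
    (g := g ∘ DP.map j hj.injective)
    ⟨hg.cont.comp (DP.isClosedEmbedding_map hj).continuous, fun z => hg.odd (DP.map j hj.injective z),
      fun z => hg.ne _⟩
    (fun z h1 h2 => by
      rw [hC] at h1 h2
      exact hgf (DP.map j hj.injective z) h1 h2)
  obtain ⟨g', hg', hgF⟩ := hom.exists_extension hj ⟨g, hg, fun z => rfl⟩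
  obtain ⟨G, hG⟩ := ContinuousMap.exists_extension' (hS'.isClosed.isClosedEmbedding_subtypeVal)
    (⟨F, hF⟩ : C(S', Fin m → ℝ))
  have hGF : ∀ x : S', G x = F x := fun x => congrFun hG x
  refine ⟨G, G.continuous, ?_, CL.of_subtype hFCL hGF, g', hg', ?_⟩
  · intro x hx y hy hxy
    have h1 := hGF ⟨x, hx⟩
    have h2 := hGF ⟨y, hy⟩
    simp only at h1 h2
    rw [h1, h2] at hxy
    exact congrArg Subtype.val (hFinj hxy)
  · rintro ⟨⟨x, y⟩, hxy⟩ hx hy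
    have h1 := hgF ⟨(⟨x, hx⟩, ⟨y, hy⟩), fun h => hxy (Subtype.ext (congrArg Subtype.val h :))⟩
    have h3 := hGF ⟨x, hx⟩
    have h4 := hGF ⟨y, hy⟩
    simp only at h1 h3 h4
    simp only [h3, h4]
    exact h1

open Geometry in
theorem Realised.of_faces {K : SimplicialComplex ℝ E} (hdim : ∀ s ∈ K.faces, s.card ≤ n + 1)
    (hmn : 3 * n + 3 ≤ 2 * m) {g : DP K.space → Fin m → ℝ} (hg : IsOdd g) (k : ℕ) :
    ∀ A : Finset (Finset E), A.card = k → (∀ s ∈ A, s ∈ K.faces) →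
      (∀ s ∈ A, ∀ t ⊆ s, t.Nonempty → t ∈ A) →
      Realised K.space m (⋃ s ∈ A, convexHull ℝ (s : Set E)) := by
  classical
  induction k with
  | zero =>
    intro A hA _ _
    rw [Finset.card_eq_zero] at hA
    subst hA
    exact ⟨fun _ => 0, continuous_const, by simp, (LipschitzWith.const _).CL _, g, hg, by simp⟩
  | succ k ih =>
    intro A hA hAK hlow
    have hne : A.Nonempty := Finset.card_pos.1 (by omega)
    obtain ⟨s, hs, hmax⟩ := A.exists_max_image Finset.card hne
    have hsK := hAK s hs
    have hsne := SimplicialComplex.nonempty_of_mem_faces hsK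
    obtain ⟨p, hp⟩ : ∃ p, s.card = p + 1 := ⟨s.card - 1, by have := hsne.card_pos; omega⟩
    have hpn : p ≤ n := by have := hdim s hsK; omega
    let B := A.erase s
    have hBlow : ∀ u ∈ B, ∀ t ⊆ u, t.Nonempty → t ∈ B := by
      intro u hu t ht htn
      have hu' := Finset.mem_erase.1 hu
      refine Finset.mem_erase.2 ⟨?_, hlow u hu'.2 t ht htn⟩
      rintro rfl
      exact hu'.1 (Finset.eq_of_subset_of_card_le ht (hmax u hu'.2)).symm
    have hB := ih B (by rw [Finset.card_erase_of_mem hs]; omega)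
      (fun u hu => hAK u (Finset.mem_of_mem_erase hu)) hBlow
    let e : Fin (p + 1) ≃ s := (s.equivFinOfCardEq hp).symm
    let v : Fin (p + 1) → E := fun i => e i
    have hv : AffineIndependent ℝ v := (K.indep hsK).comp_embedding e.toEmbedding
    have hvr : range v = (s : Set E) := by
      have : range v = Subtype.val '' range e := by rw [← range_comp]; rfl
      rw [this, e.range_eq_univ]; simp
    have hvinj : Function.Injective v := Subtype.val_injective.comp e.injective
    have himg : ∀ i, v '' {i}ᶜ = ((s.erase (v i) : Finset E) : Set E) := by
      intro i
      rw [image_compl_eq_range_sdiff_image hvinj, hvr, image_singleton, Finset.coe_erase]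
    have hcl : ∀ D : Finset (Finset E), IsCompact (⋃ s ∈ D, convexHull ℝ (s : Set E)) := fun D =>
      D.isCompact_biUnion fun s _ => s.finite_toSet.isCompact_convexHull (𝕜 := ℝ)
    have hunion : (⋃ t ∈ A, convexHull ℝ (t : Set E)) =
        (⋃ t ∈ B, convexHull ℝ (t : Set E)) ∪ convexHull ℝ (range v) := by
      rw [hvr, ← Finset.insert_erase hs, Finset.set_biUnion_insert, union_comm]
    obtain ⟨C, hC⟩ := exists_cell hv (hcl B).isClosed hunion (by
      intro x hx hxv
      obtain ⟨t, ht, hxt⟩ := mem_iUnion₂.1 hx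
      rw [hvr] at hxv
      have htA := Finset.mem_of_mem_erase ht
      have h1 := K.inter_subset_convexHull hsK (hAK t htA) ⟨hxv, hxt⟩
      have h2 : ¬ s ⊆ t := fun hst => by
        have := hBlow t ht s hst hsne
        simp [B] at this
      obtain ⟨y, hys, hyt⟩ := Finset.not_subset.1 h2
      have : y ∈ range v := by rw [hvr]; exact hys
      obtain ⟨i, rfl⟩ := this
      refine ⟨i, convexHull_mono ?_ h1⟩
      rw [himg]
      rintro z ⟨hz1, hz2⟩
      exact Finset.mem_erase.2 ⟨fun h => hyt (h ▸ hz2), hz1⟩) (by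
      intro i x hx
      rw [himg] at hx
      have hne' : (s.erase (v i)).Nonempty := by
        rw [← Finset.coe_nonempty, ← convexHull_nonempty_iff (𝕜 := ℝ)]
        exact ⟨x, hx⟩
      have hvi : v i ∈ s := (e i).2
      refine mem_iUnion₂.2 ⟨s.erase (v i), Finset.mem_erase.2 ⟨?_, hlow s hs _ (Finset.erase_subset _ _) hne'⟩, hx⟩
      intro h
      have : v i ∈ s.erase (v i) := by rw [h]; exact hvi
      simp at this)
    exact hB.step (iUnion₂_subset fun t ht => SimplicialComplex.convexHull_subset_space (hAK t ht)) (hcl A) C hC hpn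
      (CovBy.of_finite fun t ht => hdim t (hAK t ht)) hmn

end Induction

end

end HW

/-- C. Weber, 1967: For a finite geometric simplicial complex K of
dimension at most n with 2m ≥ 3n + 3, there is a topological embedding |K| → ℝ^m iff
there is a continuous equivariant map from the deleted product of |K| to S^{m-1}. -/
theorem stmt_12 {N : ℕ} (K : Geometry.SimplicialComplex ℝ (EuclideanSpace ℝ (Fin N)))
    (hfin : K.faces.Finite) (n m : ℕ) (hdim : ∀ s ∈ K.faces, s.card ≤ n + 1)
    (hmn : 3 * n + 3 ≤ 2 * m) :
    (∃ f : K.space → EuclideanSpace ℝ (Fin m), Continuous f ∧ Function.Injective f) ↔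
    (∃ g : {p : K.space × K.space // p.1 ≠ p.2} →
        Metric.sphere (0 : EuclideanSpace ℝ (Fin m)) 1,
      Continuous g ∧
      ∀ p q : {p : K.space × K.space // p.1 ≠ p.2}, q.1 = (p.1.2, p.1.1) →
        (g q : EuclideanSpace ℝ (Fin m)) = -(g p : EuclideanSpace ℝ (Fin m))) := by
  constructor
  · rintro ⟨f, hf, hinj⟩
    have hne : ∀ p : {p : K.space × K.space // p.1 ≠ p.2}, ‖f p.1.1 - f p.1.2‖ ≠ 0 := fun p =>
      norm_ne_zero_iff.2 (sub_ne_zero.2 fun h => p.2 (hinj h))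
    refine ⟨fun p => ⟨‖f p.1.1 - f p.1.2‖⁻¹ • (f p.1.1 - f p.1.2), ?_⟩, ?_, ?_⟩
    · rw [mem_sphere_zero_iff_norm, norm_smul, norm_inv, norm_norm, inv_mul_cancel₀ (hne p)]
    · have h1 : Continuous fun p : {p : K.space × K.space // p.1 ≠ p.2} => f p.1.1 - f p.1.2 := by fun_prop
      exact ((h1.norm.inv₀ hne).smul h1).subtype_mk _
    · intro p q hq
      simp only [hq]
      rw [norm_sub_rev, ← smul_neg, neg_sub]
  · rintro ⟨g, hg, hodd⟩
    have hK : HW.IsOdd (m := m) fun p : HW.DP K.space => WithLp.ofLp (g p : EuclideanSpace ℝ (Fin m)) := by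
      refine ⟨?_, fun p => ?_, fun p h0 => ?_⟩
      · exact (PiLp.continuous_ofLp 2 _).comp (continuous_subtype_val.comp hg)
      · rw [hodd p p.swap rfl]; rfl
      · have h1 : (g p : EuclideanSpace ℝ (Fin m)) = 0 := by ext i; exact congrFun h0 i
        have h2 := mem_sphere_zero_iff_norm.1 (g p).2
        rw [h1, norm_zero] at h2
        exact zero_ne_one h2
    obtain ⟨f, hf, hinj, -⟩ := HW.Realised.of_faces hdim hmn hK _ hfin.toFinset rfl (by simp)
      (by simpa using fun s hs t hts ht => K.down_closed hs hts ht)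
    have hsp : (⋃ s ∈ hfin.toFinset, convexHull ℝ (s : Set (EuclideanSpace ℝ (Fin N)))) = K.space := by
      simp [Geometry.SimplicialComplex.space]
    rw [hsp] at hinj
    refine ⟨fun x => WithLp.toLp 2 (f x), (PiLp.continuous_toLp 2 _).comp (hf.comp continuous_subtype_val), ?_⟩
    intro x y hxy
    exact Subtype.ext (hinj x.2 y.2 (by simpa using hxy))
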